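/- arXiv:2409.00934 — 3 statements merged into one kernel-verified Lean document; each statement's English description precedes it below -/
import Mathlib

section
/- For every s > 2 there exists a constant C₁ > 0 (depending only on s) with the following property: for every real random variable X with Lebesgue density p, E X = 0, Var(X) = 1, E|X|^s < ∞ and 0 < ‖p − φ‖_∞ ≤ 1/2, and for every ε > 0, D(X) ≤ C₁·(E|X|^s)^{2/s}·(√(|ln ‖p − φ‖_∞|)·‖p − φ‖_∞)^{1−2/s} ≤ C₁·M(ε)·(E|X|^s)^{2/s}·‖p − φ‖_∞^{(1−2/s)(1−ε)}, where M(ε) := sup_{x∈(0,1]} x^ε·√(|ln x|) + 1 < ∞. -/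
open MeasureTheory Real Filter
open scoped ENNReal

noncomputable section

/-- The standard Gaussian density on `ℝ`. -/
def gauss (x : ℝ) : ℝ := (Real.sqrt (2 * Real.pi))⁻¹ * Real.exp (-x ^ 2 / 2)

/-- The real-valued `L^q(ℝ)` norm. -/
def nrm (f : ℝ → ℝ) (q : ℝ≥0∞) : ℝ := (eLpNorm f q volume).toReal

/-- Kullback–Leibler divergence between densities:  `∫ p_X ln (p_X / p_Y)`. -/
def KLdiv (pX pY : ℝ → ℝ) : ℝ := ∫ x, pX x * Real.log (pX x / pY x)

/-- `M(ε) := sup_{x ∈ (0,1]} x^ε √|ln x| + 1`. -/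
def Mconst (ε : ℝ) : ℝ := (⨆ x ∈ Set.Ioc (0 : ℝ) 1, x ^ ε * Real.sqrt |Real.log x|) + 1

lemma gauss_eq_gaussianPDFReal : gauss = ProbabilityTheory.gaussianPDFReal 0 1 := by
  ext x
  simp [gauss, ProbabilityTheory.gaussianPDFReal]

lemma integrable_gauss : Integrable gauss := by
  rw [gauss_eq_gaussianPDFReal]
  exact ProbabilityTheory.integrable_gaussianPDFReal 0 1

lemma integral_gauss : ∫ x, gauss x = 1 := by
  rw [gauss_eq_gaussianPDFReal]
  exact ProbabilityTheory.integral_gaussianPDFReal_eq_one 0 one_ne_zero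

lemma gauss_pos (x : ℝ) : 0 < gauss x := by
  unfold gauss
  positivity

lemma sqrt_two_pi_mem_Ioo : Real.sqrt (2 * π) ∈ Set.Ioo (5 / 2 : ℝ) 3 := by
  have h1 := Real.pi_gt_d2
  have h2 := Real.pi_lt_d2
  constructor
  · apply Real.lt_sqrt_of_sq_lt
    nlinarith
  · rw [Real.sqrt_lt' (by norm_num)]
    nlinarith

lemma gauss_lt_half (x : ℝ) : gauss x < 1 / 2 := by
  have h := sqrt_two_pi_mem_Ioo.1
  have h1 : (Real.sqrt (2 * π))⁻¹ < 1 / 2 := by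
    rw [inv_lt_comm₀ (by linarith) (by norm_num)]
    linarith
  have h2 : Real.exp (-x ^ 2 / 2) ≤ 1 := Real.exp_le_one_iff.2 (by nlinarith [sq_nonneg x])
  calc gauss x ≤ (Real.sqrt (2 * π))⁻¹ * 1 := by unfold gauss; gcongr
    _ < 1 / 2 := by linarith

lemma gauss_le_shifts {T x : ℝ} (hT : 0 ≤ T) (hx : T < |x|) :
    gauss x ≤ Real.exp (-T ^ 2 / 2) * (gauss (x - T) + gauss (x + T)) := by
  have key : ∀ y, T ^ 2 + y ^ 2 ≤ x ^ 2 → gauss x ≤ Real.exp (-T ^ 2 / 2) * gauss y := by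
    intro y hy
    unfold gauss
    rw [mul_left_comm, ← Real.exp_add]
    gcongr
    linarith
  have hpos := Real.exp_pos (-T ^ 2 / 2)
  rw [mul_add]
  rcases lt_abs.1 hx with h | h
  · have := key (x - T) (by nlinarith)
    have := mul_pos hpos (gauss_pos (x + T))
    linarith
  · have := key (x + T) (by nlinarith)
    have := mul_pos hpos (gauss_pos (x - T))
    linarith

lemma setIntegral_gauss_tail_le {T : ℝ} (hT : 0 ≤ T) :
    ∫ x in (Set.Icc (-T) T)ᶜ, gauss x ≤ 2 * Real.exp (-T ^ 2 / 2) := by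
  have h1 : Integrable fun x => gauss (x - T) := integrable_gauss.comp_sub_right T
  have h2 : Integrable fun x => gauss (x + T) := integrable_gauss.comp_add_right T
  have hint : Integrable fun x => Real.exp (-T ^ 2 / 2) * (gauss (x - T) + gauss (x + T)) :=
    (h1.add h2).const_mul _
  calc ∫ x in (Set.Icc (-T) T)ᶜ, gauss x
      ≤ ∫ x in (Set.Icc (-T) T)ᶜ, Real.exp (-T ^ 2 / 2) * (gauss (x - T) + gauss (x + T)) := by
        refine setIntegral_mono_on integrable_gauss.integrableOn hint.integrableOn
          measurableSet_Icc.compl fun x hx => gauss_le_shifts hT ?_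
        rw [Set.mem_compl_iff, Set.mem_Icc, ← abs_le] at hx
        exact not_le.1 hx
    _ ≤ ∫ x, Real.exp (-T ^ 2 / 2) * (gauss (x - T) + gauss (x + T)) :=
        setIntegral_le_integral hint (ae_of_all _ fun x =>
          mul_nonneg (Real.exp_pos _).le (add_pos (gauss_pos _) (gauss_pos _)).le)
    _ = 2 * Real.exp (-T ^ 2 / 2) := by
        rw [integral_const_mul, integral_add h1 h2, integral_sub_right_eq_self gauss,
          integral_add_right_eq_self gauss, integral_gauss]
        ring

lemma mul_log_div_sub_add_le {a b : ℝ} (ha : 0 ≤ a) (hb : 0 < b) :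
    a * Real.log (a / b) - a + b ≤ (a - b) ^ 2 / b := by
  rcases ha.eq_or_lt with rfl | ha
  · simp [pow_two, hb.ne']
  · have h := mul_le_mul_of_nonneg_left (Real.log_le_sub_one_of_pos (div_pos ha hb)) ha.le
    calc a * Real.log (a / b) - a + b ≤ a * (a / b - 1) - a + b := by linarith
      _ = (a - b) ^ 2 / b := by field_simp; ring

lemma mul_log_div_gauss_le {a : ℝ} (ha : 0 ≤ a) (ha1 : a ≤ 1) (x : ℝ) :
    a * Real.log (a / gauss x) ≤ a * (x ^ 2 / 2 + 1) := by
  rcases ha.eq_or_lt with rfl | ha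
  · simp
  · have he : Real.log (Real.sqrt (2 * π)) ≤ 1 := by
      rw [Real.log_sqrt (by positivity)]
      have : Real.log (2 * π) ≤ 2 := by
        rw [Real.log_le_iff_le_exp (by positivity)]
        have h1 := Real.exp_one_gt_d9
        have h2 : Real.exp 2 = Real.exp 1 * Real.exp 1 := by rw [← Real.exp_add]; norm_num
        nlinarith [Real.pi_lt_d2]
      linarith
    have hlog : Real.log (gauss x) = -Real.log (Real.sqrt (2 * π)) + -x ^ 2 / 2 := by
      unfold gauss
      rw [Real.log_mul (by positivity) (Real.exp_pos _).ne', Real.log_inv, Real.log_exp]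
    rw [Real.log_div ha.ne' (gauss_pos x).ne', hlog]
    have := Real.log_nonpos ha.le ha1
    gcongr
    linarith

/-- Interpolation of the second moment between the mass and the `s`-th moment, in Young form. -/
lemma sq_le_sq_add_rpow {s K : ℝ} (hs : 2 < s) (hK : 0 < K) (x : ℝ) :
    x ^ 2 ≤ K ^ 2 + K ^ (2 - s) * |x| ^ s := by
  rcases le_total |x| K with h | h
  · have h1 : x ^ 2 ≤ K ^ 2 := by rw [← sq_abs]; gcongr
    have h2 : 0 ≤ K ^ (2 - s) * |x| ^ s := by positivity
    linarith
  · have hx : 0 < |x| := hK.trans_le h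
    have h1 : |x| ^ s = x ^ 2 * |x| ^ (s - 2) := by
      rw [← sq_abs, ← Real.rpow_two, ← Real.rpow_add hx]
      congr 1
      ring
    have h2 : 1 ≤ K ^ (2 - s) * |x| ^ (s - 2) := by
      calc (1 : ℝ) = K ^ (2 - s) * K ^ (s - 2) := by
            rw [← Real.rpow_add hK]
            simp
        _ ≤ _ := by gcongr
    rw [h1]
    nlinarith [sq_nonneg x, sq_nonneg K]

lemma sq_le_convex_rpow {s : ℝ} (hs : 2 < s) (x : ℝ) :
    x ^ 2 ≤ 2 / s * |x| ^ s + (1 - 2 / s) := by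
  have hs0 : 0 < s := by linarith
  have h := Real.geom_mean_le_arith_mean2_weighted (w₁ := 2 / s) (w₂ := 1 - 2 / s)
    (p₁ := |x| ^ s) (p₂ := 1) (by positivity)
    (by rw [sub_nonneg, div_le_one hs0]; linarith) (by positivity) zero_le_one (by ring)
  rw [Real.one_rpow, mul_one, mul_one, ← Real.rpow_mul (abs_nonneg x),
    mul_div_cancel₀ _ hs0.ne', Real.rpow_two, sq_abs] at h
  exact h

section Density

variable {p : ℝ → ℝ} {s δ : ℝ}

lemma one_le_absolute_moment (hs : 2 < s) (hint : Integrable p) (h1 : ∫ x, p x = 1)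
    (hp : ∀ x, 0 ≤ p x) (hint2 : Integrable fun x => x ^ 2 * p x) (h2 : ∫ x, x ^ 2 * p x = 1)
    (hints : Integrable fun x => |x| ^ s * p x) : 1 ≤ ∫ x, |x| ^ s * p x := by
  have h : ∫ x, x ^ 2 * p x ≤ ∫ x, (2 / s * (|x| ^ s * p x) + (1 - 2 / s) * p x) := by
    refine integral_mono hint2 ((hints.const_mul _).add (hint.const_mul _)) fun x => ?_
    calc x ^ 2 * p x ≤ (2 / s * |x| ^ s + (1 - 2 / s)) * p x :=
          mul_le_mul_of_nonneg_right (sq_le_convex_rpow hs x) (hp x)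
      _ = _ := by ring
  rw [integral_add (hints.const_mul _) (hint.const_mul _), integral_const_mul,
    integral_const_mul, h1, h2] at h
  have hs0 : 0 < 2 / s := by positivity
  nlinarith

lemma setIntegral_sq_mul_le (hs : 2 < s) (hint : Integrable p) (hp : ∀ x, 0 ≤ p x)
    (hint2 : Integrable fun x => x ^ 2 * p x) (hints : Integrable fun x => |x| ^ s * p x)
    (hm : 0 < ∫ x, |x| ^ s * p x) {B : Set ℝ} {Q : ℝ} (hQ : 0 < Q)
    (hBQ : ∫ x in B, p x ≤ Q) :
    ∫ x in B, x ^ 2 * p x ≤ 2 * ((∫ x, |x| ^ s * p x) ^ (2 / s) * Q ^ (1 - 2 / s)) := by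
  set m := ∫ x, |x| ^ s * p x
  have hs0 : 0 < s := by linarith
  set K := (m / Q) ^ (1 / s) with hKdef
  have hmQ : 0 < m / Q := div_pos hm hQ
  have hK : 0 < K := Real.rpow_pos_of_pos hmQ _
  have hint' := (hint.const_mul (K ^ 2)).add (hints.const_mul (K ^ (2 - s)))
  have h : ∫ x in B, x ^ 2 * p x ≤
      ∫ x in B, (K ^ 2 * p x + K ^ (2 - s) * (|x| ^ s * p x)) := by
    refine setIntegral_mono hint2.integrableOn hint'.integrableOn fun x => ?_
    calc x ^ 2 * p x ≤ (K ^ 2 + K ^ (2 - s) * |x| ^ s) * p x :=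
          mul_le_mul_of_nonneg_right (sq_le_sq_add_rpow hs hK x) (hp x)
      _ = _ := by ring
  rw [integral_add (hint.const_mul _).integrableOn (hints.const_mul _).integrableOn,
    integral_const_mul, integral_const_mul] at h
  have hms : ∫ x in B, |x| ^ s * p x ≤ m :=
    setIntegral_le_integral hints (ae_of_all _ fun x => mul_nonneg (by positivity) (hp x))
  have hK2 : K ^ 2 * Q = m ^ (2 / s) * Q ^ (1 - 2 / s) := by
    rw [← Real.rpow_two, hKdef, ← Real.rpow_mul hmQ.le, Real.div_rpow hm.le hQ.le,
      Real.rpow_sub hQ, Real.rpow_one, show 1 / s * 2 = 2 / s by ring]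
    ring
  have hK3 : K ^ (2 - s) * m = K ^ 2 * Q := by
    rw [Real.rpow_sub hK, Real.rpow_two, hKdef, ← Real.rpow_mul hmQ.le (1 / s) s,
      one_div_mul_cancel hs0.ne', Real.rpow_one]
    field_simp
  calc ∫ x in B, x ^ 2 * p x
      ≤ K ^ 2 * (∫ x in B, p x) + K ^ (2 - s) * ∫ x in B, |x| ^ s * p x := h
    _ ≤ K ^ 2 * Q + K ^ (2 - s) * m := by gcongr
    _ = _ := by rw [hK3, hK2]; ring

lemma setIntegral_tail_le (hint : Integrable p) (h1 : ∫ x, p x = 1)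
    (hδ : ∀ᵐ x, |p x - gauss x| ≤ δ) {T : ℝ} (hT : 0 ≤ T) :
    ∫ x in (Set.Icc (-T) T)ᶜ, p x ≤ 2 * T * δ + 2 * Real.exp (-T ^ 2 / 2) := by
  have hA : MeasurableSet (Set.Icc (-T) T) := measurableSet_Icc
  have hp := integral_add_compl hA hint
  have hg := integral_add_compl hA integrable_gauss
  rw [h1] at hp
  rw [integral_gauss] at hg
  have hcmp : ∫ x in Set.Icc (-T) T, (gauss x - p x) ≤ ∫ _ in Set.Icc (-T) T, δ := by
    refine setIntegral_mono_ae (integrable_gauss.sub hint).integrableOn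
      (integrableOn_const (by simp)) ?_
    filter_upwards [hδ] with x hx
    linarith [(abs_le.1 hx).1]
  rw [integral_sub integrable_gauss.integrableOn hint.integrableOn, setIntegral_const,
    Real.volume_real_Icc_of_le (by linarith), smul_eq_mul] at hcmp
  linarith [setIntegral_gauss_tail_le hT]

/-- Split the relative entropy at `|x| = T`: compare with the chi-square integrand inside and
with `x ^ 2 * p x` outside. -/
lemma KLdiv_gauss_le (hint : Integrable p) (h1 : ∫ x, p x = 1) (hp : ∀ x, 0 ≤ p x)
    (hint2 : Integrable fun x => x ^ 2 * p x) (hδ : ∀ᵐ x, |p x - gauss x| ≤ δ)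
    (hδ2 : δ ≤ 1 / 2) {T : ℝ} (hT : 0 ≤ T) :
    KLdiv p gauss ≤ 6 * T * (δ ^ 2 * Real.exp (T ^ 2 / 2)) +
      (1 / 2) * (∫ x in (Set.Icc (-T) T)ᶜ, x ^ 2 * p x) +
      (∫ x in (Set.Icc (-T) T)ᶜ, p x) + 2 * Real.exp (-T ^ 2 / 2) := by
  have hA : MeasurableSet (Set.Icc (-T) T) := measurableSet_Icc
  have hn1 : 0 ≤ ∫ x in (Set.Icc (-T) T)ᶜ, x ^ 2 * p x :=
    integral_nonneg fun x => mul_nonneg (sq_nonneg x) (hp x)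
  have hn2 : 0 ≤ ∫ x in (Set.Icc (-T) T)ᶜ, p x := integral_nonneg hp
  by_cases hKL : Integrable fun x => p x * Real.log (p x / gauss x)
  swap
  · rw [KLdiv, integral_undef hKL]
    positivity
  set g : ℝ → ℝ := fun x => p x * Real.log (p x / gauss x) - p x + gauss x with hgdef
  have hKLp : Integrable fun x => p x * Real.log (p x / gauss x) - p x := hKL.sub hint
  have hg : Integrable g := hKLp.add integrable_gauss
  have hKLg : KLdiv p gauss = ∫ x, g x := by
    simp only [hgdef]
    rw [integral_add hKLp integrable_gauss, integral_sub hKL hint, h1,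
      integral_gauss, KLdiv]
    ring
  have hin : ∫ x in Set.Icc (-T) T, g x ≤
      ∫ _ in Set.Icc (-T) T, 3 * (δ ^ 2 * Real.exp (T ^ 2 / 2)) := by
    refine setIntegral_mono_on_ae hg.integrableOn (integrableOn_const (by simp)) hA ?_
    filter_upwards [hδ] with x hx hxT
    have hx2 : x ^ 2 ≤ T ^ 2 := sq_le_sq' hxT.1 hxT.2
    have hginv : (gauss x)⁻¹ = Real.sqrt (2 * π) * Real.exp (x ^ 2 / 2) := by
      rw [gauss, mul_inv, inv_inv, ← Real.exp_neg]
      congr 2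
      ring
    calc g x ≤ (p x - gauss x) ^ 2 / gauss x := mul_log_div_sub_add_le (hp x) (gauss_pos x)
      _ = (p x - gauss x) ^ 2 * (Real.sqrt (2 * π) * Real.exp (x ^ 2 / 2)) := by
          rw [div_eq_mul_inv, hginv]
      _ ≤ δ ^ 2 * (3 * Real.exp (T ^ 2 / 2)) := by
          have h3 := sqrt_two_pi_mem_Ioo.2.le
          have h4 : (p x - gauss x) ^ 2 ≤ δ ^ 2 := sq_le_sq' (abs_le.1 hx).1 (abs_le.1 hx).2
          gcongr
      _ = _ := by ring
  rw [setIntegral_const, Real.volume_real_Icc_of_le (by linarith), smul_eq_mul] at hin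
  have hmom : Integrable fun x => (1 / 2) * (x ^ 2 * p x) + p x :=
    (hint2.const_mul _).add hint
  have hout : ∫ x in (Set.Icc (-T) T)ᶜ, g x ≤
      ∫ x in (Set.Icc (-T) T)ᶜ, ((1 / 2) * (x ^ 2 * p x) + p x + gauss x) := by
    refine setIntegral_mono_ae hg.integrableOn
      (hmom.add integrable_gauss).integrableOn ?_
    filter_upwards [hδ] with x hx
    have hp1 : p x ≤ 1 := by linarith [(abs_le.1 hx).2, gauss_lt_half x]
    have := mul_log_div_gauss_le (hp x) hp1 x
    simp only [hgdef]
    linarith [hp x]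
  rw [integral_add hmom.integrableOn integrable_gauss.integrableOn,
    integral_add (hint2.const_mul _).integrableOn hint.integrableOn, integral_const_mul] at hout
  rw [hKLg, ← integral_add_compl hA hg]
  linarith [setIntegral_gauss_tail_le hT]

theorem KLdiv_gauss_le_of_abs_sub_le (hs : 2 < s) (hp : ∀ x, 0 ≤ p x) (hint : Integrable p)
    (h1 : ∫ x, p x = 1) (hint2 : Integrable fun x => x ^ 2 * p x)
    (h2 : ∫ x, x ^ 2 * p x = 1) (hints : Integrable fun x => |x| ^ s * p x)
    (hδ0 : 0 < δ) (hδ2 : δ ≤ 1 / 2) (hδ : ∀ᵐ x, |p x - gauss x| ≤ δ) :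
    KLdiv p gauss ≤ 24 * (∫ x, |x| ^ s * p x) ^ (2 / s) *
      (Real.sqrt |Real.log δ| * δ) ^ (1 - 2 / s) := by
  have hm := one_le_absolute_moment hs hint h1 hp hint2 h2 hints
  have hs0 : 0 < s := by linarith
  have hθ1 : 1 - 2 / s ≤ 1 := sub_le_self _ (by positivity)
  have hlog : Real.log 2 ≤ -Real.log δ := by
    rw [← Real.log_inv]
    exact Real.log_le_log (by norm_num) (by rw [le_inv_comm₀ (by norm_num) hδ0]; linarith)
  have hlog2 := Real.log_two_gt_d9
  have habs : |Real.log δ| = -Real.log δ := abs_of_nonpos (by linarith)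
  set r := Real.sqrt |Real.log δ| with hr
  have hr2 : r ^ 2 = -Real.log δ := by rw [hr, Real.sq_sqrt (abs_nonneg _), habs]
  have hr0 : 0 ≤ r := Real.sqrt_nonneg _
  have hr1 : 2 / 3 ≤ r := by nlinarith
  set T := Real.sqrt 2 * r with hTdef
  have hT0 : 0 ≤ T := by positivity
  have hT2 : T ^ 2 / 2 = -Real.log δ := by
    rw [hTdef, mul_pow, Real.sq_sqrt (by norm_num), hr2]
    ring
  have hTr : T ≤ 3 / 2 * r := by
    rw [hTdef]
    gcongr
    exact Real.sqrt_le_iff.2 (by norm_num)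
  have hexp : Real.exp (T ^ 2 / 2) = δ⁻¹ := by rw [hT2, Real.exp_neg, Real.exp_log hδ0]
  have hexp' : Real.exp (-T ^ 2 / 2) = δ := by
    rw [neg_div, Real.exp_neg, hexp, inv_inv]
  have hKL := KLdiv_gauss_le hint h1 hp hint2 hδ hδ2 hT0
  have htail := setIntegral_tail_le hint h1 hδ hT0
  rw [hexp'] at hKL htail
  rw [hexp, show δ ^ 2 * δ⁻¹ = δ by field_simp] at hKL
  set L := r * δ with hL
  have hL0 : 0 < L := by positivity
  have hTL : T * δ ≤ 3 / 2 * L := by rw [hL, ← mul_assoc]; gcongr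
  have hδL : δ ≤ 3 / 2 * L := by rw [hL]; nlinarith
  have hQ : ∫ x in (Set.Icc (-T) T)ᶜ, p x ≤ 6 * L := by linarith
  have hsq := setIntegral_sq_mul_le hs hint hp hint2 hints (by linarith) (by positivity) hQ
  have hL1 : L ≤ 1 := by
    have hrδ : r ^ 2 ≤ δ⁻¹ := by
      rw [hr2, ← Real.log_inv]
      linarith [Real.log_le_sub_one_of_pos (inv_pos.2 hδ0)]
    have h3 : L ^ 2 ≤ δ := by
      calc L ^ 2 = r ^ 2 * δ ^ 2 := mul_pow _ _ _
        _ ≤ δ⁻¹ * δ ^ 2 := by gcongr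
        _ = δ := by field_simp
    nlinarith
  have hLθ : L ≤ L ^ (1 - 2 / s) := by
    simpa using Real.rpow_le_rpow_of_exponent_ge hL0 hL1 hθ1
  have h6 : (6 * L) ^ (1 - 2 / s) ≤ 6 * L ^ (1 - 2 / s) := by
    rw [Real.mul_rpow (by norm_num) hL0.le]
    gcongr
    simpa using Real.rpow_le_rpow_of_exponent_le (by norm_num : (1 : ℝ) ≤ 6) hθ1
  have hM : 1 ≤ (∫ x, |x| ^ s * p x) ^ (2 / s) := Real.one_le_rpow hm (by positivity)
  set M := (∫ x, |x| ^ s * p x) ^ (2 / s)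
  set N := L ^ (1 - 2 / s)
  have hMN : N ≤ M * N := le_mul_of_one_le_left (hL0.le.trans hLθ) hM
  have h7 : M * (6 * L) ^ (1 - 2 / s) ≤ M * (6 * N) := by gcongr
  linarith

end Density

lemma rpow_mul_sqrt_abs_log_le {ε x : ℝ} (hε : 0 < ε) (hx : x ∈ Set.Ioc (0 : ℝ) 1) :
    x ^ ε * Real.sqrt |Real.log x| ≤ Real.sqrt ((2 * ε)⁻¹) := by
  have hxε : 0 < x ^ ε := Real.rpow_pos_of_pos hx.1 _
  have hlog : |Real.log x| ≤ x⁻¹ ^ (2 * ε) / (2 * ε) := by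
    rw [abs_of_nonpos (Real.log_nonpos hx.1.le hx.2), ← Real.log_inv]
    exact Real.log_le_rpow_div (inv_pos.2 hx.1).le (by positivity)
  apply Real.le_sqrt_of_sq_le
  rw [mul_pow, Real.sq_sqrt (abs_nonneg _)]
  calc (x ^ ε) ^ 2 * |Real.log x| ≤ (x ^ ε) ^ 2 * (x⁻¹ ^ (2 * ε) / (2 * ε)) := by gcongr
    _ = (2 * ε)⁻¹ := by
      rw [Real.inv_rpow hx.1.le, mul_comm 2 ε, Real.rpow_mul hx.1.le, Real.rpow_two]
      field_simp

lemma rpow_mul_sqrt_abs_log_add_one_le_Mconst {ε x : ℝ} (hε : 0 < ε)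
    (hx : x ∈ Set.Ioc (0 : ℝ) 1) : x ^ ε * Real.sqrt |Real.log x| + 1 ≤ Mconst ε := by
  unfold Mconst
  gcongr
  have hbdd : BddAbove (Set.range fun y : ℝ =>
      ⨆ _ : y ∈ Set.Ioc (0 : ℝ) 1, y ^ ε * Real.sqrt |Real.log y|) := by
    refine ⟨Real.sqrt ((2 * ε)⁻¹), ?_⟩
    rintro _ ⟨y, rfl⟩
    exact Real.iSup_le (fun hy => rpow_mul_sqrt_abs_log_le hε hy) (Real.sqrt_nonneg _)
  refine le_trans (le_of_eq ?_) (le_ciSup hbdd x)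
  simp only [ciSup_pos hx]

lemma sqrt_abs_log_mul_self_rpow_le {ε x θ : ℝ} (hε : 0 < ε) (hx : x ∈ Set.Ioc (0 : ℝ) 1)
    (hθ0 : 0 ≤ θ) (hθ1 : θ ≤ 1) :
    (Real.sqrt |Real.log x| * x) ^ θ ≤ Mconst ε * x ^ (θ * (1 - ε)) := by
  have hM := rpow_mul_sqrt_abs_log_add_one_le_Mconst hε hx
  have hxε : 0 ≤ x ^ ε * Real.sqrt |Real.log x| :=
    mul_nonneg (Real.rpow_nonneg hx.1.le _) (Real.sqrt_nonneg _)
  have hx1 : 0 ≤ x ^ (1 - ε) := Real.rpow_nonneg hx.1.le _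
  have hsplit : Real.sqrt |Real.log x| * x =
      (x ^ ε * Real.sqrt |Real.log x|) * x ^ (1 - ε) := by
    rw [mul_right_comm, ← Real.rpow_add hx.1, add_sub_cancel, Real.rpow_one, mul_comm]
  rw [hsplit, Real.mul_rpow hxε hx1, ← Real.rpow_mul hx.1.le, mul_comm (1 - ε) θ]
  have hpow : 0 ≤ x ^ (θ * (1 - ε)) := Real.rpow_nonneg hx.1.le _
  refine mul_le_mul_of_nonneg_right ?_ hpow
  calc (x ^ ε * Real.sqrt |Real.log x|) ^ θ ≤ Mconst ε ^ θ :=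
        Real.rpow_le_rpow hxε (by linarith) hθ0
    _ ≤ Mconst ε := by
        simpa using Real.rpow_le_rpow_of_exponent_le (show 1 ≤ Mconst ε by linarith) hθ1

/-- **Corollary 2.6.** For every `s > 2` there is `C₁ > 0` such that for any random variable
`X` with density `p`, `E X = 0`, `Var X = 1`, `E|X|^s < ∞`, and `0 < ‖p − φ‖_∞ ≤ 1/2`, and any
`ε > 0`,
`D(X) ≤ C₁ (E|X|^s)^{2/s} (√(|ln ‖p−φ‖_∞|) ‖p−φ‖_∞)^{1−2/s}
      ≤ C₁ M(ε) (E|X|^s)^{2/s} ‖p−φ‖_∞^{(1−2/s)(1−ε)}`. -/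
theorem D_upper_bound_Linf :
    ∀ s : ℝ, 2 < s →
      ∃ C₁ : ℝ, 0 < C₁ ∧
        ∀ p : ℝ → ℝ, Measurable p → (∀ x, 0 ≤ p x) → (∫ x, p x) = 1 →
          Integrable (fun x => x * p x) → (∫ x, x * p x) = 0 →
          Integrable (fun x => x ^ 2 * p x) → (∫ x, x ^ 2 * p x) = 1 →
          Integrable (fun x => |x| ^ s * p x) →
          0 < eLpNorm (fun x => p x - gauss x) ⊤ volume →
          eLpNorm (fun x => p x - gauss x) ⊤ volume ≤ 1 / 2 →
          ∀ ε : ℝ, 0 < ε →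
            KLdiv p gauss ≤
              C₁ * (∫ x, |x| ^ s * p x) ^ (2 / s) *
                (Real.sqrt |Real.log (nrm (fun x => p x - gauss x) ⊤)| *
                  nrm (fun x => p x - gauss x) ⊤) ^ (1 - 2 / s) ∧
            C₁ * (∫ x, |x| ^ s * p x) ^ (2 / s) *
                (Real.sqrt |Real.log (nrm (fun x => p x - gauss x) ⊤)| *
                  nrm (fun x => p x - gauss x) ⊤) ^ (1 - 2 / s) ≤
              C₁ * Mconst ε * (∫ x, |x| ^ s * p x) ^ (2 / s) *
                (nrm (fun x => p x - gauss x) ⊤) ^ ((1 - 2 / s) * (1 - ε)) := by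
  intro s hs
  refine ⟨24, by norm_num, ?_⟩
  intro p _ hp h1 _ _ hint2 h2 hints hpos hle ε hε
  have hint : Integrable p := by
    by_contra h
    rw [integral_undef h] at h1
    exact zero_ne_one h1
  set N := eLpNorm (fun x => p x - gauss x) ⊤ volume with hN
  have hNtop : N ≠ ⊤ := ne_top_of_le_ne_top (by simp) hle
  have hnrm : nrm (fun x => p x - gauss x) ⊤ = N.toReal := rfl
  rw [hnrm]
  have hδ0 : 0 < N.toReal := ENNReal.toReal_pos hpos.ne' hNtop
  have hδ2 : N.toReal ≤ 1 / 2 := by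
    simpa using ENNReal.toReal_mono (by simp) hle
  have hδ : ∀ᵐ x, |p x - gauss x| ≤ N.toReal := by
    filter_upwards [ae_le_eLpNormEssSup (f := fun x => p x - gauss x) (μ := volume)] with x hx
    rw [← eLpNorm_exponent_top, ← hN] at hx
    simpa using ENNReal.toReal_mono hNtop hx
  refine ⟨KLdiv_gauss_le_of_abs_sub_le hs hp hint h1 hint2 h2 hints hδ0 hδ2 hδ, ?_⟩
  have hs0 : 0 < s := by linarith
  have hθ0 : 0 ≤ 1 - 2 / s := by rw [sub_nonneg, div_le_one hs0]; exact hs.le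
  have hθ1 : 1 - 2 / s ≤ 1 := sub_le_self _ (by positivity)
  have hm : 0 ≤ ∫ x, |x| ^ s * p x :=
    integral_nonneg fun x => mul_nonneg (Real.rpow_nonneg (abs_nonneg x) _) (hp x)
  calc 24 * (∫ x, |x| ^ s * p x) ^ (2 / s) *
        (Real.sqrt |Real.log N.toReal| * N.toReal) ^ (1 - 2 / s)
      ≤ 24 * (∫ x, |x| ^ s * p x) ^ (2 / s) *
        (Mconst ε * N.toReal ^ ((1 - 2 / s) * (1 - ε))) := by
        gcongr
        exact sqrt_abs_log_mul_self_rpow_le hε ⟨hδ0, by linarith⟩ hθ0 hθ1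
    _ = _ := by ring
end
end

section
/- Let X be a real random variable with zero mean, absolutely continuous Lebesgue density p, finite Fisher information J(X) and finite variance Var(X). Then (1/2)·ln(2πe/J(X)) ≤ h(X) ≤ (1/2)·ln(2πe·Var(X)), where h(X) := −∫_ℝ p(x) ln p(x) dx is the differential entropy. Moreover, for every t > 0, D(X) ≤ C(t)·(Var(X)^t + J(X)^t), where C(t) := sup_{x ≥ 1} (ln x)/(2x^t) < ∞ depends only on t. -/
open MeasureTheory Real Filter
open scoped ENNReal

noncomputable section

/-- `p` is the Lebesgue density of the real random variable `X` defined on `(Ω, P)`. -/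
def IsDensityOf {Ω : Type*} [MeasurableSpace Ω] (P : Measure Ω) (X : Ω → ℝ) (p : ℝ → ℝ) : Prop :=
  Measurable X ∧ Measurable p ∧ (∀ x, 0 ≤ p x) ∧
    Measure.map X P = volume.withDensity (fun x => ENNReal.ofReal (p x))

/-- `p` is absolutely continuous with (a.e.) derivative `p'`:  `p` is the integral of a locally
integrable function `p'`. -/
def HasACDeriv (p p' : ℝ → ℝ) : Prop :=
  Measurable p' ∧ LocallyIntegrable p' volume ∧ ∀ a b : ℝ, p b - p a = ∫ x in a..b, p' x

/-- Fisher information `J(p) = ∫ p'²/p` of a density `p` with derivative `p'`. -/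
def fisherInfo (p p' : ℝ → ℝ) : ℝ := ∫ x, (p' x) ^ 2 / p x

/-- The density of a Gaussian with mean `0` and variance `v`. -/
def gaussDensity (v : ℝ) (x : ℝ) : ℝ :=
  (Real.sqrt (2 * Real.pi * v))⁻¹ * Real.exp (-x ^ 2 / (2 * v))

open Set Topology ProbabilityTheory

section Quantile

theorem exists_cdf_eq {μ : Measure ℝ} (hF : Continuous (cdf μ)) {u : ℝ} (hu : u ∈ Ioo (0 : ℝ) 1) :
    ∃ x, cdf μ x = u := by
  obtain ⟨a, ha⟩ := ((tendsto_cdf_atBot μ).eventually (eventually_lt_nhds hu.1)).exists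
  obtain ⟨b, hb⟩ := ((tendsto_cdf_atTop μ).eventually (eventually_gt_nhds hu.2)).exists
  exact mem_range_of_exists_le_of_exists_ge hF ⟨a, ha.le⟩ ⟨b, hb.le⟩

theorem measureReal_cdf_le {μ : Measure ℝ} [IsProbabilityMeasure μ] (hF : Continuous (cdf μ))
    {u : ℝ} (hu : u ∈ Ioo (0 : ℝ) 1) : μ.real {x | cdf μ x ≤ u} = u := by
  apply le_antisymm
  · refine le_of_forall_gt_imp_ge_of_dense fun v hv ↦ ?_
    obtain hv1 | hv1 := le_or_gt 1 v
    · exact measureReal_le_one.trans hv1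
    obtain ⟨d, hd⟩ := exists_cdf_eq hF ⟨hu.1.trans hv, hv1⟩
    rw [← hd, cdf_eq_real]
    refine measureReal_mono fun x hx ↦ ?_
    by_contra hxd
    have := monotone_cdf μ (le_of_lt (not_le.1 hxd))
    have hx' : cdf μ x ≤ u := hx
    linarith
  · obtain ⟨c, hc⟩ := exists_cdf_eq hF hu
    nth_rw 1 [← hc]
    rw [cdf_eq_real]
    refine measureReal_mono fun x hx ↦ ?_
    exact (monotone_cdf μ hx).trans hc.le

theorem ae_cdf_mem_Ioo {μ : Measure ℝ} [IsProbabilityMeasure μ] (hF : Continuous (cdf μ)) :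
    ∀ᵐ x ∂μ, cdf μ x ∈ Ioo (0 : ℝ) 1 := by
  have h0 : μ.real {x | cdf μ x ≤ 0} = 0 := by
    refine le_antisymm (le_of_forall_gt_imp_ge_of_dense fun v hv ↦ ?_) measureReal_nonneg
    obtain hv1 | hv1 := le_or_gt 1 v
    · exact measureReal_le_one.trans hv1
    rw [← measureReal_cdf_le hF ⟨hv, hv1⟩]
    exact measureReal_mono fun x (hx : cdf μ x ≤ 0) ↦ hx.trans hv.le
  have h1 : μ.real {x | 1 ≤ cdf μ x} = 0 := by
    refine le_antisymm (le_of_forall_gt_imp_ge_of_dense fun v hv ↦ ?_) measureReal_nonneg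
    obtain hv1 | hv1 := le_or_gt 1 v
    · exact measureReal_le_one.trans hv1
    have h : μ.real {x | cdf μ x ≤ 1 - v} = 1 - v :=
      measureReal_cdf_le hF ⟨by linarith, by linarith⟩
    have hm : MeasurableSet {x | cdf μ x ≤ 1 - v} :=
      measurableSet_le hF.measurable measurable_const
    have hc := probReal_compl_eq_one_sub (μ := μ) hm
    rw [h, sub_sub_cancel] at hc
    rw [← hc]
    refine measureReal_mono fun x (hx : 1 ≤ cdf μ x) ↦ ?_
    simp only [mem_compl_iff, mem_ofPred_eq, not_le]
    linarith
  rw [measureReal_eq_zero_iff] at h0 h1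
  filter_upwards [measure_eq_zero_iff_ae_notMem.1 h0, measure_eq_zero_iff_ae_notMem.1 h1]
    with x hx0 hx1
  exact ⟨not_le.1 hx0, not_le.1 hx1⟩

theorem hasDerivAt_cdf {μ : Measure ℝ} [IsProbabilityMeasure μ] {q : ℝ → ℝ} (hq : Continuous q)
    (hq0 : ∀ x, 0 ≤ q x) (hμ : μ = volume.withDensity fun x ↦ ENNReal.ofReal (q x)) (x : ℝ) :
    HasDerivAt (cdf μ) (q x) x := by
  have hF : ∀ y, cdf μ y = cdf μ 0 + ∫ t in (0 : ℝ)..y, q t := by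
    have key : ∀ a b, a ≤ b → cdf μ b - cdf μ a = ∫ t in a..b, q t := fun a b hab ↦ by
      rw [cdf_eq_real, cdf_eq_real, ← measureReal_sdiff (Iic_subset_Iic.2 hab) measurableSet_Iic,
        Iic_sdiff_Iic, intervalIntegral.integral_of_le hab, measureReal_def, hμ,
        withDensity_apply _ measurableSet_Ioc,
        integral_eq_lintegral_of_nonneg_ae (ae_of_all _ hq0) hq.aestronglyMeasurable]
    intro y
    obtain h | h := le_total 0 y
    · linarith [key 0 y h]
    · rw [intervalIntegral.integral_symm]
      linarith [key y 0 h]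
  have h := (intervalIntegral.integral_hasDerivAt_right (hq.intervalIntegrable 0 x)
    hq.stronglyMeasurable.stronglyMeasurableAtFilter hq.continuousAt).const_add (cdf μ 0)
  exact h.congr_of_eventuallyEq (Eventually.of_forall hF)

theorem hasDerivAt_cdf_gaussianReal (x : ℝ) :
    HasDerivAt (cdf (gaussianReal 0 1)) (gaussianPDFReal 0 1 x) x := by
  refine hasDerivAt_cdf ?_ (gaussianPDFReal_nonneg 0 1) ?_ x
  · rw [gaussianPDFReal_def]
    fun_prop
  · rw [gaussianReal_of_var_ne_zero 0 one_ne_zero]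
    rfl

theorem strictMono_cdf_gaussianReal : StrictMono (cdf (gaussianReal 0 1)) :=
  strictMono_of_hasDerivAt_pos hasDerivAt_cdf_gaussianReal
    fun x ↦ gaussianPDFReal_pos 0 1 x one_ne_zero

theorem continuous_cdf_gaussianReal : Continuous (cdf (gaussianReal 0 1)) :=
  continuous_iff_continuousAt.2 fun x ↦ (hasDerivAt_cdf_gaussianReal x).continuousAt

theorem cdf_gaussianReal_mem_Ioo (z : ℝ) : cdf (gaussianReal 0 1) z ∈ Ioo (0 : ℝ) 1 :=
  ⟨(cdf_nonneg _ (z - 1)).trans_lt (strictMono_cdf_gaussianReal (sub_one_lt z)),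
    (strictMono_cdf_gaussianReal (lt_add_one z)).trans_le (cdf_le_one _ _)⟩

/-- The quantile function of the standard Gaussian on `(0, 1)`, extended by zero. -/
def gaussianQuantile : ℝ → ℝ :=
  (Ioo (0 : ℝ) 1).indicator (Function.invFun (cdf (gaussianReal 0 1)))

theorem gaussianQuantile_cdf (z : ℝ) : gaussianQuantile (cdf (gaussianReal 0 1) z) = z := by
  rw [gaussianQuantile, indicator_of_mem (cdf_gaussianReal_mem_Ioo z)]
  exact Function.leftInverse_invFun strictMono_cdf_gaussianReal.injective z

theorem cdf_gaussianQuantile {u : ℝ} (hu : u ∈ Ioo (0 : ℝ) 1) :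
    cdf (gaussianReal 0 1) (gaussianQuantile u) = u := by
  obtain ⟨z, rfl⟩ := exists_cdf_eq continuous_cdf_gaussianReal hu
  rw [gaussianQuantile_cdf]

theorem gaussianQuantile_le_iff {u z : ℝ} (hu : u ∈ Ioo (0 : ℝ) 1) :
    gaussianQuantile u ≤ z ↔ u ≤ cdf (gaussianReal 0 1) z := by
  rw [← strictMono_cdf_gaussianReal.le_iff_le, cdf_gaussianQuantile hu]

theorem strictMonoOn_gaussianQuantile : StrictMonoOn gaussianQuantile (Ioo 0 1) :=
  fun u hu v hv huv ↦ by
    rwa [← strictMono_cdf_gaussianReal.lt_iff_lt, cdf_gaussianQuantile hu, cdf_gaussianQuantile hv]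

theorem hasDerivAt_gaussianQuantile {u : ℝ} (hu : u ∈ Ioo (0 : ℝ) 1) :
    HasDerivAt gaussianQuantile (gaussianPDFReal 0 1 (gaussianQuantile u))⁻¹ u := by
  have hn : Ioo (0 : ℝ) 1 ∈ 𝓝 u := Ioo_mem_nhds hu.1 hu.2
  refine HasDerivAt.of_local_left_inverse ?_ (hasDerivAt_cdf_gaussianReal _)
    (gaussianPDFReal_pos 0 1 _ one_ne_zero).ne' ?_
  · refine strictMonoOn_gaussianQuantile.continuousAt_of_image_mem_nhds hn ?_
    convert univ_mem using 1
    exact eq_univ_of_forall fun z ↦ ⟨_, cdf_gaussianReal_mem_Ioo z, gaussianQuantile_cdf z⟩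
  · filter_upwards [hn] with v hv using cdf_gaussianQuantile hv

theorem measurable_gaussianQuantile : Measurable gaussianQuantile := by
  have h : ContinuousOn gaussianQuantile (Ioo 0 1) :=
    fun u hu ↦ (hasDerivAt_gaussianQuantile hu).continuousAt.continuousWithinAt
  have : gaussianQuantile = (Ioo (0 : ℝ) 1).piecewise gaussianQuantile 0 := by
    ext u
    by_cases hu : u ∈ Ioo (0 : ℝ) 1
    · rw [piecewise_eq_of_mem _ _ _ hu]
    · rw [piecewise_eq_of_notMem _ _ _ hu, gaussianQuantile, indicator_of_notMem hu]
      rfl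
  rw [this]
  exact h.measurable_piecewise continuousOn_const measurableSet_Ioo

/-- The increasing rearrangement `Φ⁻¹ ∘ F` pushes a law with continuous distribution function `F`
to the standard Gaussian. -/
theorem map_gaussianQuantile_cdf {μ : Measure ℝ} [IsProbabilityMeasure μ]
    (hF : Continuous (cdf μ)) :
    μ.map (fun x ↦ gaussianQuantile (cdf μ x)) = gaussianReal 0 1 := by
  have hm : Measurable fun x ↦ gaussianQuantile (cdf μ x) :=
    measurable_gaussianQuantile.comp hF.measurable
  have := Measure.isProbabilityMeasure_map (μ := μ) hm.aemeasurable
  refine Measure.eq_of_cdf _ _ ?_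
  ext z
  rw [cdf_eq_real, map_measureReal_apply hm measurableSet_Iic]
  refine Eq.trans (measureReal_congr ?_) (measureReal_cdf_le hF (cdf_gaussianReal_mem_Ioo z))
  filter_upwards [ae_cdf_mem_Ioo hF] with x hx
  exact propext (gaussianQuantile_le_iff hx)

end Quantile

section FisherInformation

theorem HasACDeriv.intervalIntegrable {p p' : ℝ → ℝ} (h : HasACDeriv p p') (a b : ℝ) :
    IntervalIntegrable p' volume a b :=
  intervalIntegrable_iff.2
    ((h.2.1.integrableOn_isCompact isCompact_uIcc).mono_set uIoc_subset_uIcc)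

theorem HasACDeriv.eq_add_integral {p p' : ℝ → ℝ} (h : HasACDeriv p p') (a : ℝ) :
    p = fun x ↦ p a + ∫ t in a..x, p' t := by
  ext x
  linarith [h.2.2 a x]

theorem HasACDeriv.continuous {p p' : ℝ → ℝ} (h : HasACDeriv p p') : Continuous p := by
  rw [h.eq_add_integral 0]
  exact continuous_const.add (intervalIntegral.continuous_primitive h.intervalIntegrable 0)

theorem HasACDeriv.ae_hasDerivAt {p p' : ℝ → ℝ} (h : HasACDeriv p p') :
    ∀ᵐ x, HasDerivAt p (p' x) x := by
  filter_upwards [_root_.LocallyIntegrable.ae_hasDerivAt_integral h.2.1] with x hx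
  rw [h.eq_add_integral 0]
  exact (hx 0).const_add (p 0)

theorem HasACDeriv.absolutelyContinuousOnInterval {p p' : ℝ → ℝ} (h : HasACDeriv p p')
    (a b : ℝ) : AbsolutelyContinuousOnInterval p a b := by
  rw [h.eq_add_integral a]
  exact (LipschitzWith.const (p a)).lipschitzOnWith.absolutelyContinuousOnInterval.add
    ((h.intervalIntegrable a b).absolutelyContinuousOnInterval_intervalIntegral left_mem_uIcc)

theorem HasACDeriv.ae_deriv_eq_zero {p p' : ℝ → ℝ} (h : HasACDeriv p p') (hp : ∀ x, 0 ≤ p x) :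
    ∀ᵐ x, p x = 0 → p' x = 0 := by
  filter_upwards [h.ae_hasDerivAt] with x hx hpx
  exact IsLocalMin.hasDerivAt_eq_zero (Eventually.of_forall fun y ↦ by rw [hpx]; exact hp y) hx

/-- Weighted arithmetic-geometric mean inequality for the score function. -/
theorem HasACDeriv.ae_abs_mul_le {p p' : ℝ → ℝ} (h : HasACDeriv p p') (hp : ∀ x, 0 ≤ p x)
    {c : ℝ} (hc : 0 < c) :
    ∀ᵐ x, ∀ y : ℝ, |p' x * y| ≤ ((p' x) ^ 2 / p x / c + c * (y ^ 2 * p x)) / 2 := by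
  filter_upwards [h.ae_deriv_eq_zero hp] with x hx y
  obtain h0 | h0 := (hp x).eq_or_lt
  · simp [hx h0.symm, ← h0]
  · have hsq : ((p' x) ^ 2 / p x / c + c * (y ^ 2 * p x)) / 2 - |p' x * y|
        = (|p' x| - c * p x * |y|) ^ 2 / (2 * c * p x) := by
      rw [abs_mul, ← sq_abs (p' x), ← sq_abs y]
      field_simp
      ring
    have : 0 ≤ (|p' x| - c * p x * |y|) ^ 2 / (2 * c * p x) := by positivity
    linarith

variable {p p' : ℝ → ℝ}

theorem HasACDeriv.integrable_deriv (h : HasACDeriv p p') (hp : ∀ x, 0 ≤ p x)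
    (hpi : Integrable p) (hJ : Integrable fun x ↦ (p' x) ^ 2 / p x) : Integrable p' := by
  refine ((hJ.div_const 1).add (hpi.const_mul 1) |>.div_const 2).mono' h.1.aestronglyMeasurable ?_
  filter_upwards [h.ae_abs_mul_le hp one_pos] with x hx
  simpa using hx 1

theorem HasACDeriv.eq_neg_integral_Ioi (h : HasACDeriv p p') (hpi : Integrable p)
    (hp' : Integrable p') (b : ℝ) : p b = -∫ x in Ioi b, p' x := by
  have ht : Tendsto p atTop (𝓝 (p b + ∫ x in Ioi b, p' x)) := by
    conv => enter [1]; rw [h.eq_add_integral b]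
    exact (intervalIntegral_tendsto_integral_Ioi b hp'.integrableOn tendsto_id).const_add _
  have := (hpi.integrableAtFilter atTop).eq_zero_of_tendsto (fun s hs ↦ by
    obtain ⟨a, ha⟩ := mem_atTop_sets.1 hs
    exact top_unique (volume_Ici (a := a) ▸ measure_mono ha)) ht
  linarith

theorem HasACDeriv.eq_integral_Iic (h : HasACDeriv p p') (hpi : Integrable p)
    (hp' : Integrable p') (a : ℝ) : p a = ∫ x in Iic a, p' x := by
  have ht : Tendsto p atBot (𝓝 (p a - ∫ x in Iic a, p' x)) := by
    have : p = fun x ↦ p a - ∫ t in x..a, p' t := by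
      ext x
      linarith [h.2.2 x a]
    conv => enter [1]; rw [this]
    exact (intervalIntegral_tendsto_integral_Iic a hp'.integrableOn tendsto_id).const_sub _
  have := (hpi.integrableAtFilter atBot).eq_zero_of_tendsto (fun s hs ↦ by
    obtain ⟨a, ha⟩ := mem_atBot_sets.1 hs
    exact top_unique (volume_Iic (a := a) ▸ measure_mono ha)) ht
  linarith

theorem HasACDeriv.le_integral_abs (h : HasACDeriv p p') (hpi : Integrable p)
    (hp' : Integrable p') (a : ℝ) : p a ≤ ∫ x, |p' x| := by
  rw [h.eq_integral_Iic hpi hp' a]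
  calc ∫ x in Iic a, p' x ≤ ∫ x in Iic a, |p' x| :=
        integral_mono hp'.integrableOn hp'.abs.integrableOn fun x ↦ le_abs_self _
    _ ≤ ∫ x, |p' x| := setIntegral_le_integral hp'.abs (ae_of_all _ fun x ↦ abs_nonneg _)

/-- Integration by parts against the score function, for a transport map `T` truncated at
height `n`. -/
theorem HasACDeriv.integral_mul_deriv_le (h : HasACDeriv p p') (hp : ∀ x, 0 ≤ p x)
    (hpi : Integrable p) (hJ : Integrable fun x ↦ (p' x) ^ 2 / p x)
    {T T' : ℝ → ℝ} {α β n c : ℝ} (hαβ : α ≤ β) (hn : 0 ≤ n) (hc : 0 < c)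
    (hT : ∀ x ∈ Icc α β, HasDerivAt T (T' x) x) (hT' : ContinuousOn T' (Icc α β))
    (hα : T α = -n) (hβ : T β = n)
    (hout : ∀ᵐ x, p x ≠ 0 → (x ≤ α ∨ β < x) → n ≤ |T x|)
    (hT2 : Integrable fun x ↦ T x ^ 2 * p x) :
    ∫ x in Ioc α β, p x * T' x ≤ (fisherInfo p p' / c + c * ∫ x, T x ^ 2 * p x) / 2 := by
  have hp' := h.integrable_deriv hp hpi hJ
  have hTc : ContinuousOn T (Icc α β) := fun x hx ↦ (hT x hx).continuousAt.continuousWithinAt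
  have hTac : AbsolutelyContinuousOnInterval T α β := by
    obtain ⟨C, hC⟩ := isCompact_Icc.exists_bound_of_continuousOn hT'
    refine LipschitzOnWith.absolutelyContinuousOnInterval (K := C.toNNReal) ?_
    rw [uIcc_of_le hαβ]
    refine (convex_Icc α β).lipschitzOnWith_of_nnnorm_hasDerivWithin_le
      (fun x hx ↦ (hT x hx).hasDerivWithinAt) fun x hx ↦ ?_
    rw [← NNReal.coe_le_coe, coe_nnnorm]
    exact (hC x hx).trans (Real.le_coe_toNNReal C)
  have hparts := (h.absolutelyContinuousOnInterval α β).integral_mul_deriv_eq_deriv_mul hTac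
  rw [intervalIntegral.integral_of_le hαβ, intervalIntegral.integral_of_le hαβ] at hparts
  have e1 : ∫ x in Ioc α β, p x * deriv T x = ∫ x in Ioc α β, p x * T' x :=
    setIntegral_congr_fun measurableSet_Ioc fun x hx ↦ by
      simp only [(hT x (Ioc_subset_Icc_self hx)).deriv]
  have e2 : ∫ x in Ioc α β, deriv p x * T x = ∫ x in Ioc α β, p' x * T x := by
    refine setIntegral_congr_ae measurableSet_Ioc ?_
    filter_upwards [h.ae_hasDerivAt] with x hx _
    rw [hx.deriv]
  rw [e1, e2, hα, hβ] at hparts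
  set H : ℝ → ℝ := fun x ↦ ((p' x) ^ 2 / p x / c + c * (T x ^ 2 * p x)) / 2 with hH
  have hHi : Integrable H := ((hJ.div_const c).add (hT2.const_mul c)).div_const 2
  have hHint : ∫ x, H x = (fisherInfo p p' / c + c * ∫ x, T x ^ 2 * p x) / 2 := by
    rw [hH, integral_div, integral_add (hJ.div_const c) (hT2.const_mul c), integral_div,
      integral_const_mul, fisherInfo]
  have hyoung := h.ae_abs_mul_le hp hc
  have houtle : ∀ᵐ x, (x ≤ α ∨ β < x) → |p' x * n| ≤ H x := by
    filter_upwards [hyoung, hout, h.ae_deriv_eq_zero hp] with x hx hxo hx0 hxm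
    obtain hpx | hpx := eq_or_ne (p x) 0
    · simp [H, hx0 hpx, hpx]
    · refine (hx n).trans ?_
      have : n ^ 2 ≤ T x ^ 2 := by
        rw [← sq_abs (T x)]
        exact pow_le_pow_left₀ hn (hxo hpx hxm) 2
      have := mul_le_mul_of_nonneg_left (mul_le_mul_of_nonneg_right this (hp x)) hc.le
      simp only [H]
      linarith
  have i1 : p β * n ≤ ∫ x in Ioi β, H x := by
    rw [h.eq_neg_integral_Ioi hpi hp' β, ← integral_neg, ← integral_mul_const]
    refine setIntegral_mono_on_ae (hp'.neg.mul_const n).integrableOn hHi.integrableOn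
      measurableSet_Ioi ?_
    filter_upwards [houtle] with x hx hxm
    have := (neg_abs_le (p' x * n)).trans' (neg_le_neg (hx (Or.inr hxm)))
    linarith
  have i2 : p α * n ≤ ∫ x in Iic α, H x := by
    rw [h.eq_integral_Iic hpi hp' α, ← integral_mul_const]
    refine setIntegral_mono_on_ae (hp'.mul_const n).integrableOn hHi.integrableOn
      measurableSet_Iic ?_
    filter_upwards [houtle] with x hx hxm
    exact (le_abs_self _).trans (hx (Or.inl hxm))
  have i3 : -∫ x in Ioc α β, p' x * T x ≤ ∫ x in Ioc α β, H x := by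
    rw [← integral_neg]
    refine setIntegral_mono_on_ae ?_ hHi.integrableOn measurableSet_Ioc ?_
    · exact ((hp'.integrableOn.mul_continuousOn hTc isCompact_Icc).mono_set
        Ioc_subset_Icc_self).neg
    · filter_upwards [hyoung] with x hx _
      exact (neg_le_abs _).trans (hx (T x))
  have hsplit : ∫ x, H x = (∫ x in Iic α, H x) + (∫ x in Ioc α β, H x) + ∫ x in Ioi β, H x := by
    rw [← setIntegral_union (Iic_disjoint_Ioc le_rfl) measurableSet_Ioc hHi.integrableOn
      hHi.integrableOn, Iic_union_Ioc_eq_Iic hαβ,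
      intervalIntegral.integral_Iic_add_Ioi hHi.integrableOn hHi.integrableOn]
  linarith

end FisherInformation

section Entropy

theorem gaussDensity_eq_gaussianPDFReal {s : ℝ} (hs : 0 ≤ s) (x : ℝ) :
    gaussDensity s x = gaussianPDFReal 0 s.toNNReal x := by
  simp [gaussDensity, gaussianPDFReal, hs]

theorem gaussDensity_pos {s : ℝ} (hs : 0 < s) (x : ℝ) : 0 < gaussDensity s x := by
  unfold gaussDensity
  positivity

theorem log_gaussDensity {s : ℝ} (hs : 0 < s) (x : ℝ) :
    log (gaussDensity s x) = -(1 / 2 * log (2 * π * s)) - x ^ 2 / (2 * s) := by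
  rw [gaussDensity, log_mul (by positivity) (by positivity), log_inv, log_exp,
    log_sqrt (by positivity)]
  ring

theorem integrable_gaussDensity {s : ℝ} (hs : 0 < s) : Integrable (gaussDensity s) := by
  rw [funext (gaussDensity_eq_gaussianPDFReal hs.le)]
  exact integrable_gaussianPDFReal 0 _

theorem integral_gaussDensity {s : ℝ} (hs : 0 < s) : ∫ x, gaussDensity s x = 1 := by
  rw [funext (gaussDensity_eq_gaussianPDFReal hs.le)]
  exact integral_gaussianPDFReal_eq_one 0 (by simpa using hs)

theorem sub_le_mul_log_sub_mul_log {a b : ℝ} (ha : 0 ≤ a) (hb : 0 < b) :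
    a - b ≤ a * log a - a * log b := by
  obtain rfl | ha := ha.eq_or_lt
  · simpa using hb.le
  · have h := mul_le_mul_of_nonneg_left (log_le_sub_one_of_pos (div_pos hb ha)) ha.le
    rw [log_div hb.ne' ha.ne', mul_sub, mul_sub, mul_div_cancel₀ _ ha.ne'] at h
    linarith

variable {p p' : ℝ → ℝ}

theorem integrable_mul_log_gaussDensity (hpi : Integrable p)
    (hx2 : Integrable fun x ↦ x ^ 2 * p x) {s : ℝ} (hs : 0 < s) :
    Integrable fun x ↦ p x * log (gaussDensity s x) := by
  simp_rw [log_gaussDensity hs]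
  refine ((hpi.const_mul (-(1 / 2 * log (2 * π * s)))).sub (hx2.div_const (2 * s))).congr
    (ae_of_all _ fun x ↦ ?_)
  simp only [Pi.sub_apply]
  ring

theorem integral_mul_log_gaussDensity (hpi : Integrable p)
    (hx2 : Integrable fun x ↦ x ^ 2 * p x) {s : ℝ} (hs : 0 < s) :
    ∫ x, p x * log (gaussDensity s x) =
      -(1 / 2 * log (2 * π * s)) * (∫ x, p x) - (∫ x, x ^ 2 * p x) / (2 * s) := by
  simp_rw [log_gaussDensity hs]
  rw [← integral_const_mul, ← integral_div, ← integral_sub (hpi.const_mul _) (hx2.div_const _)]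
  congr 1 with x
  ring

theorem integrable_mul_log (hp : ∀ x, 0 ≤ p x) (hpi : Integrable p)
    (hx2 : Integrable fun x ↦ x ^ 2 * p x) {M : ℝ} (hM : ∀ x, p x ≤ M) :
    Integrable fun x ↦ p x * log (p x) := by
  have hg := integrable_mul_log_gaussDensity hpi hx2 one_pos
  refine (((hpi.const_mul M).add hg.abs).add (integrable_gaussDensity one_pos)).mono'
    (hpi.aestronglyMeasurable.mul
      (measurable_log.comp_aemeasurable hpi.aemeasurable).aestronglyMeasurable)
    (ae_of_all _ fun x ↦ ?_)
  have hpx := hp x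
  have hM' := mul_le_mul_of_nonneg_right (hM x) hpx
  have hgx := gaussDensity_pos one_pos x
  have h1 := sub_le_mul_log_sub_mul_log hpx hgx
  have h2 := neg_abs_le (p x * log (gaussDensity 1 x))
  have h3 := abs_nonneg (p x * log (gaussDensity 1 x))
  have h4 : p x * log (p x) ≤ p x * p x := by
    gcongr
    exact log_le_self hpx
  simp only [Pi.add_apply, Real.norm_eq_abs]
  rw [abs_le]
  have h5 := mul_nonneg hpx hpx
  constructor <;> linarith

/-- Gibbs' inequality against a centered Gaussian density. -/
theorem neg_integral_mul_log_le (hp : ∀ x, 0 ≤ p x) (hpi : Integrable p) (hp1 : ∫ x, p x = 1)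
    (hx2 : Integrable fun x ↦ x ^ 2 * p x) (hlog : Integrable fun x ↦ p x * log (p x))
    {s : ℝ} (hs : 0 < s) :
    -∫ x, p x * log (p x) ≤ 1 / 2 * log (2 * π * s) + (∫ x, x ^ 2 * p x) / (2 * s) := by
  have hg := integrable_mul_log_gaussDensity hpi hx2 hs
  have h := integral_mono (hpi.sub (integrable_gaussDensity hs)) (hlog.sub hg)
    fun x ↦ sub_le_mul_log_sub_mul_log (hp x) (gaussDensity_pos hs x)
  simp only [Pi.sub_apply] at h
  rw [integral_sub hpi (integrable_gaussDensity hs), integral_sub hlog hg, hp1,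
    integral_gaussDensity hs, integral_mul_log_gaussDensity hpi hx2 hs, hp1] at h
  linarith

theorem integral_withDensity_ofReal (hm : Measurable p) (hp : ∀ x, 0 ≤ p x) (g : ℝ → ℝ) :
    ∫ x, g x ∂(volume.withDensity fun x ↦ ENNReal.ofReal (p x)) = ∫ x, g x * p x := by
  rw [integral_withDensity_eq_integral_toReal_smul hm.ennreal_ofReal
    (ae_of_all _ fun _ ↦ ENNReal.ofReal_lt_top)]
  congr 1 with x
  rw [ENNReal.toReal_ofReal (hp x), smul_eq_mul, mul_comm]

theorem integrable_withDensity_ofReal_iff (hm : Measurable p) (hp : ∀ x, 0 ≤ p x) {g : ℝ → ℝ} :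
    Integrable g (volume.withDensity fun x ↦ ENNReal.ofReal (p x)) ↔
      Integrable fun x ↦ g x * p x := by
  rw [integrable_withDensity_iff_integrable_smul' hm.ennreal_ofReal
    (ae_of_all _ fun _ ↦ ENNReal.ofReal_lt_top)]
  congr! 2 with x
  rw [ENNReal.toReal_ofReal (hp x), smul_eq_mul, mul_comm]

theorem tendsto_setIntegral_Ioc_of_eventually_mem {f : ℝ → ℝ} (hf : Integrable f) {a b : ℕ → ℝ}
    (h : ∀ᵐ x, f x ≠ 0 → ∀ᶠ n in atTop, x ∈ Ioc (a n) (b n)) :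
    Tendsto (fun n ↦ ∫ x in Ioc (a n) (b n), f x) atTop (𝓝 (∫ x, f x)) := by
  simp_rw [← integral_indicator measurableSet_Ioc]
  refine tendsto_integral_of_dominated_convergence (fun x ↦ ‖f x‖)
    (fun n ↦ (hf.indicator measurableSet_Ioc).aestronglyMeasurable) hf.norm
    (fun n ↦ ae_of_all _ fun x ↦ norm_indicator_le_norm_self f x) ?_
  filter_upwards [h] with x hx
  obtain h0 | h0 := eq_or_ne (f x) 0
  · simp [indicator_apply, h0]
  · refine tendsto_const_nhds.congr' ?_
    filter_upwards [hx h0] with n hn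
    rw [indicator_of_mem hn]

/-- Euclidean logarithmic Sobolev inequality in dimension one, with the constant `c` standing for
any upper bound of the square root of the Fisher information. -/
theorem HasACDeriv.integral_mul_log_le (h : HasACDeriv p p') (hm : Measurable p)
    (hp : ∀ x, 0 ≤ p x)
    [IsProbabilityMeasure (volume.withDensity fun x ↦ ENNReal.ofReal (p x))]
    (hpi : Integrable p) (hp1 : ∫ x, p x = 1)
    (hJ : Integrable fun x ↦ (p' x) ^ 2 / p x) (hlog : Integrable fun x ↦ p x * log (p x))
    {c : ℝ} (hc : 0 < c) (hJc : fisherInfo p p' ≤ c ^ 2) :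
    ∫ x, p x * log (p x) ≤ log c - 1 / 2 * log (2 * π) - 1 / 2 := by
  set μ : Measure ℝ := volume.withDensity fun x ↦ ENNReal.ofReal (p x) with hμ
  have hFd : ∀ x, HasDerivAt (cdf μ) (p x) x := hasDerivAt_cdf h.continuous hp hμ
  have hF : Continuous (cdf μ) := continuous_iff_continuousAt.2 fun x ↦ (hFd x).continuousAt
  set T : ℝ → ℝ := fun x ↦ gaussianQuantile (cdf μ x) with hT
  set T' : ℝ → ℝ := fun x ↦ (gaussianPDFReal 0 1 (T x))⁻¹ * p x with hT'
  have hTm : Measurable T := measurable_gaussianQuantile.comp hF.measurable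
  have hTd : ∀ x, cdf μ x ∈ Ioo (0 : ℝ) 1 → HasDerivAt T (T' x) x := fun x hx ↦
    (hasDerivAt_gaussianQuantile hx).comp x (hFd x)
  have hU : ∀ᵐ x, p x ≠ 0 → cdf μ x ∈ Ioo (0 : ℝ) 1 := by
    filter_upwards [(ae_withDensity_iff hm.ennreal_ofReal).1 (ae_cdf_mem_Ioo hF)] with x hx hpx
    exact hx (ENNReal.ofReal_pos.2 ((hp x).lt_of_ne' hpx)).ne'
  have hmap : μ.map T = gaussianReal 0 1 := map_gaussianQuantile_cdf hF
  have hT2μ : Integrable (fun x ↦ T x ^ 2) μ := by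
    have hg : Integrable (fun y : ℝ ↦ y ^ 2) (μ.map T) := by
      rw [hmap]
      exact (memLp_id_gaussianReal 2).integrable_sq
    exact hg.comp_measurable hTm
  have hT2 : Integrable fun x ↦ T x ^ 2 * p x :=
    (integrable_withDensity_ofReal_iff hm hp).1 hT2μ
  have hT2i : ∫ x, T x ^ 2 * p x = 1 := by
    rw [← integral_withDensity_ofReal hm hp fun x ↦ T x ^ 2]
    have hv := variance_of_integral_eq_zero (X := id) (μ := gaussianReal 0 1) aemeasurable_id
      (by simp)
    rw [variance_id_gaussianReal, ← hmap,
      integral_map hTm.aemeasurable (by fun_prop)] at hv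
    simpa using hv.symm
  choose α hα using fun n : ℕ ↦ exists_cdf_eq hF (cdf_gaussianReal_mem_Ioo (-((n : ℝ) + 1)))
  choose β hβ using fun n : ℕ ↦ exists_cdf_eq hF (cdf_gaussianReal_mem_Ioo ((n : ℝ) + 1))
  have hTα : ∀ n, T (α n) = -((n : ℝ) + 1) := fun n ↦ by
    simp only [hT, hα, gaussianQuantile_cdf]
  have hTβ : ∀ n, T (β n) = (n : ℝ) + 1 := fun n ↦ by simp only [hT, hβ, gaussianQuantile_cdf]
  have hαm : ∀ n, cdf μ (α n) ∈ Ioo (0 : ℝ) 1 := fun n ↦ hα n ▸ cdf_gaussianReal_mem_Ioo _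
  have hβm : ∀ n, cdf μ (β n) ∈ Ioo (0 : ℝ) 1 := fun n ↦ hβ n ▸ cdf_gaussianReal_mem_Ioo _
  have hTmono : ∀ {x y}, cdf μ x ∈ Ioo (0 : ℝ) 1 → cdf μ y ∈ Ioo (0 : ℝ) 1 → x ≤ y →
      T x ≤ T y := fun hx hy hxy ↦
    strictMonoOn_gaussianQuantile.monotoneOn hx hy (monotone_cdf μ hxy)
  have hαβ : ∀ n, α n ≤ β n := fun n ↦ by
    by_contra! hlt
    have hle := hTmono (hβm n) (hαm n) hlt.le
    rw [hTα, hTβ] at hle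
    have : (0 : ℝ) ≤ n := n.cast_nonneg
    linarith
  have hIcc : ∀ n, ∀ x ∈ Icc (α n) (β n), cdf μ x ∈ Ioo (0 : ℝ) 1 := fun n x hx ↦
    ⟨(hαm n).1.trans_le (monotone_cdf μ hx.1), (monotone_cdf μ hx.2).trans_lt (hβm n).2⟩
  have hTc : ∀ n, ContinuousOn T (Icc (α n) (β n)) := fun n x hx ↦
    (hTd x (hIcc n x hx)).continuousAt.continuousWithinAt
  have hT'c : ∀ n, ContinuousOn T' (Icc (α n) (β n)) := fun n ↦ by
    refine ContinuousOn.mul (ContinuousOn.inv₀ ?_ fun x _ ↦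
      (gaussianPDFReal_pos 0 1 (T x) one_ne_zero).ne') h.continuous.continuousOn
    have hφ : Continuous (gaussianPDFReal 0 1) := by
      rw [gaussianPDFReal_def]
      fun_prop
    exact hφ.comp_continuousOn (hTc n)
  have hmem : ∀ x, cdf μ x ∈ Ioo (0 : ℝ) 1 → ∀ᶠ n in atTop, x ∈ Ioc (α n) (β n) := by
    intro x hx
    obtain ⟨N, hN⟩ := exists_nat_gt |T x|
    filter_upwards [eventually_ge_atTop N] with n hn
    have hnN : (N : ℝ) ≤ n := by exact_mod_cast hn
    have habs := abs_lt.1 hN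
    constructor
    · by_contra! hle
      have := hTmono hx (hαm n) hle
      rw [hTα] at this
      linarith
    · by_contra! hlt
      have := hTmono (hβm n) hx hlt.le
      rw [hTβ] at this
      linarith
  have hparts : ∀ n, ∫ x in Ioc (α n) (β n), p x * T' x ≤ c := fun n ↦ by
    have hout : ∀ᵐ x, p x ≠ 0 → (x ≤ α n ∨ β n < x) → (n : ℝ) + 1 ≤ |T x| := by
      filter_upwards [hU] with x hx hpx hxo
      obtain hxo | hxo := hxo
      · have := hTmono (hx hpx) (hαm n) hxo
        rw [hTα] at this
        exact le_abs.2 (Or.inr (by linarith))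
      · have := hTmono (hβm n) (hx hpx) hxo.le
        rw [hTβ] at this
        exact le_abs.2 (Or.inl this)
    refine (h.integral_mul_deriv_le hp hpi hJ (hαβ n) (by positivity) hc
      (fun x hx ↦ hTd x (hIcc n x hx)) (hT'c n) (hTα n) (hTβ n) hout hT2).trans ?_
    rw [hT2i]
    have : fisherInfo p p' / c ≤ c := by
      rw [div_le_iff₀ hc]
      linarith
    linarith
  set G : ℝ → ℝ := fun x ↦
    (log c - 1 / 2 * log (2 * π) - 1) * p x - T x ^ 2 * p x / 2 with hG
  have hGi : Integrable G := (hpi.const_mul _).sub (hT2.div_const 2)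
  have hGint : ∫ x, G x = log c - 1 / 2 * log (2 * π) - 1 - 1 / 2 := by
    rw [hG, integral_sub (hpi.const_mul _) (hT2.div_const 2), integral_const_mul, integral_div,
      hT2i, hp1, mul_one]
  have hpoint : ∀ x, p x * log (p x) ≤ G x + p x * T' x / c := by
    intro x
    obtain h0 | h0 := (hp x).eq_or_lt
    · simp [hG, ← h0]
    · have hφ : 0 < gaussianPDFReal 0 1 (T x) := gaussianPDFReal_pos 0 1 (T x) one_ne_zero
      have hT'pos : 0 < T' x := mul_pos (inv_pos.2 hφ) h0
      have hlogφ : log (gaussianPDFReal 0 1 (T x)) = -(1 / 2 * log (2 * π)) - T x ^ 2 / 2 := by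
        have := log_gaussDensity one_pos (T x)
        rwa [gaussDensity_eq_gaussianPDFReal zero_le_one, Real.toNNReal_one, mul_one,
          mul_one] at this
      have hpe : log (p x) = log (gaussianPDFReal 0 1 (T x)) + log c + log (T' x / c) := by
        rw [log_div hT'pos.ne' hc.ne', hT', log_mul (inv_pos.2 hφ).ne' h0.ne', log_inv]
        ring
      have hl := mul_le_mul_of_nonneg_left (log_le_sub_one_of_pos (div_pos hT'pos hc)) h0.le
      rw [hpe, hlogφ, hG]
      have : p x * T' x / c = p x * (T' x / c) := mul_div_assoc _ _ _
      rw [this]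
      linarith
  have hbound : ∀ n, ∫ x in Ioc (α n) (β n), p x * log (p x) ≤
      (∫ x in Ioc (α n) (β n), G x) + 1 := fun n ↦ by
    have hpT : IntegrableOn (fun x ↦ p x * T' x) (Ioc (α n) (β n)) :=
      ((h.continuous.continuousOn.mul (hT'c n)).integrableOn_Icc).mono_set Ioc_subset_Icc_self
    have hmono := integral_mono (μ := volume.restrict (Ioc (α n) (β n))) hlog.integrableOn
      (hGi.integrableOn.add (hpT.div_const c)) hpoint
    simp only [Pi.add_apply] at hmono
    rw [integral_add hGi.integrableOn (hpT.div_const c), integral_div] at hmono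
    have := (div_le_one hc).2 (hparts n)
    linarith
  have hlim := le_of_tendsto_of_tendsto'
    (tendsto_setIntegral_Ioc_of_eventually_mem hlog ?_)
    ((tendsto_setIntegral_Ioc_of_eventually_mem hGi ?_).add_const 1) hbound
  · rw [hGint] at hlim
    linarith
  · filter_upwards [hU] with x hx hne
    exact hmem x (hx (left_ne_zero_of_mul hne))
  · filter_upwards [hU] with x hx hne
    refine hmem x (hx fun h0 ↦ hne ?_)
    simp [hG, h0]

end Entropy

section DivergenceBound

theorem log_div_two_mul_rpow_le_iSup {t : ℝ} (ht : 0 < t) {x : ℝ} (hx : 0 < x) :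
    log x / (2 * x ^ t) ≤ ⨆ y ∈ Ici (1 : ℝ), log y / (2 * y ^ t) := by
  have hbdd : BddAbove (range fun y : ℝ ↦ ⨆ _ : y ∈ Ici (1 : ℝ), log y / (2 * y ^ t)) := by
    refine ⟨1 / (2 * t), ?_⟩
    rintro _ ⟨y, rfl⟩
    refine Real.iSup_le (fun hy ↦ ?_) (by positivity)
    have hy0 : 0 < y := one_pos.trans_le hy
    rw [div_le_div_iff₀ (by positivity) (by positivity)]
    have := log_le_rpow_div hy0.le ht
    rw [le_div_iff₀ ht] at this
    linarith
  obtain h1 | h1 := le_or_gt 1 x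
  · exact (le_of_eq (ciSup_pos (f := fun _ ↦ log x / (2 * x ^ t)) (mem_Ici.2 h1)).symm).trans
      (le_ciSup hbdd x)
  · refine (div_nonpos_of_nonpos_of_nonneg (log_nonpos hx.le h1.le) (by positivity)).trans ?_
    refine Real.iSup_nonneg fun y ↦ Real.iSup_nonneg fun hy ↦ ?_
    have hy0 : 0 < y := one_pos.trans_le hy
    exact div_nonneg (log_nonneg hy) (by positivity)

theorem half_log_le_iSup_mul_rpow {t : ℝ} (ht : 0 < t) {x : ℝ} (hx : 0 < x) :
    1 / 2 * log x ≤ (⨆ y ∈ Ici (1 : ℝ), log y / (2 * y ^ t)) * x ^ t := by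
  have hxt : 0 < x ^ t := rpow_pos_of_pos hx t
  have := mul_le_mul_of_nonneg_right (log_div_two_mul_rpow_le_iSup ht hx) hxt.le
  refine le_of_eq_of_le ?_ this
  field_simp

end DivergenceBound

theorem IsDensityOf.integral_comp {Ω : Type*} [MeasurableSpace Ω] {P : Measure Ω} {X : Ω → ℝ}
    {p : ℝ → ℝ} (hX : IsDensityOf P X p) {g : ℝ → ℝ} (hg : Measurable g) :
    ∫ x, g x * p x = ∫ ω, g (X ω) ∂P := by
  rw [← integral_withDensity_ofReal hX.2.1 hX.2.2.1, ← hX.2.2.2,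
    integral_map hX.1.aemeasurable hg.aestronglyMeasurable]

theorem IsDensityOf.integrable_comp_iff {Ω : Type*} [MeasurableSpace Ω] {P : Measure Ω}
    {X : Ω → ℝ} {p : ℝ → ℝ} (hX : IsDensityOf P X p) {g : ℝ → ℝ} (hg : Measurable g) :
    Integrable (fun x ↦ g x * p x) ↔ Integrable (fun ω ↦ g (X ω)) P := by
  rw [← integrable_withDensity_ofReal_iff hX.2.1 hX.2.2.1, ← hX.2.2.2,
    integrable_map_measure hg.aestronglyMeasurable hX.1.aemeasurable]
  rfl

/-- **Lemma 3.2.** Let `X` be a centered random variable with absolutely continuous density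
`p`, finite Fisher information `J(X)` and finite variance.  Then
`(1/2) ln(2πe / J(X)) ≤ h(X) ≤ (1/2) ln(2πe Var(X))`, where `h(X) = -∫ p ln p` is the
differential entropy; moreover for every `t > 0`,
`D(X) ≤ C(t)(Var(X)^t + J(X)^t)`, where `C(t) := sup_{x ≥ 1} (ln x)/(2 x^t)`. -/
theorem entropy_bounds_and_D_bound
    {Ω : Type*} [MeasurableSpace Ω] (P : Measure Ω) [IsProbabilityMeasure P]
    (X : Ω → ℝ) (p p' : ℝ → ℝ)
    (hX : IsDensityOf P X p) (hAC : HasACDeriv p p')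
    (hmean : ∫ ω, X ω ∂P = 0)
    (hJfin : Integrable (fun x => (p' x) ^ 2 / p x))
    (hVarfin : Integrable (fun ω => (X ω) ^ 2) P) :
    (1 / 2) * Real.log (2 * Real.pi * Real.exp 1 / fisherInfo p p') ≤
        -∫ x, p x * Real.log (p x) ∧
    -∫ x, p x * Real.log (p x) ≤
        (1 / 2) * Real.log (2 * Real.pi * Real.exp 1 * ProbabilityTheory.variance X P) ∧
    ∀ t : ℝ, 0 < t →
      KLdiv p (gaussDensity (ProbabilityTheory.variance X P)) ≤
        (⨆ x ∈ Set.Ici (1 : ℝ), Real.log x / (2 * x ^ t)) *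
          ((ProbabilityTheory.variance X P) ^ t + (fisherInfo p p') ^ t) := by
  have hm := hX.2.1
  have hp := hX.2.2.1
  have : IsProbabilityMeasure (volume.withDensity fun x ↦ ENNReal.ofReal (p x)) := by
    rw [← hX.2.2.2]
    exact Measure.isProbabilityMeasure_map hX.1.aemeasurable
  have hpi : Integrable p := by
    simpa using (hX.integrable_comp_iff (g := fun _ ↦ (1 : ℝ)) measurable_const).2
      (integrable_const 1)
  have hp1 : ∫ x, p x = 1 := by
    simpa using hX.integral_comp (g := fun _ ↦ (1 : ℝ)) measurable_const
  have hx2 : Integrable fun x ↦ x ^ 2 * p x :=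
    (hX.integrable_comp_iff (g := fun x ↦ x ^ 2) (by fun_prop)).2 hVarfin
  have hv : ∫ x, x ^ 2 * p x = variance X P := by
    rw [variance_of_integral_eq_zero hX.1.aemeasurable hmean]
    exact hX.integral_comp (g := fun x ↦ x ^ 2) (by fun_prop)
  have hlog : Integrable fun x ↦ p x * log (p x) :=
    integrable_mul_log hp hpi hx2
      (hAC.le_integral_abs hpi (hAC.integrable_deriv hp hpi hJfin))
  have upper := fun (s : ℝ) (hs : 0 < s) ↦ neg_integral_mul_log_le hp hpi hp1 hx2 hlog hs
  have lower := fun (c : ℝ) (hc : 0 < c) (hJc : fisherInfo p p' ≤ c ^ 2) ↦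
    hAC.integral_mul_log_le hm hp hpi hp1 hJfin hlog hc hJc
  rw [hv] at upper
  set v := variance X P with hvdef
  set J := fisherInfo p p' with hJdef
  set E := ∫ x, p x * log (p x) with hE
  have hvpos : 0 < v := by
    refine (variance_nonneg X P).lt_of_ne' fun h0 ↦ ?_
    have h := upper (exp (-2 * E - 2 - log (2 * π))) (exp_pos _)
    rw [← hvdef] at h0
    rw [h0, log_mul (by positivity) (exp_pos _).ne', log_exp] at h
    simp only [zero_div] at h
    linarith
  have hJpos : 0 < J := by
    refine (integral_nonneg fun x ↦ div_nonneg (sq_nonneg _) (hp x)).lt_of_ne' fun h0 ↦ ?_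
    have h := lower (exp (E + 1 / 2 * log (2 * π))) (exp_pos _) (by
      rw [hJdef, fisherInfo, h0]
      positivity)
    rw [log_exp] at h
    linarith
  have h1 : 1 / 2 * log (2 * π * exp 1 / J) ≤ -E := by
    have h := lower (√J) (sqrt_pos.2 hJpos) (sq_sqrt hJpos.le).ge
    rw [log_sqrt hJpos.le] at h
    rw [log_div (by positivity) hJpos.ne', log_mul (by positivity) (exp_pos _).ne', log_exp]
    linarith
  have h2 : -E ≤ 1 / 2 * log (2 * π * v) + 1 / 2 := by
    have h := upper v hvpos
    have hvv : v / (2 * v) = 1 / 2 := by field_simp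
    rwa [hvv] at h
  refine ⟨h1, ?_, fun t ht ↦ ?_⟩
  · rw [mul_right_comm, log_mul (by positivity) (exp_pos _).ne', log_exp]
    linarith
  · have hKL : KLdiv p (gaussDensity v) = E + 1 / 2 * log (2 * π * v) + 1 / 2 := by
      have hg := integrable_mul_log_gaussDensity hpi hx2 hvpos
      have heq : ∀ x, p x * log (p x / gaussDensity v x) =
          p x * log (p x) - p x * log (gaussDensity v x) := fun x ↦ by
        obtain h0 | h0 := eq_or_ne (p x) 0
        · simp [h0]
        · rw [log_div h0 (gaussDensity_pos hvpos x).ne', mul_sub]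
      rw [KLdiv, funext heq, integral_sub hlog hg,
        integral_mul_log_gaussDensity hpi hx2 hvpos, hp1, hv, hE]
      field_simp
      ring
    rw [hKL, mul_add]
    have hv' := half_log_le_iSup_mul_rpow ht hvpos
    have hJ' := half_log_le_iSup_mul_rpow ht hJpos
    rw [log_div (by positivity) hJpos.ne', log_mul (by positivity) (exp_pos _).ne',
      log_exp] at h1
    rw [log_mul (by positivity) hvpos.ne']
    linarith
end
end

section
/- Let (X, Y) be a two-dimensional random vector and let (X_1, Y_1), (X_2, Y_2), … be i.i.d. copies of (X, Y). Set S_n := (X_1 + … + X_n)/√n and 𝐘_n := (Y_1, …, Y_n). Assume: (1) for P_Y-almost every y, the conditional distribution of X given Y = y is absolutely continuous with respect to Lebesgue measure, with absolutely continuous density; (2) there exist u > 3 and k > 6 with E|X|^k < ∞ and E[J(X|Y)^u] := ∫ J(X|Y=y)^u dP_Y(y) < ∞, such that α := 6/k + 3/u < 1. Then for every ε ∈ (0, (1−α)/(4+α)), E D(S_n|𝐘_n) := ∫ D(S_n | 𝐘_n = 𝐲) dP_{𝐘_n}(𝐲) = O(n^{−((1−α)/(4+α) − ε)}) as n → ∞.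 -/
open MeasureTheory Real Filter ProbabilityTheory
open scoped ENNReal

noncomputable section

/-- Fisher information `J(p) = ∫ p'²/p` (as an extended real) of a density `p` with
derivative `p'`. -/
def fisherInfoL (p p' : ℝ → ℝ) : ℝ≥0∞ := ∫⁻ x, ENNReal.ofReal ((p' x) ^ 2 / p x)

/-- The mean of a probability measure on `ℝ`. -/
def meanM (μ : Measure ℝ) : ℝ := ∫ x, x ∂μ

/-- The variance of a probability measure on `ℝ`. -/
def varM (μ : Measure ℝ) : ℝ := ∫ x, (x - meanM μ) ^ 2 ∂μ

/-- `D(μ) = KL(μ ‖ G_μ)`, the Kullback–Leibler divergence of a probability measure `μ` on `ℝ`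
from the Gaussian with the same mean and variance, expressed through the log-likelihood
ratio. -/
def Dm (μ : Measure ℝ) : ℝ :=
  ∫ x, llr μ (gaussianReal (meanM μ) (Real.toNNReal (varM μ))) x ∂μ

/-- The conditional law of `S_n = (X₁ + ⋯ + Xₙ)/√n` given `𝐘_n = 𝐲`, when the conditional law
of `X` given `Y = y` is `κ y`: the push-forward of `∏ᵢ κ(yᵢ)` under `v ↦ (∑ᵢ vᵢ)/√n`. -/
def condSnLaw (κ : Kernel ℝ ℝ) (n : ℕ) (y : Fin n → ℝ) : Measure ℝ :=
  Measure.map (fun v : Fin n → ℝ => (∑ i, v i) / Real.sqrt (n : ℝ))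
    (Measure.pi fun i => κ (y i))

lemma withDensity_eq_gaussianReal_withDensity {p : ℝ → ℝ} (hpm : Measurable p)
    (m : ℝ) {v : NNReal} (hv : v ≠ 0) :
    volume.withDensity (fun x => ENNReal.ofReal (p x)) =
      (gaussianReal m v).withDensity
        (fun x => ENNReal.ofReal (p x / gaussianPDFReal m v x)) := by
  have hg := gaussianPDFReal_pos m v
  rw [gaussianReal_of_var_ne_zero m hv, ← withDensity_mul _ (measurable_gaussianPDF m v)
    (by have := measurable_gaussianPDFReal m v; fun_prop)]
  congr 1
  ext x
  have hx := hg x hv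
  simp only [Pi.mul_apply, gaussianPDF]
  rw [← ENNReal.ofReal_mul hx.le, mul_div_cancel₀ _ hx.ne']

lemma ae_pos_of_withDensity {p : ℝ → ℝ} (hpm : Measurable p) :
    ∀ᵐ x ∂(volume.withDensity (fun x => ENNReal.ofReal (p x))), 0 < p x := by
  rw [ae_withDensity_iff (by fun_prop)]
  refine ae_of_all _ fun x hx => ?_
  by_contra h
  exact hx (ENNReal.ofReal_of_nonpos (not_lt.mp h))

lemma llr_withDensity_gaussianReal {p : ℝ → ℝ} (hpm : Measurable p)
    (m : ℝ) {v : NNReal} (hv : v ≠ 0) {P : Measure ℝ}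
    (hP : P = volume.withDensity (fun x => ENNReal.ofReal (p x))) :
    ∀ᵐ x ∂P, 0 < p x ∧
      llr P (gaussianReal m v) x = Real.log (p x / gaussianPDFReal m v x) := by
  have hpos : ∀ᵐ x ∂P, 0 < p x := hP ▸ ae_pos_of_withDensity hpm
  have hPG := hP.trans (withDensity_eq_gaussianReal_withDensity hpm m hv)
  have hac : P ≪ gaussianReal m v := hPG ▸ withDensity_absolutelyContinuous _ _
  have h := Measure.rnDeriv_withDensity (gaussianReal m v)
    (f := fun x => ENNReal.ofReal (p x / gaussianPDFReal m v x))
    (by have := measurable_gaussianPDFReal m v; fun_prop)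
  rw [← hPG] at h
  filter_upwards [hpos, hac.ae_le h] with x hx hx'
  refine ⟨hx, ?_⟩
  rw [llr, hx', ENNReal.toReal_ofReal (div_nonneg hx.le (gaussianPDFReal_nonneg m v x))]

lemma integral_llr_le_of_log_le {p : ℝ → ℝ} (hpm : Measurable p)
    (m : ℝ) {v : NNReal} (hv : v ≠ 0) {P : Measure ℝ}
    (hP : P = volume.withDensity (fun x => ENNReal.ofReal (p x)))
    {w : ℝ → ℝ} (hw : Integrable w P) (hw0 : ∀ x, 0 ≤ w x)
    (hpw : ∀ x, 0 < p x → Real.log (p x / gaussianPDFReal m v x) ≤ w x) :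
    ∫ x, llr P (gaussianReal m v) x ∂P ≤ ∫ x, w x ∂P := by
  by_cases hi : Integrable (llr P (gaussianReal m v)) P
  · refine integral_mono_ae hi hw ?_
    filter_upwards [llr_withDensity_gaussianReal hpm m hv hP] with x hx
    exact hx.2.le.trans (hpw x hx.1)
  · rw [integral_undef hi]
    exact integral_nonneg hw0

lemma integral_llr_gaussianReal_nonneg {p : ℝ → ℝ} (hpm : Measurable p)
    (m : ℝ) {v : NNReal} (hv : v ≠ 0) {P : Measure ℝ} [IsProbabilityMeasure P]
    (hP : P = volume.withDensity (fun x => ENNReal.ofReal (p x))) :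
    0 ≤ ∫ x, llr P (gaussianReal m v) x ∂P := by
  have hPG := hP.trans (withDensity_eq_gaussianReal_withDensity hpm m hv)
  have hac : P ≪ gaussianReal m v := hPG ▸ withDensity_absolutelyContinuous _ _
  by_cases hi : Integrable (llr P (gaussianReal m v)) P
  · simpa using InformationTheory.integral_llr_add_sub_measure_univ_nonneg hac hi
  · rw [integral_undef hi]

lemma neg_log_gaussianPDFReal (m : ℝ) {v : NNReal} (hv : v ≠ 0) (x : ℝ) :
    -Real.log (gaussianPDFReal m v x) =
      Real.log (2 * π * v) / 2 + (x - m) ^ 2 / (2 * v) := by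
  rw [gaussianPDFReal_def, Real.log_mul (by positivity) (by positivity), Real.log_inv,
    Real.log_sqrt (by positivity), Real.log_exp]
  ring

lemma integral_sqrt_gaussianPDFReal (m : ℝ) {v : NNReal} (hv : v ≠ 0) :
    Integrable (fun x => √(gaussianPDFReal m v x)) ∧
    ∫ x, √(gaussianPDFReal m v x) = √√(8 * π * v) := by
  have h : (fun x => √(gaussianPDFReal m v x)) =
      fun x => √((√(2 * π * v))⁻¹) * rexp (-(1 / (4 * v)) * (x - m) ^ 2) := by
    ext x
    rw [gaussianPDFReal_def, Real.sqrt_mul (by positivity), Real.sqrt_eq_rpow (rexp _),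
      ← Real.exp_mul]
    congr 2
    field_simp
    ring
  have hb : (0 : ℝ) < 1 / (4 * v) := by positivity
  constructor
  · rw [h]
    exact ((integrable_exp_neg_mul_sq hb).comp_sub_right m).const_mul _
  · rw [h, integral_const_mul,
      integral_sub_right_eq_self (fun x => rexp (-(1 / (4 * v)) * x ^ 2)) m,
      integral_gaussian, ← Real.sqrt_mul (by positivity)]
    congr 1
    rw [inv_mul_eq_div, div_eq_iff (by positivity), ← Real.sqrt_mul (by positivity)]
    rw [show 8 * π * (v : ℝ) * (2 * π * v) = (4 * π * v) ^ 2 by ring, Real.sqrt_sq (by positivity)]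
    field_simp

lemma integrable_of_isProbabilityMeasure_withDensity {p : ℝ → ℝ} (hpm : Measurable p)
    (hp0 : ∀ x, 0 ≤ p x) {P : Measure ℝ} [IsProbabilityMeasure P]
    (hP : P = volume.withDensity (fun x => ENNReal.ofReal (p x))) :
    Integrable p ∧ ∫ x, p x = 1 := by
  have h1 : ∫⁻ x, ENNReal.ofReal (p x) = 1 := by
    have : P Set.univ = 1 := measure_univ
    rw [hP, withDensity_apply _ MeasurableSet.univ] at this
    simpa using this
  refine ⟨⟨hpm.aestronglyMeasurable, ?_⟩, ?_⟩
  · rw [hasFiniteIntegral_iff_ofReal (ae_of_all _ hp0), h1]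
    exact ENNReal.one_lt_top
  · rw [integral_eq_lintegral_of_nonneg_ae (ae_of_all _ hp0) hpm.aestronglyMeasurable, h1]
    simp

/-- A probability density bounded by `g + δ`, where `g` is the Gaussian density with the same mean
and variance, has relative entropy at most `2 √δ ∫ √g`. -/
lemma integral_llr_le_sqrt {p : ℝ → ℝ} (hpm : Measurable p) (hp0 : ∀ x, 0 ≤ p x)
    (m : ℝ) {v : NNReal} (hv : v ≠ 0) {P : Measure ℝ} [IsProbabilityMeasure P]
    (hP : P = volume.withDensity (fun x => ENNReal.ofReal (p x)))
    (hint : Integrable (fun x => (x - m) ^ 2) P) (hvar : ∫ x, (x - m) ^ 2 ∂P = v)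
    {δ : ℝ} (hδ : 0 < δ) (hpδ : ∀ x, p x ≤ gaussianPDFReal m v x + δ) :
    ∫ x, llr P (gaussianReal m v) x ∂P ≤ 2 * √δ * √√(8 * π * v) := by
  set g := gaussianPDFReal m v with hgdef
  have hg : ∀ x, 0 < g x := fun x => gaussianPDFReal_pos m v x hv
  have hgm : Measurable g := measurable_gaussianPDFReal m v
  obtain ⟨hsi, hs⟩ := integral_sqrt_gaussianPDFReal m hv
  set w : ℝ → ℝ := fun x => Real.log (1 + δ / g x)
  set L : ℝ → ℝ := fun x => Real.log (1 + g x / δ)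
  have hlog : ∀ t : ℝ, 0 ≤ t → Real.log (1 + t) ≤ √t := by
    intro t ht
    have h3 : 1 + t ≤ rexp (√t) := by
      have h5 := Real.sq_sqrt ht
      have h4 : 1 + √t + √t ^ 2 / 2 + √t ^ 3 / 6 ≤ rexp √t := by
        have := Real.sum_le_exp_of_nonneg (Real.sqrt_nonneg t) 4
        simp [Finset.sum_range_succ, Nat.factorial] at this
        linarith
      nlinarith [Real.sqrt_nonneg t, sq_nonneg (√t - 3/2), sq_nonneg (√t),
        mul_nonneg (Real.sqrt_nonneg t) (sq_nonneg (√t - 3/2))]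
    rw [Real.log_le_iff_le_exp (by positivity)]
    exact h3
  have hw0 : ∀ x, 0 ≤ w x := fun x => Real.log_nonneg (by have := hg x; simp; positivity)
  have hL0 : ∀ x, 0 ≤ L x := fun x => Real.log_nonneg (by have := hg x; simp; positivity)
  have hwL : ∀ x, w x = L x + (Real.log δ + Real.log (2 * π * v) / 2 + (x - m) ^ 2 / (2 * v)) := by
    intro x
    have hx := hg x
    have := neg_log_gaussianPDFReal m hv x
    rw [← hgdef] at this
    have h1 : 1 + δ / g x = (1 + g x / δ) * (δ / g x) := by field_simp; ring
    simp only [w, L]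
    rw [h1, Real.log_mul (by positivity) (by positivity), Real.log_div hδ.ne' hx.ne']
    linarith
  have hLb : ∀ x, L x ≤ √(g x) / √δ := fun x => by
    have := hlog (g x / δ) (by have := hg x; positivity)
    rwa [Real.sqrt_div (hg x).le] at this
  have hwb : ∀ x, w x ≤ √δ / √(g x) := fun x => by
    have := hlog (δ / g x) (by have := hg x; positivity)
    rwa [Real.sqrt_div hδ.le] at this
  have hLm : Measurable L := by fun_prop
  have hLi : Integrable L := (hsi.div_const √δ).mono' hLm.aestronglyMeasurable
    (ae_of_all _ fun x => by rw [Real.norm_of_nonneg (hL0 x)]; exact hLb x)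
  have hgle : ∀ x, g x ≤ (√(2 * π * v))⁻¹ := fun x => by
    simp only [hgdef, gaussianPDFReal_def]
    refine mul_le_of_le_one_right (by positivity) (Real.exp_le_one_iff.2 ?_)
    have : 0 ≤ (x - m) ^ 2 / (2 * v) := by positivity
    rw [neg_div]; linarith
  have hLbd : ∀ x, ‖L x‖ ≤ √(√(2 * π * v))⁻¹ / √δ := fun x => by
    rw [Real.norm_of_nonneg (hL0 x)]
    refine (hLb x).trans ?_
    gcongr
    exact hgle x
  have hPint : ∀ h : ℝ → ℝ, ∫ x, h x ∂P = ∫ x, p x * h x := fun h => by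
    rw [hP, integral_withDensity_eq_integral_toReal_smul (by fun_prop) (by simp)]
    simp [ENNReal.toReal_ofReal (hp0 _)]
  set c := Real.log δ + Real.log (2 * π * v) / 2
  have hwQ : ∀ Q : Measure ℝ, IsProbabilityMeasure Q → Integrable (fun x => (x - m) ^ 2) Q →
      ∫ x, (x - m) ^ 2 ∂Q = v → Integrable w Q ∧ ∫ x, w x ∂Q = ∫ x, L x ∂Q + (c + 1 / 2) := by
    intro Q _ hiQ hvQ
    have hLQ : Integrable L Q :=
      Integrable.of_bound hLm.aestronglyMeasurable _ (ae_of_all _ hLbd)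
    have hqQ : Integrable (fun x => c + (x - m) ^ 2 / (2 * v)) Q :=
      (integrable_const c).add (hiQ.div_const _)
    rw [show w = _ from funext hwL]
    refine ⟨hLQ.add hqQ, ?_⟩
    rw [integral_add hLQ hqQ, integral_add (integrable_const _) (hiQ.div_const _), integral_div,
      hvQ]
    simp only [integral_const, probReal_univ, one_smul]
    field_simp
  obtain ⟨hwP, hwPeq⟩ := hwQ P inferInstance hint hvar
  have hpi := (integrable_of_isProbabilityMeasure_withDensity hpm hp0 hP).1
  refine (integral_llr_le_of_log_le hpm m hv hP hwP hw0 fun x hx => ?_).trans ?_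
  · have := hg x
    refine Real.log_le_log (by positivity) ?_
    rw [div_le_iff₀ this, add_mul, one_mul, div_mul_cancel₀ _ this.ne']
    exact hpδ x
  set G := gaussianReal m v
  have hGint : ∀ h : ℝ → ℝ, ∫ x, h x ∂G = ∫ x, g x * h x := fun h => by
    rw [integral_gaussianReal_eq_integral_smul hv]; rfl
  have hintG : Integrable (fun x => (x - m) ^ 2) G := by
    have := (memLp_id_gaussianReal (μ := m) (v := v) 2).sub (memLp_const m)
    exact this.integrable_sq
  have hvarG : ∫ x, (x - m) ^ 2 ∂G = v := by
    have h := variance_id_gaussianReal (μ := m) (v := v)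
    rw [variance_eq_integral (by fun_prop)] at h
    simpa [integral_id_gaussianReal] using h
  obtain ⟨-, hwGeq⟩ := hwQ G inferInstance hintG hvarG
  have hgL : Integrable fun x => g x * L x := hLi.bdd_mul hgm.aestronglyMeasurable
    (ae_of_all _ fun x => (Real.norm_of_nonneg (hg x).le).le.trans (hgle x))
  have hpL : Integrable fun x => p x * L x :=
    hpi.mul_bdd (c := _) hLm.aestronglyMeasurable (ae_of_all _ hLbd)
  have h1 : ∫ x, L x ∂P ≤ ∫ x, L x ∂G + √δ * √√(8 * π * v) := by
    rw [hPint, hGint, ← hs, ← integral_const_mul, ← integral_add hgL (hsi.const_mul _)]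
    refine integral_mono hpL (hgL.add (hsi.const_mul _)) fun x => ?_
    have h2 := mul_le_mul_of_nonneg_right (hpδ x) (hL0 x)
    have h3 : δ * L x ≤ √δ * √(g x) := by
      refine (mul_le_mul_of_nonneg_left (hLb x) hδ.le).trans_eq ?_
      have := Real.mul_self_sqrt hδ.le
      have h4 : √δ ≠ 0 := (Real.sqrt_pos.2 hδ).ne'
      rw [mul_div_assoc', div_eq_iff h4]
      linear_combination - √(g x) * this
    change p x * L x ≤ g x * L x + √δ * √(g x)
    linarith
  have h2 : ∫ x, w x ∂G ≤ √δ * √√(8 * π * v) := by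
    rw [hGint, ← hs, ← integral_const_mul]
    refine integral_mono_of_nonneg (ae_of_all _ fun x => mul_nonneg (hg x).le (hw0 x))
      (hsi.const_mul _) (ae_of_all _ fun x => ?_)
    refine (mul_le_mul_of_nonneg_left (hwb x) (hg x).le).trans_eq ?_
    have := Real.mul_self_sqrt (hg x).le
    have h4 : √(g x) ≠ 0 := (Real.sqrt_pos.2 (hg x)).ne'
    rw [mul_div_assoc', div_eq_iff h4]
    linear_combination - √δ * this
  linarith

/-- A crude relative entropy bound for bounded densities. -/
lemma integral_llr_le_log {p : ℝ → ℝ} (hpm : Measurable p)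
    (m : ℝ) {v : NNReal} (hv : v ≠ 0) {P : Measure ℝ} [IsProbabilityMeasure P]
    (hP : P = volume.withDensity (fun x => ENNReal.ofReal (p x)))
    (hint : Integrable (fun x => (x - m) ^ 2) P) (hvar : ∫ x, (x - m) ^ 2 ∂P = v)
    {A : ℝ} (hA : 0 ≤ A) (hpA : ∀ x, p x ≤ A) :
    ∫ x, llr P (gaussianReal m v) x ∂P ≤
      Real.log (1 + A) + Real.log (2 * π * (1 + v)) / 2 + 1 / 2 := by
  have hv2 : 1 ≤ 2 * π * (1 + v) := by nlinarith [Real.pi_gt_three]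
  refine (integral_llr_le_of_log_le hpm m hv hP
    (w := fun x => Real.log (1 + A) + Real.log (2 * π * (1 + v)) / 2 + (x - m) ^ 2 / (2 * v))
    ((integrable_const _).add (hint.div_const _)) (fun x => ?_) fun x hx => ?_).trans_eq ?_
  · have := Real.log_nonneg hv2
    have := Real.log_nonneg (x := 1 + A) (by linarith)
    positivity
  · rw [Real.log_div hx.ne' (gaussianPDFReal_pos m v x hv).ne']
    have h1 := neg_log_gaussianPDFReal m hv x
    have h2 : Real.log (p x) ≤ Real.log (1 + A) := Real.log_le_log hx (by linarith [hpA x])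
    have h3 : Real.log (2 * π * v) ≤ Real.log (2 * π * (1 + v)) :=
      Real.log_le_log (by positivity) (by gcongr; linarith)
    linarith
  · rw [integral_add (integrable_const _) (hint.div_const _), integral_div, hvar]
    simp only [integral_const, probReal_univ, one_smul]
    field_simp

lemma charFun_withDensity {p : ℝ → ℝ} (hpm : Measurable p) (hp0 : ∀ x, 0 ≤ p x) (t : ℝ) :
    charFun (volume.withDensity (fun x => ENNReal.ofReal (p x))) t =
      ∫ x : ℝ, Complex.exp (t * x * Complex.I) * p x := by
  rw [charFun_apply_real, integral_withDensity_eq_integral_toReal_smul (by fun_prop) (by simp)]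
  congr 1
  ext x
  rw [ENNReal.toReal_ofReal (hp0 x), Complex.real_smul, mul_comm]

/-- Local comparison with the Gaussian density by Fourier inversion. -/
lemma density_le_gaussianPDFReal_add {p : ℝ → ℝ} (hpc : Continuous p) (hp0 : ∀ x, 0 ≤ p x)
    {P : Measure ℝ} [IsProbabilityMeasure P]
    (hP : P = volume.withDensity (fun x => ENNReal.ofReal (p x)))
    (m : ℝ) {v : NNReal} (hv : v ≠ 0)
    (hint : Integrable fun t => charFun P t - charFun (gaussianReal m v) t) (x : ℝ) :
    p x ≤ gaussianPDFReal m v x +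
      (2 * π)⁻¹ * ∫ t, ‖charFun P t - charFun (gaussianReal m v) t‖ := by
  have hG : gaussianReal m v =
      volume.withDensity (fun x => ENNReal.ofReal (gaussianPDFReal m v x)) :=
    gaussianReal_of_var_ne_zero m hv
  set g := gaussianPDFReal m v
  have hg0 : ∀ x, 0 ≤ g x := gaussianPDFReal_nonneg m v
  have hgc : Continuous g := by
    simp only [g, gaussianPDFReal_def]; fun_prop
  have hpi := (integrable_of_isProbabilityMeasure_withDensity hpc.measurable hp0 hP).1
  have hgi : Integrable g := integrable_gaussianPDFReal m v
  set h : ℝ → ℂ := fun x => (p x : ℂ) - g x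
  have hhc : Continuous h := by fun_prop
  have hhi : Integrable h := hpi.ofReal.sub hgi.ofReal
  set D : ℝ → ℂ := fun t => charFun P t - charFun (gaussianReal m v) t
  have hexp : ∀ (q : ℝ → ℝ) (t : ℝ), Integrable q →
      Integrable fun x : ℝ => Complex.exp (t * x * Complex.I) * q x := by
    intro q t hq
    refine hq.ofReal.bdd_mul (c := 1) (by fun_prop) (ae_of_all _ fun y => ?_)
    rw [← Complex.ofReal_mul, Complex.norm_exp_ofReal_mul_I]
  have hF : FourierTransform.fourier h = fun ξ => D (-(2 * π) * ξ) := by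
    ext ξ
    simp only [D, h]
    rw [hP, hG, charFun_withDensity hpc.measurable hp0, charFun_withDensity hgc.measurable hg0,
      ← integral_sub (hexp p _ hpi) (hexp g _ hgi), Real.fourier_eq']
    congr 1
    ext y
    rw [smul_eq_mul, ← mul_sub]
    congr 2
    simp
    ring
  have hFi : Integrable (FourierTransform.fourier h) := by
    rw [hF]
    exact hint.comp_mul_left' (by have := Real.pi_pos; simp [this.ne'])
  have hinv := congrFun (hhc.fourierInv_fourier_eq hhi hFi) x
  have hnorm : ‖h x‖ ≤ (2 * π)⁻¹ * ∫ t, ‖D t‖ := by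
    rw [← hinv, Real.fourierInv_eq']
    refine (norm_integral_le_integral_norm _).trans_eq ?_
    have : ∀ v : ℝ, ‖Complex.exp (↑(2 * π * inner ℝ v x) * Complex.I) •
        FourierTransform.fourier h v‖ = ‖D (-(2 * π) * v)‖ := by
      intro v
      rw [norm_smul, Complex.norm_exp_ofReal_mul_I, one_mul, hF]
    simp_rw [this]
    rw [Measure.integral_comp_mul_left (fun t => ‖D t‖), smul_eq_mul, inv_neg, abs_neg,
      abs_of_pos (by positivity)]
  have h2 : p x - g x ≤ ‖h x‖ := by
    simp only [h]
    rw [← Complex.ofReal_sub, Complex.norm_real]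
    exact le_abs_self _
  linarith

lemma HasACDeriv.continuous_s18 {f f' : ℝ → ℝ} (h : HasACDeriv f f') : Continuous f := by
  have h1 : f = fun x => f 0 + ∫ t in (0 : ℝ)..x, f' t := by
    ext x; linarith [h.2.2 0 x]
  rw [h1]
  exact continuous_const.add (intervalIntegral.continuous_primitive
    (fun a b => (h.2.1.integrableOn_isCompact isCompact_uIcc).intervalIntegrable) 0)

/-- The derivative of a nonnegative absolutely continuous function vanishes a.e. on its zero
set. -/
lemma HasACDeriv.ae_eq_zero {f f' : ℝ → ℝ} (h : HasACDeriv f f') (hf0 : ∀ x, 0 ≤ f x) :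
    ∀ᵐ x, f x = 0 → f' x = 0 := by
  filter_upwards [LocallyIntegrable.ae_hasDerivAt_integral h.2.1] with x hx hfx
  have h1 : f = fun x => f 0 + ∫ t in (0 : ℝ)..x, f' t := by
    ext x; linarith [h.2.2 0 x]
  have h2 : HasDerivAt f (f' x) x := by
    rw [h1]; exact (hx 0).const_add _
  have h3 : IsLocalMin f x := Eventually.of_forall fun y => by rw [hfx]; exact hf0 y
  exact h3.hasDerivAt_eq_zero h2

lemma HasACDeriv.lintegral_le_fisherInfoL {f f' : ℝ → ℝ} (h : HasACDeriv f f')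
    (hf0 : ∀ x, 0 ≤ f x) (hf1 : ∫⁻ x, ENNReal.ofReal (f x) = 1) :
    ∫⁻ x, ‖f' x‖ₑ ≤ fisherInfoL f f' ^ (1 / 2 : ℝ) := by
  have hfm := h.continuous_s18.measurable
  have hf'm := h.1
  have h1 := ENNReal.lintegral_mul_le_Lp_mul_Lq volume Real.HolderConjugate.two_two
    (f := fun x => ENNReal.ofReal (|f' x| / √(f x))) (g := fun x => ENNReal.ofReal (√(f x)))
    (by fun_prop) (by fun_prop)
  have h2 : ∀ x, ENNReal.ofReal (|f' x| / √(f x)) ^ (2 : ℝ) =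
      ENNReal.ofReal (f' x ^ 2 / f x) := fun x => by
    rw [ENNReal.ofReal_rpow_of_nonneg (by positivity) (by norm_num), Real.rpow_two, div_pow,
      sq_abs, Real.sq_sqrt (hf0 x)]
  have h3 : ∀ x, ENNReal.ofReal (√(f x)) ^ (2 : ℝ) = ENNReal.ofReal (f x) := fun x => by
    rw [ENNReal.ofReal_rpow_of_nonneg (by positivity) (by norm_num), Real.rpow_two,
      Real.sq_sqrt (hf0 x)]
  simp_rw [h2, h3, hf1, ENNReal.one_rpow, mul_one] at h1
  refine le_trans (lintegral_mono_ae ?_) h1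
  filter_upwards [h.ae_eq_zero hf0] with x hx
  rw [Pi.mul_apply, ← ENNReal.ofReal_mul (by positivity), ← ofReal_norm]
  apply ENNReal.ofReal_le_ofReal
  by_cases hfx : f x = 0
  · simp [hx hfx]
  · rw [div_mul_cancel₀ _ (Real.sqrt_pos.2 ((hf0 x).lt_of_ne' hfx)).ne', Real.norm_eq_abs]

lemma HasACDeriv.ofReal_le_lintegral {f f' : ℝ → ℝ} (h : HasACDeriv f f')
    (hfi : Integrable f) (x : ℝ) :
    ENNReal.ofReal (f x) ≤ ∫⁻ x, ‖f' x‖ₑ := by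
  by_cases hV : ∫⁻ x, ‖f' x‖ₑ = ⊤
  · simp [hV]
  have hi : Integrable f' := ⟨h.1.aestronglyMeasurable, lt_top_iff_ne_top.2 hV⟩
  rw [← ofReal_integral_norm_eq_lintegral_enorm hi]
  apply ENNReal.ofReal_le_ofReal
  by_contra! hlt
  set V := ∫ x, ‖f' x‖
  have hlow : ∀ a, f x - V ≤ f a := fun a => by
    have h1 := h.2.2 a x
    have h2 : ‖∫ t in a..x, f' t‖ ≤ V :=
      intervalIntegral.norm_integral_le_integral_norm_uIoc.trans
        (setIntegral_le_integral hi.norm (ae_of_all _ fun _ => norm_nonneg _))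
    have h3 := le_abs_self (∫ t in a..x, f' t)
    rw [Real.norm_eq_abs] at h2
    linarith
  have hc : Integrable (fun _ : ℝ => f x - V) := hfi.mono' (by fun_prop)
    (ae_of_all _ fun a => by rw [Real.norm_of_nonneg (by linarith)]; exact hlow a)
  rw [integrable_const_iff] at hc
  rcases hc with hc | hc
  · linarith
  · simpa using hc.measure_univ_lt_top

lemma HasACDeriv.lintegral_translate_sub_le {f f' : ℝ → ℝ} (h : HasACDeriv f f') {r : ℝ}
    (hr : 0 ≤ r) :
    ∫⁻ x, ‖f (x + r) - f x‖ₑ ≤ ENNReal.ofReal r * ∫⁻ x, ‖f' x‖ₑ := by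
  have hf'm := h.1
  calc ∫⁻ x, ‖f (x + r) - f x‖ₑ
      ≤ ∫⁻ x, ∫⁻ t in Set.Ioc 0 r, ‖f' (x + t)‖ₑ := by
        refine lintegral_mono fun x => ?_
        rw [h.2.2 x (x + r)]
        have : ∫ t in x..(x + r), f' t = ∫ t in (0 : ℝ)..r, f' (x + t) := by
          rw [intervalIntegral.integral_comp_add_left]; simp
        rw [this, intervalIntegral.integral_of_le hr]
        exact enorm_integral_le_lintegral_enorm _
    _ = ∫⁻ t in Set.Ioc 0 r, ∫⁻ x, ‖f' (x + t)‖ₑ := by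
        rw [lintegral_lintegral_swap]
        exact Measurable.aemeasurable (by unfold Function.uncurry; fun_prop)
    _ = ENNReal.ofReal r * ∫⁻ x, ‖f' x‖ₑ := by
        simp_rw [lintegral_add_right_eq_self (fun x => ‖f' x‖ₑ)]
        simp [mul_comm]

lemma HasACDeriv.charFun_decay_of_pos {f f' : ℝ → ℝ} (h : HasACDeriv f f')
    (hf0 : ∀ x, 0 ≤ f x) (hfi : Integrable f) {s : ℝ} (hs : 0 < s) :
    ENNReal.ofReal (|s| * ‖charFun (volume.withDensity fun x => ENNReal.ofReal (f x)) s‖) ≤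
      2 * ∫⁻ x, ‖f' x‖ₑ := by
  have hfm := h.continuous_s18.measurable
  set r := π / s
  have hr : 0 < r := by positivity
  have hexp : ∀ q : ℝ → ℝ, Integrable q →
      Integrable fun x : ℝ => Complex.exp (s * x * Complex.I) * q x := by
    intro q hq
    refine hq.ofReal.bdd_mul (c := 1) (by fun_prop) (ae_of_all _ fun y => ?_)
    rw [← Complex.ofReal_mul, Complex.norm_exp_ofReal_mul_I]
  have hfr : Integrable fun x => f (x + r) := hfi.comp_add_right r
  rw [charFun_withDensity hfm hf0]
  set Φ := ∫ x : ℝ, Complex.exp (s * x * Complex.I) * f x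
  have h1 : Φ = - ∫ x : ℝ, Complex.exp (s * x * Complex.I) * f (x + r) := by
    rw [← integral_neg]
    refine (integral_add_right_eq_self
      (fun x : ℝ => Complex.exp (s * x * Complex.I) * f x) r).symm.trans ?_
    congr 1
    ext x
    have : (s : ℂ) * ↑(x + r) * Complex.I = s * x * Complex.I + π * Complex.I := by
      simp only [r]
      push_cast
      have : (s : ℂ) ≠ 0 := by exact_mod_cast hs.ne'
      field_simp
    rw [this, Complex.exp_add, Complex.exp_pi_mul_I]
    ring
  have h2 : 2 * Φ = -∫ x : ℝ, Complex.exp (s * x * Complex.I) * ((f (x + r) - f x : ℝ) : ℂ) := by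
    have h3 : ∫ x : ℝ, Complex.exp (s * x * Complex.I) * ((f (x + r) - f x : ℝ) : ℂ) =
        (∫ x : ℝ, Complex.exp (s * x * Complex.I) * f (x + r)) - Φ := by
      rw [← integral_sub (hexp _ hfr) (hexp _ hfi)]
      congr 1; ext x; push_cast; ring
    rw [h3]
    linear_combination h1
  have h4 : ‖2 * Φ‖ₑ ≤ ENNReal.ofReal r * ∫⁻ x, ‖f' x‖ₑ := by
    rw [h2, enorm_neg]
    refine (enorm_integral_le_lintegral_enorm _).trans
      (le_trans (lintegral_mono fun x => ?_) (h.lintegral_translate_sub_le hr.le))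
    rw [enorm_mul]
    have : ‖Complex.exp (s * x * Complex.I)‖ₑ = 1 := by
      rw [← ofReal_norm, ← Complex.ofReal_mul, Complex.norm_exp_ofReal_mul_I]; simp
    rw [this, one_mul, ← ofReal_norm, ← ofReal_norm, Complex.norm_real]
  have h5 : |s| * ‖Φ‖ = (s / 2) * ‖2 * Φ‖ := by
    rw [norm_mul, abs_of_pos hs]; norm_num; ring
  rw [h5, ENNReal.ofReal_mul (by positivity), ofReal_norm]
  calc _ ≤ ENNReal.ofReal (s / 2) * (ENNReal.ofReal r * ∫⁻ x, ‖f' x‖ₑ) := by gcongr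
    _ = ENNReal.ofReal (π / 2) * ∫⁻ x, ‖f' x‖ₑ := by
      rw [← mul_assoc, ← ENNReal.ofReal_mul (by positivity)]
      congr 2
      simp only [r]; field_simp
    _ ≤ 2 * ∫⁻ x, ‖f' x‖ₑ := by
      gcongr
      rw [show (2 : ℝ≥0∞) = ENNReal.ofReal 2 by simp]
      exact ENNReal.ofReal_le_ofReal (by linarith [Real.pi_le_four])

lemma HasACDeriv.charFun_decay {f f' : ℝ → ℝ} (h : HasACDeriv f f')
    (hf0 : ∀ x, 0 ≤ f x) (hfi : Integrable f) (s : ℝ) :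
    ENNReal.ofReal (|s| * ‖charFun (volume.withDensity fun x => ENNReal.ofReal (f x)) s‖) ≤
      2 * ∫⁻ x, ‖f' x‖ₑ := by
  rcases lt_trichotomy s 0 with hs | rfl | hs
  · have := h.charFun_decay_of_pos hf0 hfi (neg_pos.2 hs)
    rwa [abs_neg, charFun_neg, RCLike.norm_conj] at this
  · simp
  · exact h.charFun_decay_of_pos hf0 hfi hs

lemma norm_cexp_mul_I_sub_taylor_le (x : ℝ) :
    ‖Complex.exp (x * Complex.I) - (1 + x * Complex.I - x ^ 2 / 2)‖ ≤ 4 * |x| ^ 3 := by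
  have hn : ‖(x : ℂ) * Complex.I‖ = |x| := by simp
  rcases le_or_gt |x| 1 with hx | hx
  · have h := Complex.exp_bound (x := x * Complex.I) (by rwa [hn]) (n := 3) (by norm_num)
    rw [hn] at h
    have h2 : ∑ m ∈ Finset.range 3, ((x : ℂ) * Complex.I) ^ m / (m.factorial : ℂ) =
        1 + x * Complex.I - x ^ 2 / 2 := by
      simp [Finset.sum_range_succ, mul_pow]; ring
    rw [h2] at h
    refine h.trans ?_
    have : 0 ≤ |x| ^ 3 := by positivity
    norm_num [Nat.factorial]
    nlinarith
  · have h1 : ‖Complex.exp (x * Complex.I)‖ = 1 := Complex.norm_exp_ofReal_mul_I x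
    have h2 : ‖(1 + x * Complex.I - x ^ 2 / 2 : ℂ)‖ ≤ 1 + |x| + |x| ^ 2 / 2 := by
      refine (norm_sub_le _ _).trans (add_le_add ((norm_add_le _ _).trans ?_) ?_)
      · simp
      · simp
    refine (norm_sub_le _ _).trans ?_
    rw [h1]
    nlinarith [mul_pos (sub_pos.2 hx) (sub_pos.2 hx), pow_pos (sub_pos.2 hx) 3]

lemma integrable_pow_of_integrable_abs_cube {μ : Measure ℝ} [IsFiniteMeasure μ]
    (h3 : Integrable (fun x => |x| ^ 3) μ) :
    Integrable (fun x : ℝ => x) μ ∧ Integrable (fun x : ℝ => x ^ 2) μ := by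
  have h : Integrable (fun x : ℝ => 1 + |x| ^ 3) μ := (integrable_const _).add h3
  constructor
  · refine h.mono' (by fun_prop) (ae_of_all _ fun x => ?_)
    rw [Real.norm_eq_abs]
    nlinarith [abs_nonneg x, sq_nonneg (|x| - 1), mul_nonneg (abs_nonneg x) (sq_nonneg (|x| - 1))]
  · refine h.mono' (by fun_prop) (ae_of_all _ fun x => ?_)
    rw [Real.norm_eq_abs, abs_pow]
    nlinarith [abs_nonneg x, sq_nonneg (|x| - 1), mul_nonneg (abs_nonneg x) (sq_nonneg (|x| - 1))]

lemma norm_charFun_sub_taylor_le {μ : Measure ℝ} [IsProbabilityMeasure μ]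
    (h3 : Integrable (fun x => |x| ^ 3) μ) (s : ℝ) :
    ‖charFun μ s - (1 + s * (∫ x, x ∂μ : ℝ) * Complex.I - s ^ 2 * (∫ x, x ^ 2 ∂μ : ℝ) / 2)‖ ≤
      4 * |s| ^ 3 * ∫ x, |x| ^ 3 ∂μ := by
  obtain ⟨h1, h2⟩ := integrable_pow_of_integrable_abs_cube h3
  have hE : Integrable (fun x : ℝ => Complex.exp (s * x * Complex.I)) μ := by
    refine Integrable.of_bound (by fun_prop) 1 (ae_of_all _ fun y => ?_)
    rw [← Complex.ofReal_mul, Complex.norm_exp_ofReal_mul_I]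
  have hA : Integrable (fun x : ℝ => (1 : ℂ) + s * x * Complex.I) μ :=
    (integrable_const _).add ((h1.ofReal.const_mul _).mul_const _)
  have hB : Integrable (fun x : ℝ => (s : ℂ) ^ 2 * (x ^ 2 : ℝ) / 2) μ :=
    (h2.ofReal.const_mul _).div_const _
  have heq : charFun μ s -
      (1 + s * (∫ x, x ∂μ : ℝ) * Complex.I - s ^ 2 * (∫ x, x ^ 2 ∂μ : ℝ) / 2) =
      ∫ x : ℝ, (Complex.exp (s * x * Complex.I) -
        (1 + s * x * Complex.I - (s : ℂ) ^ 2 * (x ^ 2 : ℝ) / 2)) ∂μ := by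
    have hC : ∫ x : ℝ, ((1 : ℂ) + s * x * Complex.I) ∂μ =
        1 + s * (∫ x, x ∂μ : ℝ) * Complex.I := by
      have hid : ∫ x : ℝ, (x : ℂ) ∂μ = ((∫ x, x ∂μ : ℝ) : ℂ) := integral_ofReal
      rw [integral_add (integrable_const _) ((h1.ofReal.const_mul _).mul_const _),
        integral_mul_const, integral_const_mul, hid]
      simp
    have hD : ∫ x : ℝ, ((x ^ 2 : ℝ) : ℂ) ∂μ = ((∫ x, x ^ 2 ∂μ : ℝ) : ℂ) := integral_ofReal
    have hAB : Integrable (fun x : ℝ => (1 : ℂ) + s * x * Complex.I -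
        (s : ℂ) ^ 2 * (x ^ 2 : ℝ) / 2) μ := hA.sub hB
    rw [integral_sub hE hAB, integral_sub hA hB, hC, integral_div, integral_const_mul,
      hD, charFun_apply_real]
  rw [heq, ← integral_const_mul]
  refine norm_integral_le_of_norm_le (h3.const_mul _) (ae_of_all _ fun x => ?_)
  have := norm_cexp_mul_I_sub_taylor_le (s * x)
  rw [abs_mul, mul_pow, ← mul_assoc] at this
  refine (le_of_eq (congrArg _ ?_)).trans this
  push_cast
  ring_nf

lemma varM_nonneg (μ : Measure ℝ) : 0 ≤ varM μ := integral_nonneg fun _ => sq_nonneg _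

lemma varM_eq {μ : Measure ℝ} [IsProbabilityMeasure μ] (h1 : Integrable (fun x : ℝ => x) μ)
    (h2 : Integrable (fun x : ℝ => x ^ 2) μ) :
    varM μ = ∫ x, x ^ 2 ∂μ - meanM μ ^ 2 := by
  have h : ∀ x : ℝ, (x - meanM μ) ^ 2 = x ^ 2 - (2 * meanM μ * x - meanM μ ^ 2) := fun x => by ring
  simp_rw [varM, h]
  have h12 : Integrable (fun x => 2 * meanM μ * x - meanM μ ^ 2) μ :=
    (h1.const_mul _).sub (integrable_const _)
  rw [integral_sub h2 h12,
    integral_sub (h1.const_mul _) (integrable_const _), integral_const_mul]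
  simp only [integral_const, probReal_univ, one_smul]
  change _ - (2 * meanM μ * meanM μ - _) = _
  ring

/-- The Gaussian law with the same mean and variance as `μ`. -/
def gaussM (μ : Measure ℝ) : Measure ℝ := gaussianReal (meanM μ) (Real.toNNReal (varM μ))

lemma integral_abs_cube_gaussianReal_le (m : ℝ) (v : NNReal) :
    Integrable (fun x => |x| ^ 3) (gaussianReal m v) ∧
    ∫ x, |x| ^ 3 ∂(gaussianReal m v) ≤
      4 * (|m| ^ 3 + √v ^ 3 * ∫ x, |x| ^ 3 ∂(gaussianReal 0 1)) := by
  have hi : ∀ (m : ℝ) (v : NNReal), Integrable (fun x => |x| ^ 3) (gaussianReal m v) := by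
    intro m v
    simpa using (memLp_id_gaussianReal (μ := m) (v := v) 3).integrable_norm_pow (by norm_num)
  refine ⟨hi m v, ?_⟩
  have hmap : gaussianReal m v = (gaussianReal 0 1).map (fun z => m + √v * z) := by
    have h1 : (fun z : ℝ => m + √v * z) = (fun z => m + z) ∘ (fun z => √v * z) := rfl
    rw [h1, ← Measure.map_map (by fun_prop) (by fun_prop), gaussianReal_map_const_mul,
      gaussianReal_map_const_add]
    congr 1
    · simp
    · ext; simp
  rw [hmap, integral_map (by fun_prop) (by fun_prop)]
  have h2 := hi 0 1
  rw [← integral_const_mul, show |m| ^ 3 = ∫ _, |m| ^ 3 ∂(gaussianReal 0 1) by simp,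
    ← integral_add (integrable_const _) (h2.const_mul _), ← integral_const_mul]
  refine integral_mono_of_nonneg (ae_of_all _ fun _ => by positivity)
    (((integrable_const _).add (h2.const_mul _)).const_mul _) (ae_of_all _ fun z => ?_)
  change |m + √v * z| ^ 3 ≤ 4 * (|m| ^ 3 + √v ^ 3 * |z| ^ 3)
  have h3 := abs_add_le m (√v * z)
  rw [abs_mul, abs_of_nonneg (Real.sqrt_nonneg (v : ℝ))] at h3
  have h4 := add_pow_le (abs_nonneg m) (by positivity : 0 ≤ √(v : ℝ) * |z|) 3
  norm_num at h4
  rw [mul_pow] at h4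
  exact (pow_le_pow_left₀ (abs_nonneg _) h3 3).trans h4

/-- The absolute moment of order three, plus one. -/
def cubeM (μ : Measure ℝ) : ℝ := 1 + ∫ x, |x| ^ 3 ∂μ

lemma one_le_cubeM (μ : Measure ℝ) : 1 ≤ cubeM μ :=
  le_add_of_nonneg_right (integral_nonneg fun _ => by positivity)

lemma varM_le_cubeM {μ : Measure ℝ} [IsProbabilityMeasure μ]
    (h3 : Integrable (fun x => |x| ^ 3) μ) : varM μ ≤ cubeM μ := by
  obtain ⟨h1, h2⟩ := integrable_pow_of_integrable_abs_cube h3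
  have h : ∫ x, x ^ 2 ∂μ ≤ cubeM μ := by
    rw [cubeM, show (1 : ℝ) = ∫ _, (1 : ℝ) ∂μ by simp, ← integral_add (integrable_const _) h3]
    refine integral_mono h2 ((integrable_const _).add h3) fun x => ?_
    change x ^ 2 ≤ 1 + |x| ^ 3
    rw [← sq_abs]
    nlinarith [abs_nonneg x, sq_nonneg (|x| - 1), mul_nonneg (abs_nonneg x) (sq_nonneg (|x| - 1))]
  rw [varM_eq h1 h2]
  nlinarith [sq_nonneg (meanM μ)]

/-- Lyapunov's inequalities between the first three absolute moments. -/
lemma moments_le_cubeM {μ : Measure ℝ} [IsProbabilityMeasure μ]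
    (h3 : Integrable (fun x => |x| ^ 3) μ) :
    |meanM μ| ^ 3 ≤ cubeM μ ∧ √(varM μ) ^ 3 ≤ cubeM μ := by
  obtain ⟨h1, h2⟩ := integrable_pow_of_integrable_abs_cube h3
  set b := ∫ x, |x| ^ 3 ∂μ with hb
  set l := (cubeM μ) ^ (1 / 3 : ℝ) with hl
  have hc0 : 0 < cubeM μ := one_pos.trans_le (one_le_cubeM μ)
  have hlpos : 0 < l := by positivity
  have hl3 : l ^ 3 = cubeM μ := by
    rw [hl, ← Real.rpow_natCast, ← Real.rpow_mul hc0.le]; norm_num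
  have hbl : b ≤ l ^ 3 := by rw [hl3, cubeM]; linarith
  have ham : ∀ a : ℝ, 0 ≤ a → a * l ^ 2 ≤ (a ^ 3 + 2 * l ^ 3) / 3 ∧
      a ^ 2 * l ≤ (2 * a ^ 3 + l ^ 3) / 3 := fun a ha => by
    constructor <;>
      nlinarith [mul_nonneg ha (sq_nonneg (a - l)), mul_nonneg hlpos.le (sq_nonneg (a - l))]
  have hm : |meanM μ| ≤ l := by
    have h4 : (∫ x, |x| ∂μ) * l ^ 2 ≤ (b + 2 * l ^ 3) / 3 := by
      rw [← integral_mul_const]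
      have : ∫ x, (|x| ^ 3 + 2 * l ^ 3) / 3 ∂μ = (b + 2 * l ^ 3) / 3 := by
        rw [integral_div, integral_add h3 (integrable_const _)]; simp [hb]
      rw [← this]
      exact integral_mono (h1.abs.mul_const _) ((h3.add (integrable_const _)).div_const _)
        fun x => (ham |x| (abs_nonneg x)).1
    have h5 : |meanM μ| ≤ ∫ x, |x| ∂μ := abs_integral_le_integral_abs
    have h6 : (∫ x, |x| ∂μ) * l ^ 2 ≤ l * l ^ 2 := by nlinarith
    exact h5.trans (le_of_mul_le_mul_right h6 (by positivity))
  have hv : varM μ ≤ l ^ 2 := by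
    have h4 : (∫ x, x ^ 2 ∂μ) * l ≤ (2 * b + l ^ 3) / 3 := by
      rw [← integral_mul_const]
      have : ∫ x, (2 * |x| ^ 3 + l ^ 3) / 3 ∂μ = (2 * b + l ^ 3) / 3 := by
        rw [integral_div, integral_add (h3.const_mul _) (integrable_const _), integral_const_mul]
        simp [hb]
      rw [← this]
      refine integral_mono (h2.mul_const _)
        (((h3.const_mul _).add (integrable_const _)).div_const _) fun x => ?_
      have := (ham |x| (abs_nonneg x)).2
      rwa [sq_abs] at this
    have h6 : (∫ x, x ^ 2 ∂μ) * l ≤ l ^ 2 * l := by nlinarith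
    rw [varM_eq h1 h2]
    nlinarith [sq_nonneg (meanM μ)]
  rw [← hl3]
  refine ⟨pow_le_pow_left₀ (abs_nonneg _) hm 3, pow_le_pow_left₀ (Real.sqrt_nonneg _) ?_ 3⟩
  rw [← Real.sqrt_sq hlpos.le]
  exact Real.sqrt_le_sqrt hv

/-- The constant in `norm_charFun_sub_gaussM_le`. -/
def cubeConst : ℝ := 4 + 16 * (1 + ∫ x, |x| ^ 3 ∂(gaussianReal 0 1))

lemma cubeConst_pos : 0 < cubeConst := by
  have : 0 ≤ ∫ x, |x| ^ 3 ∂(gaussianReal 0 1) := integral_nonneg fun _ => by positivity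
  unfold cubeConst
  linarith

lemma norm_charFun_sub_gaussM_le {μ : Measure ℝ} [IsProbabilityMeasure μ]
    (h3 : Integrable (fun x => |x| ^ 3) μ) (s : ℝ) :
    ‖charFun μ s - charFun (gaussM μ) s‖ ≤ cubeConst * |s| ^ 3 * cubeM μ := by
  obtain ⟨h1, h2⟩ := integrable_pow_of_integrable_abs_cube h3
  set v := Real.toNNReal (varM μ)
  have hv : (v : ℝ) = varM μ := Real.coe_toNNReal _ (varM_nonneg μ)
  obtain ⟨hG3, hGle⟩ := integral_abs_cube_gaussianReal_le (meanM μ) v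
  obtain ⟨hG1, hG2⟩ := integrable_pow_of_integrable_abs_cube hG3
  have hT := norm_charFun_sub_taylor_le h3 s
  have hTG := norm_charFun_sub_taylor_le hG3 s
  have hm2 : ∫ x, x ^ 2 ∂(gaussianReal (meanM μ) v) = ∫ x, x ^ 2 ∂μ := by
    have ha := varM_eq hG1 hG2
    have hb := varM_eq h1 h2
    have hc : meanM (gaussianReal (meanM μ) v) = meanM μ := integral_id_gaussianReal
    have hd : varM (gaussianReal (meanM μ) v) = v := by
      have h := variance_id_gaussianReal (μ := meanM μ) (v := v)
      rw [variance_eq_integral (by fun_prop)] at h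
      exact h
    rw [hc] at ha
    linarith
  rw [integral_id_gaussianReal, hm2] at hTG
  have hb : ∫ x, |x| ^ 3 ∂μ ≤ cubeM μ := by unfold cubeM; linarith
  obtain ⟨hmo1, hmo2⟩ := moments_le_cubeM h3
  rw [hv] at hGle
  have hZ : 0 ≤ ∫ x, |x| ^ 3 ∂(gaussianReal 0 1) := integral_nonneg fun _ => by positivity
  set Z := ∫ x, |x| ^ 3 ∂(gaussianReal 0 1) with hZdef
  have hGle' : ∫ x, |x| ^ 3 ∂(gaussianReal (meanM μ) v) ≤ 4 * (1 + Z) * cubeM μ := by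
    nlinarith [mul_le_mul_of_nonneg_right hmo2 hZ]
  have hs : 0 ≤ 4 * |s| ^ 3 := by positivity
  have e1 := mul_le_mul_of_nonneg_left hb hs
  have e2 := mul_le_mul_of_nonneg_left hGle' hs
  rw [norm_sub_rev] at hTG
  refine (norm_sub_le_norm_sub_add_norm_sub _ _ _).trans ((add_le_add hT hTG).trans ?_)
  unfold cubeConst
  rw [← hZdef]
  linarith

lemma norm_prod_sub_prod_le {ι : Type*} [DecidableEq ι] (s : Finset ι) (a b : ι → ℂ) (w : ι → ℝ)
    (ha : ∀ i, ‖a i‖ ≤ w i) (hb : ∀ i, ‖b i‖ ≤ w i) :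
    ‖∏ i ∈ s, a i - ∏ i ∈ s, b i‖ ≤ ∑ i ∈ s, ‖a i - b i‖ * ∏ j ∈ s.erase i, w j := by
  have hw : ∀ i, 0 ≤ w i := fun i => (norm_nonneg _).trans (ha i)
  induction s using Finset.induction_on with
  | empty => simp
  | insert i s hi ih =>
    rw [Finset.prod_insert hi, Finset.prod_insert hi, Finset.sum_insert hi, Finset.erase_insert hi]
    have h1 : ∑ x ∈ s, ‖a x - b x‖ * ∏ j ∈ (insert i s).erase x, w j =
        w i * ∑ x ∈ s, ‖a x - b x‖ * ∏ j ∈ s.erase x, w j := by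
      rw [Finset.mul_sum]
      refine Finset.sum_congr rfl fun x hx => ?_
      have hne : i ≠ x := fun h => hi (h ▸ hx)
      rw [Finset.erase_insert_of_ne hne, Finset.prod_insert (by simp [hi])]
      ring
    have h2 : a i * ∏ j ∈ s, a j - b i * ∏ j ∈ s, b j =
        (a i - b i) * ∏ j ∈ s, a j + b i * (∏ j ∈ s, a j - ∏ j ∈ s, b j) := by ring
    rw [h1, h2]
    refine (norm_add_le _ _).trans (add_le_add ?_ ?_)
    · rw [norm_mul, norm_prod]
      gcongr with j hj
      exact ha j
    · rw [norm_mul]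
      exact mul_le_mul (hb i) ih (norm_nonneg _) (hw i)

lemma inv_one_add_mul_sq_pow_le {c : ℝ} (hc : 0 < c) {k : ℕ} (hk : 1 ≤ k) (s : ℝ) :
    |s| ^ 3 * ((1 + c * s ^ 2)⁻¹) ^ (3 * k) ≤
      2 * (√(k * c) ^ 3)⁻¹ * (1 + (√(k * c) * s) ^ 2)⁻¹ := by
  set L := √(k * c) with hL
  have hLpos : 0 < L := Real.sqrt_pos.2 (by positivity)
  have hL2 : L ^ 2 = k * c := Real.sq_sqrt (by positivity)
  set t := L * |s| with ht
  have ht0 : 0 ≤ t := by positivity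
  have ht2 : t ^ 2 = k * (c * s ^ 2) := by rw [ht, mul_pow, hL2, sq_abs]; ring
  have h1 : 1 + t ^ 6 ≤ (1 + c * s ^ 2) ^ (3 * k) := by
    have hB : 1 + t ^ 2 ≤ (1 + c * s ^ 2) ^ k := by
      rw [ht2]
      exact one_add_mul_le_pow (by nlinarith [mul_nonneg hc.le (sq_nonneg s)]) k
    calc 1 + t ^ 6 ≤ (1 + t ^ 2) ^ 3 := by nlinarith [sq_nonneg t, sq_nonneg (t ^ 2)]
      _ ≤ ((1 + c * s ^ 2) ^ k) ^ 3 := pow_le_pow_left₀ (by positivity) hB 3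
      _ = _ := by rw [← pow_mul, mul_comm k]
  have h2 : t ^ 3 * (1 + t ^ 2) ≤ 2 * (1 + t ^ 6) := by
    nlinarith [sq_nonneg (t ^ 3 - 1), sq_nonneg (t ^ 3 - t ^ 2), sq_nonneg (t ^ 2 - 1),
      mul_nonneg ht0 ht0, pow_nonneg ht0 3, sq_nonneg (t ^ 3 - t), sq_nonneg (t^2 - t),
      mul_nonneg (sq_nonneg (t - 1)) (pow_nonneg ht0 4)]
  have h3 : (L * s) ^ 2 = t ^ 2 := by rw [ht, mul_pow, mul_pow, sq_abs]
  rw [h3, inv_pow]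
  have hs3 : |s| ^ 3 = (L ^ 3)⁻¹ * t ^ 3 := by rw [ht, mul_pow]; field_simp
  rw [hs3, show (L ^ 3)⁻¹ * t ^ 3 * ((1 + c * s ^ 2) ^ (3 * k))⁻¹ =
    (L ^ 3)⁻¹ * (t ^ 3 * ((1 + c * s ^ 2) ^ (3 * k))⁻¹) by ring,
    show 2 * (L ^ 3)⁻¹ * (1 + t ^ 2)⁻¹ = (L ^ 3)⁻¹ * (2 * (1 + t ^ 2)⁻¹) by ring]
  refine mul_le_mul_of_nonneg_left ?_ (by positivity)
  have h4 : ((1 + c * s ^ 2) ^ (3 * k))⁻¹ ≤ (1 + t ^ 6)⁻¹ := inv_anti₀ (by positivity) h1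
  refine (mul_le_mul_of_nonneg_left h4 (by positivity)).trans ?_
  rw [← div_eq_mul_inv, ← div_eq_mul_inv, div_le_div_iff₀ (by positivity) (by positivity)]
  exact h2

lemma norm_charFun_gaussM_sq_mul_le (μ : Measure ℝ) {c : ℝ} (hc0 : 0 ≤ c) (hc : c ≤ varM μ)
    (s : ℝ) :
    ‖charFun (gaussM μ) s‖ ^ 2 * (1 + c * s ^ 2) ≤ 1 := by
  have h : ‖charFun (gaussM μ) s‖ = rexp (-(varM μ * s ^ 2 / 2)) := by
    rw [gaussM, charFun_gaussianReal, Complex.norm_exp, Real.coe_toNNReal _ (varM_nonneg μ)]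
    congr 1
    simp [← Complex.ofReal_pow, ← Complex.ofReal_mul]
  rw [h, ← Real.exp_nat_mul]
  calc _ ≤ rexp (-(varM μ * s ^ 2)) * rexp (varM μ * s ^ 2) := by
        refine mul_le_mul (le_of_eq (by congr 1; push_cast; ring)) ?_ ?_ (Real.exp_pos _).le
        · nlinarith [Real.add_one_le_exp (varM μ * s ^ 2), sq_nonneg s]
        · positivity
    _ = 1 := by rw [← Real.exp_add]; simp

lemma integral_norm_prod_charFun_sub_le {ι : Type*} [Fintype ι] (μ : ι → Measure ℝ)
    [∀ i, IsProbabilityMeasure (μ i)] (h3 : ∀ i, Integrable (fun x => |x| ^ 3) (μ i))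
    (g : Finset ι) {c : ℝ} (hc : 0 < c)
    (hg : ∀ i ∈ g, (∀ s, ‖charFun (μ i) s‖ ^ 2 * (1 + c * s ^ 2) ≤ 1) ∧ c ≤ varM (μ i))
    {k : ℕ} (hk : 1 ≤ k) (hcard : 6 * k + 1 ≤ g.card) :
    Integrable (fun s => ∏ i, charFun (μ i) s - ∏ i, charFun (gaussM (μ i)) s) ∧
    ∫ s, ‖∏ i, charFun (μ i) s - ∏ i, charFun (gaussM (μ i)) s‖ ≤
      2 * π * cubeConst * (∑ i, cubeM (μ i)) / (k * c) ^ 2 := by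
  classical
  have hGP : ∀ i, IsProbabilityMeasure (gaussM (μ i)) := fun i => by unfold gaussM; infer_instance
  set L := √(k * c) with hL
  have hLpos : 0 < L := Real.sqrt_pos.2 (by positivity)
  have hL2 : L ^ 2 = k * c := Real.sq_sqrt (by positivity)
  set S := ∑ i, cubeM (μ i) with hS
  have hS0 : 0 ≤ S := Finset.sum_nonneg fun i _ => zero_le_one.trans (one_le_cubeM _)
  have hC := cubeConst_pos
  have hpt : ∀ s : ℝ, ‖∏ i, charFun (μ i) s - ∏ i, charFun (gaussM (μ i)) s‖ ≤
      cubeConst * S * (2 * (L ^ 3)⁻¹) * (1 + (L * s) ^ 2)⁻¹ := by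
    intro s
    set r := √((1 + c * s ^ 2)⁻¹) with hr
    have hr0 : 0 ≤ r := Real.sqrt_nonneg _
    have hcs : 0 < 1 + c * s ^ 2 := by nlinarith [mul_nonneg hc.le (sq_nonneg s)]
    have hr2 : r ^ 2 = (1 + c * s ^ 2)⁻¹ := Real.sq_sqrt (by positivity)
    have hr1 : r ≤ 1 := by
      rw [hr, Real.sqrt_le_one]
      exact inv_le_one_of_one_le₀ (by nlinarith [mul_nonneg hc.le (sq_nonneg s)])
    have hle : ∀ z : ℂ, ‖z‖ ^ 2 * (1 + c * s ^ 2) ≤ 1 → ‖z‖ ≤ r := fun z hz => by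
      refine Real.le_sqrt_of_sq_le ?_
      rw [← one_div, le_div_iff₀ hcs]
      exact hz
    have hw := norm_prod_sub_prod_le Finset.univ (fun i => charFun (μ i) s)
      (fun i => charFun (gaussM (μ i)) s) (fun i => if i ∈ g then r else 1)
      (fun i => by
        by_cases hi : i ∈ g
        · simpa [hi] using hle _ ((hg i hi).1 s)
        · simpa [hi] using norm_charFun_le_one s)
      (fun i => by
        by_cases hi : i ∈ g
        · simpa [hi] using hle _ (norm_charFun_gaussM_sq_mul_le _ hc.le (hg i hi).2 s)
        · simpa [hi] using norm_charFun_le_one s)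
    have hprod : ∀ i, ∏ j ∈ Finset.univ.erase i, (if j ∈ g then r else 1) ≤
        ((1 + c * s ^ 2)⁻¹) ^ (3 * k) := fun i => by
      rw [Finset.prod_ite, Finset.prod_const, Finset.prod_const_one, mul_one, ← hr2, ← pow_mul]
      refine pow_le_pow_of_le_one hr0 hr1 ?_
      have : Finset.filter (fun j => j ∈ g) (Finset.univ.erase i) = g.erase i := by
        ext j; simp [and_comm]
      rw [this]
      have := Finset.pred_card_le_card_erase (s := g) (a := i)
      omega
    calc _ ≤ _ := hw
      _ ≤ ∑ i, cubeConst * |s| ^ 3 * cubeM (μ i) * ((1 + c * s ^ 2)⁻¹) ^ (3 * k) :=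
        Finset.sum_le_sum fun i _ => mul_le_mul (norm_charFun_sub_gaussM_le (h3 i) s) (hprod i)
          (Finset.prod_nonneg fun j _ => by split_ifs <;> positivity)
          (by have := one_le_cubeM (μ i); positivity)
      _ = cubeConst * S * (|s| ^ 3 * ((1 + c * s ^ 2)⁻¹) ^ (3 * k)) := by
        rw [hS, Finset.mul_sum, Finset.sum_mul]
        exact Finset.sum_congr rfl fun i _ => by ring
      _ ≤ cubeConst * S * (2 * (L ^ 3)⁻¹ * (1 + (L * s) ^ 2)⁻¹) :=
        mul_le_mul_of_nonneg_left (inv_one_add_mul_sq_pow_le hc hk s) (by positivity)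
      _ = _ := by ring
  have hint : Integrable (fun s : ℝ => (1 + (L * s) ^ 2)⁻¹) :=
    integrable_inv_one_add_sq.comp_mul_left' hLpos.ne'
  have hmeas : AEStronglyMeasurable
      (fun s => ∏ i, charFun (μ i) s - ∏ i, charFun (gaussM (μ i)) s) volume := by
    refine Measurable.aestronglyMeasurable ?_
    exact (Finset.measurable_fun_prod _ fun i _ => measurable_charFun).sub
      (Finset.measurable_fun_prod _ fun i _ => measurable_charFun)
  have hI : Integrable (fun s => ∏ i, charFun (μ i) s - ∏ i, charFun (gaussM (μ i)) s) :=
    (hint.const_mul _).mono' hmeas (ae_of_all _ hpt)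
  refine ⟨hI, (integral_mono hI.norm (hint.const_mul _) hpt).trans (le_of_eq ?_)⟩
  rw [integral_const_mul, Measure.integral_comp_mul_left (fun x => (1 + x ^ 2)⁻¹) L,
    integral_univ_inv_one_add_sq, abs_of_pos (inv_pos.2 hLpos), ← hL2, smul_eq_mul]
  field_simp

/-- The law of the sum of independent variables with laws `μ i`. -/
def sumLaw {ι : Type*} [Fintype ι] (μ : ι → Measure ℝ) : Measure ℝ :=
  (Measure.pi μ).map fun v => ∑ i, v i

instance {ι : Type*} [Fintype ι] (μ : ι → Measure ℝ) [∀ i, IsProbabilityMeasure (μ i)] :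
    IsProbabilityMeasure (sumLaw μ) :=
  Measure.isProbabilityMeasure_map (by fun_prop)

instance (μ : Measure ℝ) : IsProbabilityMeasure (gaussM μ) := by
  unfold gaussM; infer_instance

lemma varM_eq_variance (μ : Measure ℝ) : varM μ = Var[id; μ] :=
  (variance_eq_integral (by fun_prop)).symm

lemma conv_withDensity_of_continuous {f : ℝ → ℝ} (hf : Continuous f) (hf0 : ∀ x, 0 ≤ f x) {A : ℝ}
    (hA : ∀ x, f x ≤ A) (ρ : Measure ℝ) [IsProbabilityMeasure ρ] :
    Continuous (fun x => ∫ z, f (x - z) ∂ρ) ∧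
    (volume.withDensity fun x => ENNReal.ofReal (f x)) ∗ ρ =
      volume.withDensity fun x => ENNReal.ofReal (∫ z, f (x - z) ∂ρ) := by
  have hb : ∀ x z, ‖f (x - z)‖ ≤ A := fun x z => by
    rw [Real.norm_of_nonneg (hf0 _)]
    exact hA _
  refine ⟨continuous_of_dominated (fun x => by fun_prop) (fun x => ae_of_all _ (hb x))
    (integrable_const A) (ae_of_all _ fun z => by fun_prop), ?_⟩
  have hint : ∀ x, Integrable (fun z => f (x - z)) ρ := fun x =>
    Integrable.of_bound (by fun_prop) A (ae_of_all _ (hb x))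
  have hfm : Measurable fun x => ENNReal.ofReal (f x) := hf.measurable.ennreal_ofReal
  ext s hs
  have h1 : Measurable (s.indicator (1 : ℝ → ℝ≥0∞)) := measurable_one.indicator hs
  rw [← lintegral_indicator_one hs, Measure.lintegral_conv h1,
    lintegral_withDensity_eq_lintegral_mul _ hfm
      (Measurable.lintegral_prod_right' (f := fun q : ℝ × ℝ => s.indicator 1 (q.1 + q.2))
        (h1.comp (by fun_prop))), withDensity_apply _ hs, ← lintegral_indicator hs]
  simp only [Pi.mul_apply]
  have e1 : ∀ x, ENNReal.ofReal (f x) * ∫⁻ y, s.indicator 1 (x + y) ∂ρ =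
      ∫⁻ y, ENNReal.ofReal (f x) * s.indicator 1 (x + y) ∂ρ := fun x =>
    (lintegral_const_mul _ (h1.comp (by fun_prop))).symm
  simp_rw [e1]
  rw [lintegral_lintegral_swap ((hfm.comp measurable_fst).mul
    (h1.comp (measurable_fst.add measurable_snd))).aemeasurable]
  have e2 : ∀ z : ℝ, ∫⁻ x, ENNReal.ofReal (f x) * s.indicator 1 (x + z) =
      ∫⁻ x, ENNReal.ofReal (f (x - z)) * s.indicator 1 x := fun z => by
    rw [← lintegral_sub_right_eq_self _ z]
    simp
  simp_rw [e2]
  rw [lintegral_lintegral_swap ((hfm.comp (measurable_snd.sub measurable_fst)).mul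
    (h1.comp measurable_snd)).aemeasurable]
  refine lintegral_congr fun x => ?_
  have hfx : Measurable fun z => ENNReal.ofReal (f (x - z)) := by fun_prop
  rw [lintegral_mul_const _ hfx,
    ← ofReal_integral_eq_lintegral_ofReal (hint x) (ae_of_all _ fun z => hf0 _)]
  by_cases hx : x ∈ s <;> simp [hx]

section SumLaw

variable {ι : Type*} [Fintype ι] (μ : ι → Measure ℝ) [∀ i, IsProbabilityMeasure (μ i)]

lemma charFun_sumLaw (s : ℝ) : charFun (sumLaw μ) s = ∏ i, charFun (μ i) s := by
  rw [sumLaw, charFun_map_sum_pi_eq_prod, Finset.prod_apply]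

lemma exists_density_sumLaw {f : ℝ → ℝ} (hf : Continuous f) (hf0 : ∀ x, 0 ≤ f x) {A : ℝ}
    (hA : ∀ x, f x ≤ A) (i₀ : ι) (hμ : μ i₀ = volume.withDensity fun x => ENNReal.ofReal (f x)) :
    ∃ p : ℝ → ℝ, Continuous p ∧ (∀ x, 0 ≤ p x) ∧ (∀ x, p x ≤ A) ∧
      sumLaw μ = volume.withDensity fun x => ENNReal.ofReal (p x) := by
  classical
  set μ' := Function.update μ i₀ (Measure.dirac 0) with hμ'
  have : ∀ i, IsProbabilityMeasure (μ' i) := fun i => by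
    by_cases hi : i = i₀
    · subst hi; simp [hμ']; infer_instance
    · simp [hμ', hi]; infer_instance
  obtain ⟨hc, hd⟩ := conv_withDensity_of_continuous hf hf0 hA (sumLaw μ')
  refine ⟨_, hc, fun x => integral_nonneg fun z => hf0 _, fun x => ?_, ?_⟩
  · calc _ ≤ ∫ _, A ∂(sumLaw μ') := integral_mono_of_nonneg (ae_of_all _ fun z => hf0 _)
          (integrable_const A) (ae_of_all _ fun z => hA _)
      _ = A := by simp
  · rw [← hd, ← hμ]
    refine Measure.ext_of_charFun (funext fun s => ?_)
    rw [charFun_conv, charFun_sumLaw, charFun_sumLaw,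
      ← Finset.mul_prod_erase _ _ (Finset.mem_univ i₀),
      ← Finset.mul_prod_erase _ (fun i => charFun (μ' i) s) (Finset.mem_univ i₀)]
    have h1 : charFun (μ' i₀) s = 1 := by simp [hμ', charFun_dirac]
    rw [h1, one_mul]
    congr 1
    refine Finset.prod_congr rfl fun i hi => ?_
    simp [hμ', Finset.ne_of_mem_erase hi]

variable {μ}

lemma integrable_sq_sumLaw (h2 : ∀ i, Integrable (fun x : ℝ => x ^ 2) (μ i)) (m : ℝ) :
    Integrable (fun x => (x - m) ^ 2) (sumLaw μ) := by
  rw [sumLaw, integrable_map_measure (by fun_prop) (by fun_prop)]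
  refine MemLp.integrable_sq (f := fun v : ι → ℝ => ∑ i, v i - m) (MemLp.sub ?_ (memLp_const m))
  refine memLp_finsetSum _ fun i _ => ?_
  have : MemLp (fun x : ℝ => x) 2 (μ i) := (memLp_two_iff_integrable_sq (by fun_prop)).2 (h2 i)
  exact this.comp_measurePreserving (measurePreserving_eval μ i)

lemma meanM_sumLaw (h1 : ∀ i, Integrable (fun x : ℝ => x) (μ i)) :
    meanM (sumLaw μ) = ∑ i, meanM (μ i) := by
  rw [meanM, sumLaw, integral_map (by fun_prop) (by fun_prop),
    integral_finsetSum _ fun i _ =>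
      integrable_comp_eval (X := fun _ => ℝ) (f := fun x : ℝ => x) (h1 i)]
  exact Finset.sum_congr rfl fun i _ =>
    integral_comp_eval (X := fun _ => ℝ) (f := fun x : ℝ => x) (by fun_prop)

lemma varM_sumLaw (h2 : ∀ i, Integrable (fun x : ℝ => x ^ 2) (μ i)) :
    varM (sumLaw μ) = ∑ i, varM (μ i) := by
  have h := variance_sum_pi (μ := μ) (X := fun _ => id)
    (fun i => (memLp_two_iff_integrable_sq (by fun_prop)).2 (h2 i))
  simp_rw [varM_eq_variance]
  rw [← h, sumLaw, variance_id_map (by fun_prop)]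
  congr 1
  ext v
  simp

lemma charFun_gaussM_sumLaw (h1 : ∀ i, Integrable (fun x : ℝ => x) (μ i))
    (h2 : ∀ i, Integrable (fun x : ℝ => x ^ 2) (μ i)) (s : ℝ) :
    charFun (gaussM (sumLaw μ)) s = ∏ i, charFun (gaussM (μ i)) s := by
  simp_rw [gaussM, charFun_gaussianReal]
  rw [← Complex.exp_sum, meanM_sumLaw h1, varM_sumLaw h2]
  simp_rw [Real.coe_toNNReal _ (varM_nonneg _)]
  rw [Real.coe_toNNReal _ (Finset.sum_nonneg fun i _ => varM_nonneg _)]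
  push_cast
  rw [Finset.sum_sub_distrib, Finset.mul_sum, Finset.sum_mul, Finset.sum_mul, Finset.sum_div]

end SumLaw

lemma varM_pos_of_withDensity {μ : Measure ℝ} [IsProbabilityMeasure μ] (hμ : μ ≪ volume)
    (h2 : ∀ m : ℝ, Integrable (fun x : ℝ => (x - m) ^ 2) μ) : 0 < varM μ := by
  refine (varM_nonneg μ).lt_of_ne' fun h => ?_
  have h1 := (integral_eq_zero_iff_of_nonneg (fun x => sq_nonneg (x - meanM μ)) (h2 _)).1 h
  have h3 : ∀ᵐ x ∂μ, x = meanM μ := by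
    filter_upwards [h1] with x hx
    have : (x - meanM μ) ^ 2 = 0 := hx
    linarith [pow_eq_zero_iff (two_ne_zero) |>.1 this]
  have h4 : μ {meanM μ} = 0 := hμ (by simp)
  have h5 : ∀ᵐ x ∂μ, False := by
    filter_upwards [h3, compl_mem_ae_iff.2 h4] with x hx hx'
    exact hx' hx
  simp only [eventually_false_iff_eq_bot, ae_eq_bot] at h5
  exact IsProbabilityMeasure.ne_zero μ h5

lemma Dm_map_div_const {P : Measure ℝ} [IsProbabilityMeasure P] (hP : P ≪ volume)
    (hv : 0 < varM P) {c : ℝ} (hc : 0 < c) :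
    Dm (P.map (· / c)) = Dm P := by
  have hm : meanM (P.map (· / c)) = meanM P / c := by
    rw [meanM, integral_map (by fun_prop) (by fun_prop), integral_div]
    rfl
  have hv' : varM (P.map (· / c)) = varM P / c ^ 2 := by
    rw [varM, integral_map (by fun_prop) (by fun_prop), hm, varM, ← integral_div]
    refine integral_congr_ae (ae_of_all _ fun x => ?_)
    change (x / c - meanM P / c) ^ 2 = _
    field_simp
  have hG : gaussianReal (meanM (P.map (· / c))) (Real.toNNReal (varM (P.map (· / c)))) =
      (gaussianReal (meanM P) (Real.toNNReal (varM P))).map (· / c) := by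
    rw [gaussianReal_map_div_const, hm, hv']
    congr 1
    rw [Real.toNNReal_div (varM_nonneg P)]
    congr 1
    exact Real.toNNReal_of_nonneg (sq_nonneg c)
  have he : MeasurableEmbedding (fun x : ℝ => x / c) :=
    by
    simp_rw [div_eq_mul_inv]
    exact measurableEmbedding_mulRight₀ (inv_ne_zero hc.ne')
  rw [Dm, hG, he.integral_map, Dm]
  have hPG : P ≪ gaussianReal (meanM P) (Real.toNNReal (varM P)) :=
    hP.trans (gaussianReal_absolutelyContinuous' _ (by simpa using hv))
  refine integral_congr_ae ?_
  filter_upwards [hPG.ae_le (he.rnDeriv_map P (gaussianReal (meanM P) (Real.toNNReal (varM P))))]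
    with x hx
  rw [llr, llr, hx]

section SumLaw

variable {ι : Type*} [Fintype ι] {μ : ι → Measure ℝ} [∀ i, IsProbabilityMeasure (μ i)]

lemma varM_sumLaw_pos {f : ℝ → ℝ} (h2 : ∀ i, Integrable (fun x : ℝ => x ^ 2) (μ i)) {i₀ : ι}
    (hμ : μ i₀ = volume.withDensity fun x => ENNReal.ofReal (f x)) : 0 < varM (sumLaw μ) := by
  rw [varM_sumLaw h2]
  refine Finset.sum_pos' (fun i _ => varM_nonneg _) ⟨i₀, Finset.mem_univ _,
    varM_pos_of_withDensity ?_ fun m => ?_⟩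
  · rw [hμ]
    exact withDensity_absolutelyContinuous _ _
  · refine MemLp.integrable_sq (f := fun x : ℝ => x - m) (MemLp.sub ?_ (memLp_const m))
    exact (memLp_two_iff_integrable_sq (by fun_prop)).2 (h2 i₀)

lemma Dm_sumLaw_bounds {f : ℝ → ℝ} (hf : Continuous f) (hf0 : ∀ x, 0 ≤ f x) {A : ℝ}
    (hA : ∀ x, f x ≤ A) (i₀ : ι) (hμ : μ i₀ = volume.withDensity fun x => ENNReal.ofReal (f x))
    (h3 : ∀ i, Integrable (fun x : ℝ => |x| ^ 3) (μ i)) :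
    0 ≤ Dm (sumLaw μ) ∧
    Dm (sumLaw μ) ≤ log (1 + A) + log (2 * π * (1 + ∑ i, cubeM (μ i))) / 2 + 1 / 2 := by
  have h2 := fun i => (integrable_pow_of_integrable_abs_cube (h3 i)).2
  obtain ⟨p, hp, hp0, hpA, hP⟩ := exists_density_sumLaw μ hf hf0 hA i₀ hμ
  have hvpos := varM_sumLaw_pos h2 hμ
  have hv : Real.toNNReal (varM (sumLaw μ)) ≠ 0 := by simpa using hvpos
  have hvc : (Real.toNNReal (varM (sumLaw μ)) : ℝ) = varM (sumLaw μ) :=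
    Real.coe_toNNReal _ hvpos.le
  refine ⟨integral_llr_gaussianReal_nonneg hp.measurable _ hv hP, ?_⟩
  refine (integral_llr_le_log hp.measurable (meanM (sumLaw μ)) hv hP (integrable_sq_sumLaw h2 _)
    hvc.symm ((hf0 0).trans (hA 0)) hpA).trans ?_
  have hle : varM (sumLaw μ) ≤ ∑ i, cubeM (μ i) := by
    rw [varM_sumLaw h2]
    exact Finset.sum_le_sum fun i _ => varM_le_cubeM (h3 i)
  rw [hvc]
  gcongr

lemma Dm_sumLaw_le_sqrt {f : ℝ → ℝ} (hf : Continuous f) (hf0 : ∀ x, 0 ≤ f x) {A : ℝ}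
    (hA : ∀ x, f x ≤ A) (i₀ : ι) (hμ : μ i₀ = volume.withDensity fun x => ENNReal.ofReal (f x))
    (h3 : ∀ i, Integrable (fun x : ℝ => |x| ^ 3) (μ i))
    (g : Finset ι) {c : ℝ} (hc : 0 < c)
    (hg : ∀ i ∈ g, (∀ s, ‖charFun (μ i) s‖ ^ 2 * (1 + c * s ^ 2) ≤ 1) ∧ c ≤ varM (μ i))
    {k : ℕ} (hk : 1 ≤ k) (hcard : 6 * k + 1 ≤ g.card) :
    Dm (sumLaw μ) ≤ 2 * √(cubeConst * (∑ i, cubeM (μ i)) / (k * c) ^ 2) *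
      √√(8 * π * ∑ i, cubeM (μ i)) := by
  have h1 := fun i => (integrable_pow_of_integrable_abs_cube (h3 i)).1
  have h2 := fun i => (integrable_pow_of_integrable_abs_cube (h3 i)).2
  obtain ⟨p, hp, hp0, hpA, hP⟩ := exists_density_sumLaw μ hf hf0 hA i₀ hμ
  have hvpos := varM_sumLaw_pos h2 hμ
  have hv : Real.toNNReal (varM (sumLaw μ)) ≠ 0 := by simpa using hvpos
  have hvc : (Real.toNNReal (varM (sumLaw μ)) : ℝ) = varM (sumLaw μ) :=
    Real.coe_toNNReal _ hvpos.le
  have hle : varM (sumLaw μ) ≤ ∑ i, cubeM (μ i) := by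
    rw [varM_sumLaw h2]
    exact Finset.sum_le_sum fun i _ => varM_le_cubeM (h3 i)
  have hS : 0 < ∑ i, cubeM (μ i) := hvpos.trans_le hle
  have hC := cubeConst_pos
  obtain ⟨hI, hB⟩ := integral_norm_prod_charFun_sub_le μ h3 g hc hg hk hcard
  simp_rw [← charFun_gaussM_sumLaw h1 h2, ← charFun_sumLaw] at hI hB
  have hd := density_le_gaussianPDFReal_add hp hp0 hP (meanM (sumLaw μ)) hv hI
  have hδ : ∀ x, p x ≤ gaussianPDFReal (meanM (sumLaw μ)) (Real.toNNReal (varM (sumLaw μ))) x +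
      cubeConst * (∑ i, cubeM (μ i)) / (k * c) ^ 2 := fun x => by
    refine (hd x).trans (add_le_add_right ?_ _)
    refine (mul_le_mul_of_nonneg_left hB (by positivity)).trans (le_of_eq ?_)
    field_simp
  refine (integral_llr_le_sqrt hp.measurable hp0 (meanM (sumLaw μ)) hv hP
    (integrable_sq_sumLaw h2 _) hvc.symm (by positivity) hδ).trans ?_
  rw [hvc]
  gcongr

lemma Dm_map_div_sumLaw {f : ℝ → ℝ} (hf : Continuous f) (hf0 : ∀ x, 0 ≤ f x) {A : ℝ}
    (hA : ∀ x, f x ≤ A) (i₀ : ι) (hμ : μ i₀ = volume.withDensity fun x => ENNReal.ofReal (f x))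
    (h3 : ∀ i, Integrable (fun x : ℝ => |x| ^ 3) (μ i)) {c : ℝ} (hc : 0 < c) :
    Dm ((sumLaw μ).map (· / c)) = Dm (sumLaw μ) := by
  obtain ⟨p, hp, hp0, hpA, hP⟩ := exists_density_sumLaw μ hf hf0 hA i₀ hμ
  refine Dm_map_div_const ?_
    (varM_sumLaw_pos (fun i => (integrable_pow_of_integrable_abs_cube (h3 i)).2) hμ) hc
  rw [hP]
  exact withDensity_absolutelyContinuous _ _

end SumLaw

lemma condSnLaw_eq (κ : Kernel ℝ ℝ) [IsMarkovKernel κ] (n : ℕ) (y : Fin n → ℝ) :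
    condSnLaw κ n y = (sumLaw fun i => κ (y i)).map (· / √n) := by
  rw [sumLaw, Measure.map_map (by fun_prop) (by fun_prop)]
  rfl

lemma one_sub_norm_charFun_two_mul_sq_le (μ : Measure ℝ) [IsProbabilityMeasure μ] (s : ℝ) :
    1 - ‖charFun μ (2 * s)‖ ^ 2 ≤ 4 * (1 - ‖charFun μ s‖ ^ 2) := by
  have : IsProbabilityMeasure (μ.map fun x => -x) :=
    Measure.isProbabilityMeasure_map (by fun_prop)
  set ρ := μ ∗ μ.map fun x => -x with hρ
  have hcos : ∀ t, Integrable (fun x => Real.cos (t * x)) ρ := fun t =>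
    Integrable.of_bound (by fun_prop) 1 (ae_of_all _ fun x => Real.abs_cos_le_one _)
  have h : ∀ t, ‖charFun μ t‖ ^ 2 = ∫ x, Real.cos (t * x) ∂ρ := by
    intro t
    have h1 : charFun ρ t = (‖charFun μ t‖ ^ 2 : ℝ) := by
      have h2 : charFun (μ.map fun x => -x) t = charFun μ (-t) := by
        have := charFun_map_mul (μ := μ) (-1) t
        simpa using this
      rw [hρ, charFun_conv, h2, charFun_neg, Complex.mul_conj, Complex.normSq_eq_norm_sq]
    have h2 := congrArg Complex.re h1
    rw [Complex.ofReal_re, charFun_apply_real] at h2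
    rw [← h2, ← RCLike.re_eq_complex_re, ← integral_re]
    · refine integral_congr_ae (ae_of_all _ fun x => ?_)
      simp only [RCLike.re_eq_complex_re]
      rw [← Complex.ofReal_mul, Complex.exp_ofReal_mul_I_re]
    · refine Integrable.of_bound (by fun_prop) 1 (ae_of_all _ fun y => ?_)
      rw [← Complex.ofReal_mul, Complex.norm_exp_ofReal_mul_I]
  rw [h, h]
  have hone : ∫ _, (1 : ℝ) ∂ρ = 1 := by simp
  have e1 : ∀ t, 1 - ∫ x, Real.cos (t * x) ∂ρ = ∫ x, (1 - Real.cos (t * x)) ∂ρ := fun t => by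
    rw [integral_sub (integrable_const _) (hcos t), hone]
  rw [e1, e1, ← integral_const_mul]
  refine integral_mono ((integrable_const _).sub (hcos _))
    (((integrable_const _).sub (hcos _)).const_mul _) fun x => ?_
  change 1 - Real.cos (2 * s * x) ≤ 4 * (1 - Real.cos (s * x))
  rw [mul_assoc, Real.cos_two_mul]
  nlinarith [sq_nonneg (1 - Real.cos (s * x))]

/-- A characteristic function decaying like `1/|s|` is bounded by `(1 + c s²)^{-1/2}`. -/
lemma norm_charFun_sq_mul_le {μ : Measure ℝ} [IsProbabilityMeasure μ] {T : ℝ} (hT : 0 < T)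
    (h : ∀ s, |s| * ‖charFun μ s‖ ≤ T) (s : ℝ) :
    ‖charFun μ s‖ ^ 2 * (1 + 1 / (16 * T ^ 2) * s ^ 2) ≤ 1 := by
  have hsq : ∀ s, s ^ 2 * ‖charFun μ s‖ ^ 2 ≤ T ^ 2 := fun s => by
    rw [← sq_abs, ← mul_pow]
    exact pow_le_pow_left₀ (by positivity) (h s) 2
  have hbig : ∀ s, 2 * T ^ 2 ≤ s ^ 2 → 1 / 2 ≤ 1 - ‖charFun μ s‖ ^ 2 := fun s hs => by
    have := hsq s
    have hT2 : 0 < T ^ 2 := by positivity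
    nlinarith [sq_nonneg ‖charFun μ s‖]
  have key : ∀ (j : ℕ) (s : ℝ), 2 * T ^ 2 ≤ 4 ^ j * s ^ 2 →
      min (1 / 2) (s ^ 2 / (16 * T ^ 2)) ≤ 1 - ‖charFun μ s‖ ^ 2 := by
    intro j
    induction j with
    | zero => exact fun s hs => (min_le_left _ _).trans (hbig s (by simpa using hs))
    | succ j ih =>
      intro s hs
      rcases le_or_gt (2 * T ^ 2) (s ^ 2) with h1 | h1
      · exact (min_le_left _ _).trans (hbig s h1)
      · have h2 := ih (2 * s) (by rw [pow_succ 4 j] at hs; linarith)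
        have h3 := one_sub_norm_charFun_two_mul_sq_le μ s
        have h4 : s ^ 2 / (16 * T ^ 2) ≤ 1 / 8 := by
          rw [div_le_div_iff₀ (by positivity) (by positivity)]
          linarith
        have h5 : (2 * s) ^ 2 / (16 * T ^ 2) = 4 * (s ^ 2 / (16 * T ^ 2)) := by ring
        rw [h5, min_eq_right (by linarith)] at h2
        exact (min_le_right _ _).trans (by linarith)
  rcases eq_or_ne s 0 with rfl | hs
  · simp
  obtain ⟨j, hj⟩ := pow_unbounded_of_one_lt (2 * T ^ 2 / s ^ 2) (by norm_num : (1 : ℝ) < 4)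
  have hs2 : 0 < s ^ 2 := by positivity
  have hk := key j s (by rw [div_lt_iff₀ hs2] at hj; exact hj.le)
  have hle1 : ‖charFun μ s‖ ^ 2 ≤ 1 := pow_le_one₀ (norm_nonneg _) (norm_charFun_le_one s)
  have e : ‖charFun μ s‖ ^ 2 * (1 + 1 / (16 * T ^ 2) * s ^ 2) =
      ‖charFun μ s‖ ^ 2 + ‖charFun μ s‖ ^ 2 * (s ^ 2 / (16 * T ^ 2)) := by ring
  rw [e]
  rcases min_le_iff.1 hk with h1 | h1
  · have h2 : ‖charFun μ s‖ ^ 2 * (s ^ 2 / (16 * T ^ 2)) ≤ 1 / 2 := by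
      rw [← mul_div_assoc, div_le_iff₀ (by positivity)]
      nlinarith [hsq s]
    linarith
  · have h2 : ‖charFun μ s‖ ^ 2 * (s ^ 2 / (16 * T ^ 2)) ≤ s ^ 2 / (16 * T ^ 2) :=
      mul_le_of_le_one_left (by positivity) hle1
    linarith

/-- The supremum of the average density of `μ` over intervals with rational endpoints. -/
def densSup (μ : Measure ℝ) : ℝ≥0∞ :=
  ⨆ q : ℚ × ℚ, μ (Set.Ioc (q.1 : ℝ) q.2) / ENNReal.ofReal (q.2 - q.1)

/-- The supremum of `|s| ‖charFun μ s‖` over rational `s`. -/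
def cfSup (μ : Measure ℝ) : ℝ≥0∞ := ⨆ s : ℚ, ENNReal.ofReal (|(s : ℝ)| * ‖charFun μ s‖)

lemma densSup_le {f f' : ℝ → ℝ} (h : HasACDeriv f f') (hf0 : ∀ x, 0 ≤ f x) {μ : Measure ℝ}
    [IsProbabilityMeasure μ] (hμ : μ = volume.withDensity fun x => ENNReal.ofReal (f x)) :
    densSup μ ≤ fisherInfoL f f' ^ (1 / 2 : ℝ) ∧ cfSup μ ≤ 2 * fisherInfoL f f' ^ (1 / 2 : ℝ) := by
  have hfm : Measurable f := h.continuous_s18.measurable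
  obtain ⟨hfi, -⟩ := integrable_of_isProbabilityMeasure_withDensity hfm hf0 hμ
  have hf1 : ∫⁻ x, ENNReal.ofReal (f x) = 1 := by
    have := measure_univ (μ := μ)
    rwa [hμ, withDensity_apply _ MeasurableSet.univ, setLIntegral_univ] at this
  have hJ := h.lintegral_le_fisherInfoL hf0 hf1
  refine ⟨iSup_le fun q => ?_, iSup_le fun s => ?_⟩
  · refine ENNReal.div_le_of_le_mul ?_
    rw [hμ, withDensity_apply _ measurableSet_Ioc]
    calc _ ≤ ∫⁻ _ in Set.Ioc (q.1 : ℝ) q.2, fisherInfoL f f' ^ (1 / 2 : ℝ) :=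
          lintegral_mono fun x => (h.ofReal_le_lintegral hfi x).trans hJ
      _ = _ := by simp
  · rw [hμ]
    exact (h.charFun_decay hf0 hfi s).trans (by gcongr)

lemma ofReal_le_densSup {f : ℝ → ℝ} (hf : Continuous f) {μ : Measure ℝ}
    (hμ : μ = volume.withDensity fun x => ENNReal.ofReal (f x)) (x : ℝ) :
    ENNReal.ofReal (f x) ≤ densSup μ := by
  refine le_of_forall_lt fun r hr => ?_
  have hcont : Continuous fun x => ENNReal.ofReal (f x) := ENNReal.continuous_ofReal.comp hf
  obtain ⟨r', hrr', hr'⟩ := exists_between hr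
  have hev := hcont.continuousAt.eventually (lt_mem_nhds hr')
  obtain ⟨ε, hε, hball⟩ := Metric.eventually_nhds_iff.1 hev
  obtain ⟨a, ha1, ha2⟩ := exists_rat_btwn (show x - ε < x by linarith)
  obtain ⟨b, hb1, hb2⟩ := exists_rat_btwn (show x < x + ε by linarith)
  refine hrr'.trans_le (le_trans ?_ (le_iSup _ (a, b)))
  have hab : (0 : ℝ) < b - a := by linarith
  rw [ENNReal.le_div_iff_mul_le (Or.inl (by simpa using hab)) (Or.inl ENNReal.ofReal_ne_top), hμ,
    withDensity_apply _ measurableSet_Ioc]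
  calc r' * ENNReal.ofReal (b - a) = ∫⁻ _ in Set.Ioc (a : ℝ) b, r' := by simp
    _ ≤ _ := by
      refine setLIntegral_mono hcont.measurable fun z hz => (hball ?_).le
      rw [Real.dist_eq, abs_lt]
      constructor <;> linarith [hz.1, hz.2]

lemma mul_norm_charFun_le_of_cfSup_le {μ : Measure ℝ} [IsProbabilityMeasure μ] {T : ℝ}
    (hT : 0 ≤ T) (h : cfSup μ ≤ ENNReal.ofReal T) (s : ℝ) : |s| * ‖charFun μ s‖ ≤ T := by
  have hc : Continuous fun s : ℝ => |s| * ‖charFun μ s‖ := by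
    have := continuous_charFun (μ := μ)
    fun_prop
  have hcl : IsClosed {s : ℝ | |s| * ‖charFun μ s‖ ≤ T} := isClosed_le hc continuous_const
  have hsub : Set.range ((↑) : ℚ → ℝ) ⊆ {s : ℝ | |s| * ‖charFun μ s‖ ≤ T} := by
    rintro _ ⟨q, rfl⟩
    exact (ENNReal.ofReal_le_ofReal_iff hT).1 ((le_iSup _ q).trans h)
  have := hcl.closure_subset_iff.2 hsub
  rw [Rat.denseRange_cast.closure_range] at this
  exact this (Set.mem_univ s)

section Measurability

variable (κ : Kernel ℝ ℝ)

lemma measurable_densSup : Measurable fun y => densSup (κ y) :=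
  Measurable.iSup fun _ => (κ.measurable_coe measurableSet_Ioc).div_const _

lemma measurable_charFun_kernel (s : ℝ) : Measurable fun y => charFun (κ y) s := by
  simp_rw [charFun_apply_real]
  refine StronglyMeasurable.measurable ?_
  exact StronglyMeasurable.integral_kernel (κ := κ)
    (f := fun x : ℝ => Complex.exp (s * x * Complex.I))
    (by fun_prop : Continuous _).stronglyMeasurable

lemma measurable_cfSup : Measurable fun y => cfSup (κ y) :=
  Measurable.iSup fun s => ((measurable_charFun_kernel κ s).norm.const_mul _).ennreal_ofReal

lemma measurable_cubeM : Measurable fun y => cubeM (κ y) := by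
  refine Measurable.const_add (StronglyMeasurable.measurable ?_) 1
  exact StronglyMeasurable.integral_kernel (κ := κ) (f := fun x : ℝ => |x| ^ 3)
    (by fun_prop : Continuous _).stronglyMeasurable

lemma measurable_varM [IsMarkovKernel κ] : Measurable fun y => varM (κ y) := by
  have hm : Measurable fun y => meanM (κ y) :=
    (StronglyMeasurable.integral_kernel (κ := κ) (f := fun x : ℝ => x)
      stronglyMeasurable_id).measurable
  refine StronglyMeasurable.measurable ?_
  exact StronglyMeasurable.integral_kernel_prod_right' (κ := κ)
    (f := fun q : ℝ × ℝ => (q.2 - meanM (κ q.1)) ^ 2) (by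
      have : Measurable fun q : ℝ × ℝ => (q.2 - meanM (κ q.1)) ^ 2 :=
        (measurable_snd.sub (hm.comp measurable_fst)).pow_const 2
      exact this.stronglyMeasurable)

end Measurability

lemma log_sq_le_sqrt_sqrt {x : ℝ} (hx : 1 ≤ x) : log x ^ 2 ≤ 64 * √√x := by
  have h0 : 0 < √√√x := by positivity
  have h1 : log x = 8 * log √√√x := by
    rw [Real.log_sqrt (by positivity), Real.log_sqrt (by positivity), Real.log_sqrt (by positivity)]
    ring
  have h2 : log x ≤ 8 * √√√x := by
    rw [h1]
    linarith [Real.log_le_sub_one_of_pos h0]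
  calc log x ^ 2 ≤ (8 * √√√x) ^ 2 := pow_le_pow_left₀ (Real.log_nonneg hx) h2 2
    _ = 64 * √√x := by rw [mul_pow, Real.sq_sqrt (by positivity)]; norm_num

lemma sqrt_sqrt_le_mul_div {n x : ℝ} (hn : 0 < n) (hx : n ≤ x) : √√x ≤ √√n * (x / n) := by
  have h1 : 1 ≤ x / n := (one_le_div hn).2 hx
  have h2 : √√x = √√n * √√(x / n) := by
    rw [← Real.sqrt_mul (by positivity), ← Real.sqrt_mul (by positivity), mul_div_cancel₀ _ hn.ne']
  have hs : √(x / n) ≤ x / n := Real.sqrt_le_iff.2 ⟨by linarith, by nlinarith⟩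
  have h3 : √√(x / n) ≤ x / n := (Real.sqrt_le_sqrt hs).trans hs
  rw [h2]
  gcongr

lemma log_bound_le {n S a F : ℝ} (hn : 1 ≤ n) (hS : n ≤ S) (ha : 0 ≤ a)
    (hF : F ≤ log (1 + a) + log (2 * π * (1 + S)) / 2 + 1 / 2) {Q : ℝ} (hQ : 1 ≤ Q) :
    F ≤ √n / 2 * Q + 3 / (2 * √n) * (a ^ 2 + 16 * (√√n * (2 * π * (1 + S) / n)) + 1 / 4) := by
  have hpi := Real.two_le_pi
  set x := 2 * π * (1 + S) with hx
  have hnx : n ≤ x := by nlinarith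
  have hl0 : 0 ≤ log (1 + a) := Real.log_nonneg (by linarith)
  have hla : log (1 + a) ≤ a := by
    linarith [Real.log_le_sub_one_of_pos (show 0 < 1 + a by linarith)]
  have hlx := (log_sq_le_sqrt_sqrt (hn.trans hnx)).trans
    (mul_le_mul_of_nonneg_left (sqrt_sqrt_le_mul_div (by linarith) hnx) (by norm_num))
  set W := log (1 + a) + log x / 2 + 1 / 2 with hW
  have hW2 : W ^ 2 ≤ 3 * (a ^ 2 + 16 * (√√n * (x / n)) + 1 / 4) := by
    have : log (1 + a) ^ 2 ≤ a ^ 2 := pow_le_pow_left₀ hl0 hla 2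
    rw [hW]
    nlinarith [sq_nonneg (log (1 + a) - log x / 2), sq_nonneg (log (1 + a) - 1 / 2),
      sq_nonneg (log x / 2 - 1 / 2)]
  have h1 : W ≤ √n / 2 + W ^ 2 / (2 * √n) := by
    rw [div_add_div _ _ (by norm_num) (by positivity), le_div_iff₀ (by positivity)]
    nlinarith [sq_nonneg (√n - W)]
  have h2 : W ^ 2 / (2 * √n) ≤ 3 / (2 * √n) * (a ^ 2 + 16 * (√√n * (x / n)) + 1 / 4) := by
    rw [div_mul_eq_mul_div]
    gcongr
  have h3 : √n / 2 ≤ √n / 2 * Q := le_mul_of_one_le_right (by positivity) hQ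
  linarith

/-- The bound on the relative entropy, in terms of the number `N` of good indices and of the
sum `S` of the third moments. -/
lemma entropy_bound_le {n N : ℕ} {S a F C c γ b : ℝ} (hγ : 0 < γ) (hb : 0 ≤ b) (hC : 0 ≤ C)
    (hc : 0 < c) (hnγ : 48 ≤ n * γ) (hn : 1 ≤ n) (hS : n ≤ S) (ha : 0 ≤ a)
    (hF1 : F ≤ log (1 + a) + log (2 * π * (1 + S)) / 2 + 1 / 2)
    (hF2 : ∀ k : ℕ, 1 ≤ k → 6 * k + 1 ≤ N → F ≤ 2 * √(C * S / (k * c) ^ 2) * √√(8 * π * S)) :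
    F ≤ 2 * √(C * (b + 1) * 48 ^ 2 / (γ * c) ^ 2) * √√(8 * π * (b + 1)) / √√n +
      √n / 2 * ((4 / γ ^ 2 * (N - n * γ) ^ 2 + (S - n * b) ^ 2) / n ^ 2) +
      3 / (2 * √n) * (a ^ 2 + 16 * (√√n * (2 * π * (1 + S) / n)) + 1 / 4) := by
  have hn1 : (1 : ℝ) ≤ n := by exact_mod_cast hn
  have hn0 : (0 : ℝ) < n := by linarith
  have hS0 : 0 < S := by linarith
  by_cases hgood : n * γ / 2 ≤ N ∧ S ≤ (b + 1) * n
  · obtain ⟨hN, hSb⟩ := hgood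
    set k := ⌊n * γ / 24⌋₊ with hk
    have hk1 : (k : ℝ) ≤ n * γ / 24 := Nat.floor_le (by positivity)
    have hk2 : n * γ / 24 < k + 1 := Nat.lt_floor_add_one _
    have hk3 : n * γ / 48 ≤ k := by linarith
    have hkpos : (0 : ℝ) < k := by linarith
    have hle := hF2 k (by exact_mod_cast hkpos) (by
      have : (6 * k + 1 : ℝ) ≤ N := by linarith
      exact_mod_cast this)
    have e1 : C * S / (k * c) ^ 2 ≤ C * (b + 1) * 48 ^ 2 / (γ * c) ^ 2 / n := by
      calc C * S / (k * c) ^ 2 ≤ C * ((b + 1) * n) / (n * γ / 48 * c) ^ 2 := by gcongr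
        _ = _ := by field_simp
    have e2 : √√(8 * π * S) ≤ √√(8 * π * (b + 1)) * √√n := by
      rw [← Real.sqrt_mul (by positivity), ← Real.sqrt_mul (by positivity)]
      refine Real.sqrt_le_sqrt (Real.sqrt_le_sqrt ?_)
      nlinarith [Real.pi_pos]
    have e3 : √(C * (b + 1) * 48 ^ 2 / (γ * c) ^ 2 / n) =
        √(C * (b + 1) * 48 ^ 2 / (γ * c) ^ 2) / √n := Real.sqrt_div' _ hn0.le
    have e4 := Real.sqrt_le_sqrt e1
    rw [e3] at e4
    have e5 : √(n : ℝ) = √√n * √√n := (Real.mul_self_sqrt (Real.sqrt_nonneg _)).symm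
    have e6 : F ≤ 2 * √(C * (b + 1) * 48 ^ 2 / (γ * c) ^ 2) * √√(8 * π * (b + 1)) / √√n := by
      refine hle.trans ?_
      calc _ ≤ 2 * (√(C * (b + 1) * 48 ^ 2 / (γ * c) ^ 2) / √n) *
            (√√(8 * π * (b + 1)) * √√n) := by gcongr
        _ = _ := by
          generalize √√(n : ℝ) = r at *
          rw [e5]
          field_simp
    refine e6.trans ?_
    rw [add_assoc]
    refine le_add_of_nonneg_right (by positivity)
  · have hQ : 1 ≤ (4 / γ ^ 2 * (N - n * γ) ^ 2 + (S - n * b) ^ 2) / (n : ℝ) ^ 2 := by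
      rw [one_le_div (by positivity)]
      rcases not_and_or.1 hgood with h | h
      · have h1 : (n * γ / 2) ^ 2 ≤ ((N : ℝ) - n * γ) ^ 2 := by
          rw [← neg_sq ((N : ℝ) - n * γ)]
          refine pow_le_pow_left₀ (by positivity) ?_ 2
          linarith [not_le.1 h]
        have h2 : 4 / γ ^ 2 * (n * γ / 2) ^ 2 = (n : ℝ) ^ 2 := by field_simp; norm_num
        have h3 : 4 / γ ^ 2 * (n * γ / 2) ^ 2 ≤ 4 / γ ^ 2 * ((N : ℝ) - n * γ) ^ 2 := by gcongr
        nlinarith [sq_nonneg (S - n * b)]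
      · have h1 : (n : ℝ) ^ 2 ≤ (S - n * b) ^ 2 := by
          refine pow_le_pow_left₀ (by positivity) ?_ 2
          linarith [not_le.1 h]
        have : 0 ≤ 4 / γ ^ 2 * ((N : ℝ) - n * γ) ^ 2 := by positivity
        linarith
    have := log_bound_le hn1 hS ha hF1 hQ
    rw [add_assoc]
    exact this.trans (le_add_of_nonneg_left (by positivity))

lemma integral_sq_sum_sub_pi {ι : Type*} [Fintype ι] (ν : Measure ℝ) [IsProbabilityMeasure ν]
    {h : ℝ → ℝ} (hh : MemLp h 2 ν) :
    Integrable (fun y : ι → ℝ => (∑ i, h (y i) - Fintype.card ι * ∫ y, h y ∂ν) ^ 2)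
      (Measure.pi fun _ => ν) ∧
    ∫ y : ι → ℝ, (∑ i, h (y i) - Fintype.card ι * ∫ y, h y ∂ν) ^ 2 ∂(Measure.pi fun _ => ν) =
      Fintype.card ι * Var[h; ν] := by
  have hL : MemLp (fun y : ι → ℝ => ∑ i, h (y i)) 2 (Measure.pi fun _ => ν) :=
    memLp_finsetSum _ fun i _ =>
      hh.comp_measurePreserving (measurePreserving_eval (fun _ : ι => ν) i)
  refine ⟨MemLp.integrable_sq (f := fun y : ι → ℝ => ∑ i, h (y i) - Fintype.card ι * ∫ y, h y ∂ν)
    (hL.sub (memLp_const _)), ?_⟩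
  have h1 := variance_sum_pi (μ := fun _ : ι => ν) (X := fun _ => h) (fun _ => hh)
  have h2 : (∑ i : ι, fun ω : ι → ℝ => h (ω i)) = fun y : ι → ℝ => ∑ i, h (y i) := by
    ext y; simp
  have hint : ∫ y : ι → ℝ, ∑ i, h (y i) ∂(Measure.pi fun _ => ν) =
      Fintype.card ι * ∫ y, h y ∂ν := by
    rw [integral_finsetSum _ fun i _ =>
      integrable_comp_eval (X := fun _ => ℝ) (f := h) (hh.integrable (by norm_num))]
    simp [integral_comp_eval (X := fun _ : ι => ℝ) (μ := fun _ => ν) hh.aestronglyMeasurable]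
  rw [h2, variance_eq_integral hL.aestronglyMeasurable.aemeasurable, hint] at h1
  simpa using h1

lemma ENNReal.sq_rpow_half_le (x : ℝ≥0∞) {u : ℝ} (hu : 1 ≤ u) :
    (x ^ (1 / 2 : ℝ)) ^ 2 ≤ 1 + x ^ u := by
  rw [← ENNReal.rpow_natCast, ← ENNReal.rpow_mul]
  norm_num
  rcases le_total x 1 with h | h
  · exact h.trans le_self_add
  · calc x = x ^ (1 : ℝ) := (ENNReal.rpow_one x).symm
      _ ≤ x ^ u := ENNReal.rpow_le_rpow_of_exponent_le h hu
      _ ≤ _ := le_add_self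

section Moments

variable {ν : Measure ℝ} {κ : Kernel ℝ ℝ}

lemma lintegral_densSup_sq_lt_top [IsProbabilityMeasure ν] [IsMarkovKernel κ] {f f' : ℝ → ℝ → ℝ}
    (hdens : ∀ᵐ y ∂ν, Measurable (f y) ∧ (∀ x, 0 ≤ f y x) ∧
      κ y = volume.withDensity (fun x => ENNReal.ofReal (f y x)) ∧ HasACDeriv (f y) (f' y))
    {u : ℝ} (hu : 1 ≤ u) (hmomJ : ∫⁻ y, (fisherInfoL (f y) (f' y)) ^ u ∂ν < ⊤) :
    ∫⁻ y, densSup (κ y) ^ 2 ∂ν < ⊤ ∧ ∀ᵐ y ∂ν, cfSup (κ y) < ⊤ := by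
  have hfin : ∫⁻ y, 4 * (1 + fisherInfoL (f y) (f' y) ^ u) ∂ν < ⊤ := by
    rw [lintegral_const_mul' _ _ (by norm_num), lintegral_add_left measurable_const]
    simpa [ENNReal.mul_lt_top_iff] using hmomJ
  have hbd : ∀ᵐ y ∂ν, densSup (κ y) ^ 2 ≤ 4 * (1 + fisherInfoL (f y) (f' y) ^ u) ∧
      cfSup (κ y) ^ 2 ≤ 4 * (1 + fisherInfoL (f y) (f' y) ^ u) := by
    filter_upwards [hdens] with y hy
    obtain ⟨h1, h2⟩ := densSup_le hy.2.2.2 hy.2.1 hy.2.2.1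
    have h3 := ENNReal.sq_rpow_half_le (fisherInfoL (f y) (f' y)) hu
    constructor
    · refine (pow_le_pow_left₀ zero_le h1 2).trans (h3.trans ?_)
      exact le_mul_of_one_le_left zero_le (by norm_num)
    · refine (pow_le_pow_left₀ zero_le h2 2).trans ?_
      rw [mul_pow]
      norm_num
      gcongr
  refine ⟨(lintegral_mono_ae (hbd.mono fun y h => h.1)).trans_lt hfin, ?_⟩
  have h4 := (lintegral_mono_ae (hbd.mono fun y h => h.2)).trans_lt hfin
  filter_upwards [ae_lt_top ((measurable_cfSup κ).pow_const 2) h4.ne] with y hy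
  exact (ENNReal.pow_lt_top_iff.1 hy).resolve_right (by norm_num)

lemma integrable_densSup_sq (h : ∫⁻ y, densSup (κ y) ^ 2 ∂ν < ⊤) :
    (∀ᵐ y ∂ν, densSup (κ y) < ⊤) ∧ Integrable (fun y => (densSup (κ y)).toReal ^ 2) ν := by
  have hm := (measurable_densSup κ).pow_const 2
  constructor
  · filter_upwards [ae_lt_top hm h.ne] with y hy
    exact (ENNReal.pow_lt_top_iff.1 hy).resolve_right (by norm_num)
  · simpa using integrable_toReal_of_lintegral_ne_top hm.aemeasurable h.ne

lemma memLp_cubeM [IsProbabilityMeasure ν] [IsMarkovKernel κ] {k : ℝ} (hk : 6 ≤ k)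
    (hmomX : ∫⁻ y, ∫⁻ x, ENNReal.ofReal (|x| ^ k) ∂(κ y) ∂ν < ⊤) :
    (∀ᵐ y ∂ν, Integrable (fun x => |x| ^ 3) (κ y)) ∧ MemLp (fun y => cubeM (κ y)) 2 ν := by
  have hkm : Measurable fun x : ℝ => |x| ^ k := by fun_prop
  have hm : Measurable fun y => ∫⁻ x, ENNReal.ofReal (|x| ^ k) ∂(κ y) :=
    hkm.ennreal_ofReal.lintegral_kernel
  have hk0 : ∀ x : ℝ, 0 ≤ |x| ^ k := fun x => by positivity
  have hpow : ∀ (x : ℝ) (j : ℕ), j ≤ 6 → |x| ^ j ≤ 1 + |x| ^ k := fun x j hj => by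
    rcases le_total |x| 1 with h | h
    · exact (pow_le_one₀ (abs_nonneg x) h).trans (by linarith [hk0 x])
    · have : |x| ^ (j : ℝ) ≤ |x| ^ k :=
        Real.rpow_le_rpow_of_exponent_le h (le_trans (by exact_mod_cast hj) hk)
      rw [Real.rpow_natCast] at this
      linarith
  have hae : ∀ᵐ y ∂ν, Integrable (fun x : ℝ => |x| ^ k) (κ y) := by
    filter_upwards [ae_lt_top hm hmomX.ne] with y hy
    exact (lintegral_ofReal_ne_top_iff_integrable hkm.aestronglyMeasurable
      (ae_of_all _ hk0)).1 hy.ne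
  have hint : ∀ y, Integrable (fun x : ℝ => |x| ^ k) (κ y) → ∀ j : ℕ, j ≤ 6 →
      Integrable (fun x : ℝ => |x| ^ j) (κ y) := fun y hy j hj =>
    ((integrable_const (1 : ℝ)).add hy).mono' (by fun_prop) (ae_of_all _ fun x => by
      rw [Real.norm_of_nonneg (by positivity)]
      exact hpow x j hj)
  refine ⟨hae.mono fun y hy => hint y hy 3 (by norm_num), ?_⟩
  rw [memLp_two_iff_integrable_sq (measurable_cubeM κ).aestronglyMeasurable]
  have hI : Integrable (fun y => 4 + 2 * (∫⁻ x, ENNReal.ofReal (|x| ^ k) ∂(κ y)).toReal) ν :=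
    (integrable_const _).add
      ((integrable_toReal_of_lintegral_ne_top hm.aemeasurable hmomX.ne).const_mul 2)
  refine hI.mono' ((measurable_cubeM κ).pow_const 2).aestronglyMeasurable ?_
  filter_upwards [hae] with y hy
  rw [Real.norm_of_nonneg (sq_nonneg _),
    ← integral_eq_lintegral_of_nonneg_ae (ae_of_all _ hk0) hkm.aestronglyMeasurable]
  have h6 := hint y hy 6 (by norm_num)
  have hsq : (∫ x, |x| ^ 3 ∂(κ y)) ^ 2 ≤ ∫ x, |x| ^ 6 ∂(κ y) := by
    have hL : MemLp (fun x : ℝ => |x| ^ 3) 2 (κ y) :=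
      (memLp_two_iff_integrable_sq (by fun_prop)).2 (h6.congr (ae_of_all _ fun x => by
        change |x| ^ 6 = (|x| ^ 3) ^ 2; ring))
    have h := variance_eq_sub hL
    have h0 := variance_nonneg (fun x : ℝ => |x| ^ 3) (κ y)
    have h7 : (κ y)[(fun x : ℝ => |x| ^ 3) ^ 2] = ∫ x, |x| ^ 6 ∂(κ y) :=
      integral_congr_ae (ae_of_all _ fun x => by change (|x| ^ 3) ^ 2 = |x| ^ 6; ring)
    rw [h7] at h
    linarith
  have hle : ∫ x, |x| ^ 6 ∂(κ y) ≤ 1 + ∫ x, |x| ^ k ∂(κ y) := by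
    have := integral_mono h6 ((integrable_const (1 : ℝ)).add hy) fun x => hpow x 6 le_rfl
    simpa [integral_add (integrable_const (1 : ℝ)) hy] using this
  unfold cubeM
  nlinarith [sq_nonneg (∫ x, |x| ^ 3 ∂(κ y) - 1)]

/-- Indices whose conditional law has a quantitatively decaying characteristic function and a
variance bounded below. -/
def goodSet (κ : Kernel ℝ ℝ) (m : ℕ) : Set ℝ :=
  {y | cfSup (κ y) ≤ ENNReal.ofReal (m + 1) ∧ 1 / ((m : ℝ) + 1) ≤ varM (κ y)}

lemma measurableSet_goodSet [IsMarkovKernel κ] (m : ℕ) : MeasurableSet (goodSet κ m) :=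
  (measurableSet_le (measurable_cfSup κ) measurable_const).inter
    (measurableSet_le measurable_const (measurable_varM κ))

lemma goodSet_spec [IsMarkovKernel κ] {m : ℕ} {y : ℝ} (hy : y ∈ goodSet κ m) :
    (∀ s, ‖charFun (κ y) s‖ ^ 2 * (1 + 1 / (16 * ((m : ℝ) + 1) ^ 2) * s ^ 2) ≤ 1) ∧
      1 / (16 * ((m : ℝ) + 1) ^ 2) ≤ varM (κ y) := by
  have hm : (0 : ℝ) < m + 1 := by positivity
  refine ⟨norm_charFun_sq_mul_le hm (mul_norm_charFun_le_of_cfSup_le hm.le hy.1), ?_⟩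
  refine le_trans ?_ hy.2
  refine one_div_le_one_div_of_le hm ?_
  nlinarith [(Nat.cast_nonneg m : (0 : ℝ) ≤ m)]

lemma exists_goodSet_pos [IsProbabilityMeasure ν]
    (h : ∀ᵐ y ∂ν, cfSup (κ y) < ⊤) (hv : ∀ᵐ y ∂ν, 0 < varM (κ y)) :
    ∃ m : ℕ, 0 < ν.real (goodSet κ m) := by
  by_contra! hcon
  have h0 : ∀ m : ℕ, ν (goodSet κ m) = 0 := fun m => by
    have := le_antisymm (hcon m) measureReal_nonneg
    exact (measureReal_eq_zero_iff).1 this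
  have h1 : ∀ᵐ y ∂ν, ∀ m, y ∉ goodSet κ m := ae_all_iff.2 fun m =>
    measure_eq_zero_iff_ae_notMem.1 (h0 m)
  have h2 : ∀ᵐ y ∂ν, False := by
    filter_upwards [h, hv, h1] with y hy hvy hno
    obtain ⟨m, hm⟩ := exists_nat_ge (max (cfSup (κ y)).toReal (1 / varM (κ y)))
    refine hno m ⟨?_, ?_⟩
    · rw [← ENNReal.ofReal_toReal hy.ne]
      exact ENNReal.ofReal_le_ofReal
        (by linarith [le_max_left (cfSup (κ y)).toReal (1 / varM (κ y))])
    · rw [one_div_le (by positivity) hvy]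
      linarith [le_max_right (cfSup (κ y)).toReal (1 / varM (κ y))]
  simp only [eventually_false_iff_eq_bot, ae_eq_bot] at h2
  exact IsProbabilityMeasure.ne_zero ν h2

end Moments

/-- The expectation of the upper bound in `entropy_bound_le` is of order `n^{-1/4}`. -/
lemma integral_entropy_bound_le {ν : Measure ℝ} [IsProbabilityMeasure ν] {a β : ℝ → ℝ}
    {G : Set ℝ} (hG : MeasurableSet G) (ha : Integrable (fun y => a y ^ 2) ν) (hβ : MemLp β 2 ν)
    {n : ℕ} (hn : 1 ≤ n) (i₀ : Fin n) {K γ : ℝ} (hγ : γ = ν.real G)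
    {B : (Fin n → ℝ) → ℝ}
    (hB : ∀ y, B y = K / √√n +
      √n / 2 * ((4 / γ ^ 2 * (∑ i, G.indicator 1 (y i) - n * γ) ^ 2 +
        (∑ i, β (y i) - n * ∫ y, β y ∂ν) ^ 2) / n ^ 2) +
      3 / (2 * √n) * (a (y i₀) ^ 2 + 16 * (√√n * (2 * π * (1 + ∑ i, β (y i)) / n)) + 1 / 4)) :
    Integrable B (Measure.pi fun _ => ν) ∧
    ∫ y, B y ∂(Measure.pi fun _ => ν) ≤
      (K + (4 / γ ^ 2 * Var[G.indicator 1; ν] + Var[β; ν]) / 2 +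
        3 / 2 * (∫ y, a y ^ 2 ∂ν + 32 * π * (1 + ∫ y, β y ∂ν) + 1 / 4)) / √√n := by
  have hGL : MemLp (G.indicator (1 : ℝ → ℝ)) 2 ν := (memLp_const (1 : ℝ)).indicator hG
  obtain ⟨i1, e1⟩ := integral_sq_sum_sub_pi (ι := Fin n) ν hGL
  obtain ⟨i2, e2⟩ := integral_sq_sum_sub_pi (ι := Fin n) ν hβ
  rw [integral_indicator_one hG, ← hγ, Fintype.card_fin] at i1 e1
  rw [Fintype.card_fin] at i2 e2
  have i3 : Integrable (fun y : Fin n → ℝ => a (y i₀) ^ 2) (Measure.pi fun _ => ν) :=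
    integrable_comp_eval (X := fun _ => ℝ) (f := fun y => a y ^ 2) ha
  have e3 : ∫ y : Fin n → ℝ, a (y i₀) ^ 2 ∂(Measure.pi fun _ => ν) = ∫ y, a y ^ 2 ∂ν :=
    integral_comp_eval (X := fun _ => ℝ) (μ := fun _ => ν) (f := fun y => a y ^ 2)
      ha.aestronglyMeasurable
  have i5 : ∀ i, Integrable (fun y : Fin n → ℝ => β (y i)) (Measure.pi fun _ => ν) := fun i =>
    integrable_comp_eval (X := fun _ => ℝ) (f := β) (hβ.integrable (by norm_num))
  have i4 : Integrable (fun y : Fin n → ℝ => ∑ i, β (y i)) (Measure.pi fun _ => ν) :=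
    integrable_finsetSum _ fun i _ => i5 i
  have e4 : ∫ y : Fin n → ℝ, ∑ i, β (y i) ∂(Measure.pi fun _ => ν) = n * ∫ y, β y ∂ν := by
    rw [integral_finsetSum _ fun i _ => i5 i]
    simp [integral_comp_eval (X := fun _ : Fin n => ℝ) (μ := fun _ => ν) hβ.aestronglyMeasurable]
  have j1 : Integrable (fun y : Fin n → ℝ => √n / 2 * ((4 / γ ^ 2 *
      (∑ i, G.indicator 1 (y i) - n * γ) ^ 2 + (∑ i, β (y i) - n * ∫ y, β y ∂ν) ^ 2) / n ^ 2))
      (Measure.pi fun _ => ν) := (((i1.const_mul _).add i2).div_const _).const_mul _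
  have j3 : Integrable (fun y : Fin n → ℝ => 16 * (√√n * (2 * π * (1 + ∑ i, β (y i)) / n)))
      (Measure.pi fun _ => ν) :=
    (((((integrable_const 1).add i4).const_mul _).div_const _).const_mul _).const_mul _
  have j4 : Integrable (fun y : Fin n → ℝ => a (y i₀) ^ 2 +
      16 * (√√n * (2 * π * (1 + ∑ i, β (y i)) / n))) (Measure.pi fun _ => ν) := i3.add j3
  have j2 : Integrable (fun y : Fin n → ℝ => 3 / (2 * √n) * (a (y i₀) ^ 2 +
      16 * (√√n * (2 * π * (1 + ∑ i, β (y i)) / n)) + 1 / 4)) (Measure.pi fun _ => ν) :=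
    (j4.add (integrable_const _)).const_mul _
  have hBf : B = _ := funext hB
  have j0 : Integrable (fun y : Fin n → ℝ => K / √√n +
      √n / 2 * ((4 / γ ^ 2 * (∑ i, G.indicator 1 (y i) - n * γ) ^ 2 +
        (∑ i, β (y i) - n * ∫ y, β y ∂ν) ^ 2) / n ^ 2)) (Measure.pi fun _ => ν) :=
    (integrable_const _).add j1
  refine ⟨hBf ▸ j0.add j2, ?_⟩
  rw [hBf, integral_add j0 j2, integral_add (integrable_const _) j1]
  have q1 : ∫ y : Fin n → ℝ, √n / 2 * ((4 / γ ^ 2 * (∑ i, G.indicator 1 (y i) - n * γ) ^ 2 +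
      (∑ i, β (y i) - n * ∫ y, β y ∂ν) ^ 2) / n ^ 2) ∂(Measure.pi fun _ => ν) =
      √n / 2 * ((4 / γ ^ 2 * (n * Var[G.indicator 1; ν]) + n * Var[β; ν]) / n ^ 2) := by
    rw [integral_const_mul, integral_div, integral_add (i1.const_mul _) i2, integral_const_mul,
      e1, e2]
  have q3 : ∫ y : Fin n → ℝ, 16 * (√√n * (2 * π * (1 + ∑ i, β (y i)) / n))
      ∂(Measure.pi fun _ => ν) = 16 * (√√n * (2 * π * (1 + n * ∫ y, β y ∂ν) / n)) := by
    rw [integral_const_mul, integral_const_mul, integral_div, integral_const_mul,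
      integral_add (integrable_const _) i4, e4]
    simp only [integral_const, probReal_univ, one_smul]
  rw [q1, integral_const_mul, integral_add j4 (integrable_const _), integral_add i3 j3, e3, q3]
  simp only [integral_const, probReal_univ, one_smul]
  have hV1 := variance_nonneg (G.indicator (1 : ℝ → ℝ)) ν
  have hV2 := variance_nonneg β ν
  have hE : 0 ≤ ∫ y, a y ^ 2 ∂ν := integral_nonneg fun _ => sq_nonneg _
  have hn1 : (1 : ℝ) ≤ n := by exact_mod_cast hn
  have hD : 0 ≤ 4 / γ ^ 2 * Var[G.indicator (1 : ℝ → ℝ); ν] := by positivity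
  generalize 4 / γ ^ 2 = D at *
  generalize Var[G.indicator (1 : ℝ → ℝ); ν] = V1 at *
  generalize Var[β; ν] = V2 at *
  generalize ∫ y, a y ^ 2 ∂ν = E at *
  generalize ∫ y, β y ∂ν = b at *
  obtain ⟨r, hr⟩ : ∃ r : ℝ, r = √√(n : ℝ) := ⟨_, rfl⟩
  have hr1 : 1 ≤ r := by
    rw [hr, Real.one_le_sqrt, Real.one_le_sqrt]
    exact hn1
  have hr0 : 0 < r := by linarith
  have h2 : √(n : ℝ) = r ^ 2 := by rw [hr, Real.sq_sqrt (Real.sqrt_nonneg _)]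
  have h4 : (n : ℝ) = r ^ 4 := by
    rw [← Real.sq_sqrt (Nat.cast_nonneg n : (0 : ℝ) ≤ n), h2]; ring
  rw [← hr, h2, h4, add_div _ _ r, add_div _ _ r]
  refine add_le_add (add_le_add le_rfl ?_) ?_
  · have : r ^ 2 / 2 * ((D * (r ^ 4 * V1) + r ^ 4 * V2) / (r ^ 4) ^ 2) =
        (D * V1 + V2) / 2 / r ^ 2 := by field_simp
    rw [this]
    exact div_le_div_of_nonneg_left (by positivity) hr0 (by nlinarith)
  · have : 3 / (2 * r ^ 2) * (E + 16 * (r * (2 * π * (1 + r ^ 4 * b) / r ^ 4)) + 1 / 4) =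
        3 / 2 * (E / r + 32 * π * (1 / r ^ 4 + b) + 1 / 4 / r) / r := by field_simp; ring
    rw [this]
    have hle1 : E / r ≤ E := div_le_self hE hr1
    have hle2 : (1 : ℝ) / 4 / r ≤ 1 / 4 := div_le_self (by norm_num) hr1
    have hle3 : 1 / r ^ 4 ≤ 1 := (div_le_one (by positivity)).2 (one_le_pow₀ hr1)
    have := Real.pi_pos
    gcongr

/-- **Theorem 3.3 (rate of convergence in the conditional CLT).** Let `(X, Y)` have joint law
`ν ⊗ₘ κ` (so `ν` is the law of `Y` and `κ y` the conditional law of `X` given `Y = y`), and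
let `(X_i, Y_i)` be i.i.d. copies, `S_n = (X₁ + ⋯ + Xₙ)/√n`, `𝐘_n = (Y₁, …, Y_n)`.  Assume:
(1) for `ν`-a.e. `y` the conditional law `κ y` has an absolutely continuous Lebesgue density
`f y` with derivative `f' y`;  (2) there are `u > 3`, `k > 6` with `E|X|^k < ∞`,
`E[J(X|Y)^u] < ∞` and `α := 6/k + 3/u < 1`.  Then for every `ε ∈ (0, (1-α)/(4+α))`,
`E D(S_n | 𝐘_n) = ∫ D(S_n | 𝐘_n = 𝐲) dP_{𝐘_n}(𝐲) = O(n^{-((1-α)/(4+α) - ε)})`. -/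
theorem conditional_clt_rate
    (ν : Measure ℝ) [IsProbabilityMeasure ν]
    (κ : Kernel ℝ ℝ) [IsMarkovKernel κ]
    (f f' : ℝ → ℝ → ℝ)
    (hdens : ∀ᵐ y ∂ν, Measurable (f y) ∧ (∀ x, 0 ≤ f y x) ∧
      κ y = volume.withDensity (fun x => ENNReal.ofReal (f y x)) ∧
      HasACDeriv (f y) (f' y))
    (u k : ℝ) (hu : 3 < u) (hk : 6 < k)
    (hmomX : ∫⁻ y, ∫⁻ x, ENNReal.ofReal (|x| ^ k) ∂(κ y) ∂ν < ⊤)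
    (hmomJ : ∫⁻ y, (fisherInfoL (f y) (f' y)) ^ u ∂ν < ⊤)
    (halpha : 6 / k + 3 / u < 1) :
    ∀ ε : ℝ, 0 < ε → ε < (1 - (6 / k + 3 / u)) / (4 + (6 / k + 3 / u)) →
      (fun n : ℕ => ∫ y, Dm (condSnLaw κ n y) ∂(Measure.pi fun _ : Fin n => ν))
        =O[atTop]
      (fun n : ℕ => (n : ℝ) ^ (-((1 - (6 / k + 3 / u)) / (4 + (6 / k + 3 / u)) - ε))) := by
  intro ε hε _
  obtain ⟨hA2, hcf⟩ := lintegral_densSup_sq_lt_top hdens (by linarith) hmomJ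
  obtain ⟨hAfin, hAint⟩ := integrable_densSup_sq hA2
  obtain ⟨hcube, hβ⟩ := memLp_cubeM hk.le hmomX
  have hvar : ∀ᵐ y ∂ν, 0 < varM (κ y) := by
    filter_upwards [hdens, hcube] with y hy h3
    refine varM_pos_of_withDensity ?_ fun m => ?_
    · rw [hy.2.2.1]
      exact withDensity_absolutelyContinuous _ _
    · refine MemLp.integrable_sq (f := fun x : ℝ => x - m) (MemLp.sub ?_ (memLp_const m))
      exact (memLp_two_iff_integrable_sq (by fun_prop)).2
        (integrable_pow_of_integrable_abs_cube h3).2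
  obtain ⟨m, hm⟩ := exists_goodSet_pos hcf hvar
  classical
  set G := goodSet κ m with hG
  have hGm : MeasurableSet G := measurableSet_goodSet m
  set γ := ν.real G with hγ
  set c : ℝ := 1 / (16 * ((m : ℝ) + 1) ^ 2) with hc
  have hcpos : 0 < c := by positivity
  set b := ∫ y, cubeM (κ y) ∂ν with hb
  have hb0 : 0 ≤ b := integral_nonneg fun y => zero_le_one.trans (one_le_cubeM _)
  set K := 2 * √(cubeConst * (b + 1) * 48 ^ 2 / (γ * c) ^ 2) * √√(8 * π * (b + 1)) with hK
  set K' := K + (4 / γ ^ 2 * Var[G.indicator 1; ν] + Var[fun y => cubeM (κ y); ν]) / 2 +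
    3 / 2 * (∫ y, (densSup (κ y)).toReal ^ 2 ∂ν + 32 * π * (1 + b) + 1 / 4) with hK'
  have hmain : ∀ n : ℕ, 48 ≤ n * γ → 1 ≤ n →
      0 ≤ ∫ y, Dm (condSnLaw κ n y) ∂(Measure.pi fun _ : Fin n => ν) ∧
      ∫ y, Dm (condSnLaw κ n y) ∂(Measure.pi fun _ : Fin n => ν) ≤ K' / √√n := by
    intro n hnγ hn
    set i₀ : Fin n := ⟨0, hn⟩
    have hall : ∀ {p : ℝ → Prop}, (∀ᵐ y ∂ν, p y) →
        ∀ᵐ y ∂(Measure.pi fun _ : Fin n => ν), ∀ i, p (y i) := fun {p} hp =>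
      ae_all_iff.2 fun i =>
        (measurePreserving_eval (fun _ : Fin n => ν) i).quasiMeasurePreserving.ae hp
    have hpt : ∀ᵐ y ∂(Measure.pi fun _ : Fin n => ν), 0 ≤ Dm (condSnLaw κ n y) ∧
        Dm (condSnLaw κ n y) ≤ K / √√n +
          √n / 2 * ((4 / γ ^ 2 * (∑ i, G.indicator 1 (y i) - n * γ) ^ 2 +
            (∑ i, cubeM (κ (y i)) - n * b) ^ 2) / n ^ 2) +
          3 / (2 * √n) * ((densSup (κ (y i₀))).toReal ^ 2 +
            16 * (√√n * (2 * π * (1 + ∑ i, cubeM (κ (y i))) / n)) + 1 / 4) := by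
      filter_upwards [hall hdens, hall hAfin, hall hcube] with y hd hA h3
      have hfc := (hd i₀).2.2.2.continuous_s18
      have hfA : ∀ x, f (y i₀) x ≤ (densSup (κ (y i₀))).toReal := fun x =>
        (ENNReal.ofReal_le_iff_le_toReal (hA i₀).ne).1 (ofReal_le_densSup hfc (hd i₀).2.2.1 x)
      have hsqrt : 0 < √(n : ℝ) := Real.sqrt_pos.2 (by exact_mod_cast hn)
      rw [condSnLaw_eq, Dm_map_div_sumLaw (μ := fun i => κ (y i)) hfc (hd i₀).2.1 hfA i₀
        (hd i₀).2.2.1 h3 hsqrt]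
      obtain ⟨h0, h1⟩ := Dm_sumLaw_bounds (μ := fun i => κ (y i)) hfc (hd i₀).2.1 hfA i₀
        (hd i₀).2.2.1 h3
      refine ⟨h0, ?_⟩
      have hN : ∑ i, G.indicator (1 : ℝ → ℝ) (y i) =
          ((Finset.univ.filter fun i => y i ∈ G).card : ℝ) := by
        simp [Set.indicator_apply]
      rw [hN]
      refine entropy_bound_le hm hb0 cubeConst_pos.le hcpos hnγ hn ?_ ENNReal.toReal_nonneg h1 ?_
      · calc (n : ℝ) = ∑ _i : Fin n, (1 : ℝ) := by simp
          _ ≤ _ := Finset.sum_le_sum fun i _ => one_le_cubeM _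
      · intro j hj hcard
        exact Dm_sumLaw_le_sqrt (μ := fun i => κ (y i)) hfc (hd i₀).2.1 hfA i₀ (hd i₀).2.2.1 h3
          (Finset.univ.filter fun i => y i ∈ G) hcpos
          (fun i hi => goodSet_spec (Finset.mem_filter.1 hi).2) hj hcard
    obtain ⟨hBi, hBle⟩ := integral_entropy_bound_le hGm hAint hβ hn i₀
      (K := K) hγ fun y => rfl
    exact ⟨integral_nonneg_of_ae (hpt.mono fun y h => h.1),
      (integral_mono_of_nonneg (hpt.mono fun y h => h.1) hBi (hpt.mono fun y h => h.2)).trans hBle⟩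
  have hk6 : 0 < 6 / k := div_pos (by norm_num) (by linarith)
  have hu3 : 0 < 3 / u := div_pos (by norm_num) (by linarith)
  have hr : (1 - (6 / k + 3 / u)) / (4 + (6 / k + 3 / u)) - ε ≤ 1 / 4 := by
    have : (1 - (6 / k + 3 / u)) / (4 + (6 / k + 3 / u)) ≤ 1 / 4 := by
      rw [div_le_div_iff₀ (by positivity) (by norm_num)]
      linarith
    linarith
  refine Asymptotics.IsBigO.of_bound |K'| ?_
  filter_upwards [eventually_ge_atTop 1, eventually_ge_atTop ⌈48 / γ⌉₊] with n hn hn2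
  have hn1 : (1 : ℝ) ≤ n := by exact_mod_cast hn
  obtain ⟨h0, h1⟩ := hmain n (by
    rw [← div_le_iff₀ hm]
    exact Nat.ceil_le.1 hn2) hn
  rw [Real.norm_of_nonneg h0, Real.norm_of_nonneg (by positivity)]
  refine h1.trans ?_
  have e : (√√(n : ℝ))⁻¹ = (n : ℝ) ^ (-(1 / 4) : ℝ) := by
    rw [Real.sqrt_eq_rpow, Real.sqrt_eq_rpow, ← Real.rpow_mul (by positivity),
      ← Real.rpow_neg (by positivity)]
    norm_num
  rw [div_eq_mul_inv, e]
  refine mul_le_mul (le_abs_self _) ?_ (by positivity) (abs_nonneg _)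
  exact Real.rpow_le_rpow_of_exponent_le hn1 (by linarith)
end
end
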